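/- Let q : ℝⁿ → ℝ be real analytic on a neighborhood of 0 with q(0) = 0, and assume there exist h > 0, an integer 0 ≤ l ≤ n−1, and r₀ > 0 such that for every 0 < r ≤ r₀ there is c_r > 0 with m({x : |x| < r, |q(x)| < ε}) = c_r ε^h (log(1/ε))^l + o(ε^h (log(1/ε))^l) as ε → 0⁺. Write h = 1/(m + γ) where m is a nonnegative integer and 0 < γ ≤ 1. Let s₁,…,s_m be linearly independent real analytic functions on a neighborhood of 0 with s_i(0) = 0 for each i. Then there exist positive constants C, δ, and r₁ < r₀ such that for every (η₁,…,η_m) ∈ ℝ^m with |η_i| < δ for each i and every 0 < ε < 1/2, m({x : |x| < r₁, |q(x) + Σ_{i=1}^m η_i s_i(x)| < ε}) ≤ C ε^h (log(1/ε))^l. Consequently, for every t > 0 with ∫_{\{|x| < r₀\}} |q(x)|^{−t} dx < ∞ there is a constant D_t such that ∫_{\{|x| < r₁\}} |q(x) + Σ_{i=1}^m η_i s_i(x)|^{−t} dx ≤ D_t for all such (η₁,…,η_m). -/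

import Mathlib

open MeasureTheory Filter Topology Asymptotics ENNReal

namespace SublevelStability

/-- The terms of the power series of the difference quotient of `p` along `e`. -/
noncomputable def quotientSeries {E : Type*} [NormedAddCommGroup E] [NormedSpace ℝ E]
    (p : FormalMultilinearSeries ℝ E ℝ) (P : E →L[ℝ] E) (e : E) :
    FormalMultilinearSeries ℝ E ℝ := fun k =>
  ∑ j : Fin (k + 1), ((p (k + 1)).curryMid j e).compContinuousLinearMap
    (fun l : Fin k => if l.castSucc < j then P else ContinuousLinearMap.id ℝ E)

theorem norm_quotientSeries_le {E : Type*} [NormedAddCommGroup E] [NormedSpace ℝ E]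
    (p : FormalMultilinearSeries ℝ E ℝ) (P : E →L[ℝ] E) (hP : ‖P‖ ≤ 1) (e : E) (k : ℕ) :
    ‖quotientSeries p P e k‖ ≤ (k + 1) * (‖p (k + 1)‖ * ‖e‖) := by
  unfold quotientSeries
  refine (norm_sum_le _ _).trans ?_
  have : ∀ j ∈ (Finset.univ : Finset (Fin (k + 1))),
      ‖((p (k + 1)).curryMid j e).compContinuousLinearMap
        (fun l : Fin k => if l.castSucc < j then P else ContinuousLinearMap.id ℝ E)‖
        ≤ ‖p (k + 1)‖ * ‖e‖ := by
    intro j _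
    refine (ContinuousMultilinearMap.norm_compContinuousLinearMap_le _ _).trans ?_
    have h1 : ‖(p (k + 1)).curryMid j e‖ ≤ ‖p (k + 1)‖ * ‖e‖ := by
      refine (((p (k + 1)).curryMid j).le_opNorm e).trans ?_
      gcongr
      exact le_of_eq (ContinuousMultilinearMap.norm_curryMid j (p (k + 1)))
    have h2 : ∏ l : Fin k, ‖(if l.castSucc < j then P else ContinuousLinearMap.id ℝ E)‖ ≤ 1 := by
      refine Finset.prod_le_one (fun _ _ => norm_nonneg _) ?_
      intro l _
      split_ifs
      · exact hP
      · exact ContinuousLinearMap.norm_id_le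
    calc _ ≤ (‖p (k + 1)‖ * ‖e‖) * 1 := by gcongr
      _ = _ := mul_one _
  refine (Finset.sum_le_sum this).trans ?_
  simp

theorem quotientSeries_apply {E : Type*} [NormedAddCommGroup E] [NormedSpace ℝ E]
    (p : FormalMultilinearSeries ℝ E ℝ) (P : E →L[ℝ] E) (e : E) (k : ℕ) (x : E) (c : ℝ)
    (hx : x - P x = c • e) :
    p (k + 1) (fun _ => x) - p (k + 1) (fun _ => P x)
      = c * quotientSeries p P e k (fun _ => x) := by
  set a : ℕ → ℝ := fun j => p (k + 1) (fun l : Fin (k + 1) => if (l : ℕ) < j then P x else x)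
    with ha
  have h0 : a 0 = p (k + 1) (fun _ => x) := by simp [ha]
  have h1 : a (k + 1) = p (k + 1) (fun _ => P x) := by
    simp only [ha]
    congr 1
    ext l
    simp [l.2]
  rw [← h0, ← h1, ← Finset.sum_range_sub', Finset.sum_range]
  simp only [quotientSeries, sum_apply, Finset.mul_sum]
  refine Finset.sum_congr rfl fun j _ => ?_
  have e1 : (fun l : Fin (k + 1) => if (l : ℕ) < j then P x else x)
      = Function.update (fun l : Fin (k + 1) => if (l : ℕ) < j then P x else x) j x := by
    ext l
    by_cases hl : l = j
    · subst hl; simp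
    · simp [hl]
  have e2 : (fun l : Fin (k + 1) => if (l : ℕ) < j + 1 then P x else x)
      = Function.update (fun l : Fin (k + 1) => if (l : ℕ) < j then P x else x) j (P x) := by
    ext l
    by_cases hl : l = j
    · subst hl; simp
    · have : (l : ℕ) ≠ j := fun h => hl (Fin.ext h)
      simp only [Function.update_of_ne hl]
      congr 1
      simp only [eq_iff_iff]
      omega
  simp only [ha]
  rw [e1, e2, ← ContinuousMultilinearMap.map_update_sub, hx,
    ContinuousMultilinearMap.map_update_smul, smul_eq_mul]
  congr 1
  rw [ContinuousMultilinearMap.compContinuousLinearMap_apply,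
    ContinuousMultilinearMap.curryMid_apply]
  congr 1
  ext l
  refine Fin.succAboveCases j ?_ (fun i => ?_) l
  · simp
  · rw [Function.update_of_ne (Fin.succAbove_ne j i), Fin.insertNth_apply_succAbove]
    by_cases h : i.castSucc < j
    · have h' : (i : ℕ) < j := h
      rw [Fin.succAbove_of_castSucc_lt _ _ h]
      simp [h', h]
    · have h' : ¬ ((i : ℕ) + 1 < j) := fun h'' => h (by rw [Fin.lt_def]; simp; omega)
      rw [Fin.succAbove_of_le_castSucc _ _ (not_lt.1 h)]
      simp [h', h]

theorem quotientSeries_radius_pos {E : Type*} [NormedAddCommGroup E] [NormedSpace ℝ E]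
    (p : FormalMultilinearSeries ℝ E ℝ) (hp : 0 < p.radius) (P : E →L[ℝ] E) (hP : ‖P‖ ≤ 1)
    (e : E) : 0 < (quotientSeries p P e).radius := by
  obtain ⟨r, hr0, hr⟩ := ENNReal.lt_iff_exists_nnreal_btwn.1 hp
  have hr0' : 0 < r := by exact_mod_cast hr0
  obtain ⟨C, hC, hb⟩ := p.norm_le_div_pow_of_pos_of_lt_radius hr0' hr
  have hr0'' : (0 : ℝ) < r := hr0'
  have key : ((r / 2 : NNReal) : ℝ≥0∞) ≤ (quotientSeries p P e).radius := by
    refine FormalMultilinearSeries.le_radius_of_bound _ (C / r * ‖e‖) fun k => ?_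
    have h1 := norm_quotientSeries_le p P hP e k
    have h2 := hb (k + 1)
    have h3 : ((k : ℝ) + 1) ≤ 2 ^ k := by
      have := Nat.lt_two_pow_self (n := k)
      exact_mod_cast this
    have h4 : ((r / 2 : NNReal) : ℝ) ^ k = r ^ k / 2 ^ k := by
      rw [NNReal.coe_div, div_pow]; norm_num
    rw [h4]
    calc ‖quotientSeries p P e k‖ * (r ^ k / 2 ^ k)
        ≤ (2 ^ k * (C / r ^ (k + 1) * ‖e‖)) * (r ^ k / 2 ^ k) := by
          gcongr
          exact h1.trans (by gcongr)
      _ = C / r * ‖e‖ := by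
          field_simp
          try ring
  refine lt_of_lt_of_le ?_ key
  have : (0 : NNReal) < r / 2 := by positivity
  exact_mod_cast this

/-- An analytic function is, up to a multiple of the linear form `ℓ`, the function obtained by
projecting along `e`. -/
theorem exists_analyticAt_sub_comp_eq_mul {E : Type*} [NormedAddCommGroup E] [NormedSpace ℝ E]
    {f : E → ℝ} (hf : AnalyticAt ℝ f 0) (P : E →L[ℝ] E) (hP : ‖P‖ ≤ 1) (e : E) (ℓ : E → ℝ)
    (h : ∀ x, x - P x = ℓ x • e) :
    ∃ g : E → ℝ, AnalyticAt ℝ g 0 ∧ ∀ᶠ x in 𝓝 0, f x = f (P x) + ℓ x * g x := by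
  obtain ⟨p, r, hp⟩ := hf
  have hrad : 0 < p.radius := hp.r_pos.trans_le hp.r_le
  have hq := quotientSeries_radius_pos p hrad P hP e
  have hg := (quotientSeries p P e).hasFPowerSeriesOnBall hq
  refine ⟨(quotientSeries p P e).sum, ⟨_, _, hg⟩, ?_⟩
  filter_upwards [Metric.eball_mem_nhds (0 : E) hp.r_pos, Metric.eball_mem_nhds (0 : E) hq]
    with x hx1 hx2
  have hPx : P x ∈ Metric.eball (0 : E) r := by
    rw [Metric.mem_eball, edist_zero_right] at hx1 ⊢
    refine lt_of_le_of_lt ?_ hx1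
    have := P.le_of_opNorm_le hP x
    rw [one_mul] at this
    exact enorm_le_iff_norm_le.2 this
  have s1 := hp.hasSum hx1
  have s2 := hp.hasSum hPx
  have s3 := (hg.hasSum hx2).mul_left (ℓ x)
  simp only [zero_add] at s1 s2 s3
  have s4 := s1.sub s2
  have s5 : HasSum (fun k => p (k + 1) (fun _ => x) - p (k + 1) (fun _ => P x))
      (ℓ x * (quotientSeries p P e).sum x) := by
    simpa only [quotientSeries_apply p P e _ x (ℓ x) (h x)] using s3
  rw [hasSum_nat_add_iff' (f := fun k => p k (fun _ => x) - p k (fun _ => P x)) 1 |>.symm] at s4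
  have := s4.unique s5
  simp only [Finset.range_one, Finset.sum_singleton] at this
  have h0 : p 0 (fun _ => x) = p 0 (fun _ => P x) := by
    congr 1; ext i; exact i.elim0
  rw [h0] at this
  linarith

/-- If a product of analytic germs vanishes, one of the factors vanishes. -/
theorem eventuallyEq_zero_or_of_mul {E : Type*} [NormedAddCommGroup E] [NormedSpace ℝ E]
    {f g : E → ℝ} {a : E} (hf : AnalyticAt ℝ f a) (hg : AnalyticAt ℝ g a)
    (h : ∀ᶠ x in 𝓝 a, f x * g x = 0) : (∀ᶠ x in 𝓝 a, f x = 0) ∨ ∀ᶠ x in 𝓝 a, g x = 0 := by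
  by_cases hf0 : ∀ᶠ x in 𝓝 a, f x = 0
  · exact Or.inl hf0
  right
  obtain ⟨r, hr, hball⟩ := Metric.eventually_nhds_iff_ball.1
    (h.and (hf.eventually_analyticAt.and hg.eventually_analyticAt))
  have hfreq : ∃ᶠ x in 𝓝 a, f x ≠ 0 := not_eventually.1 hf0
  obtain ⟨x, hx, hxb⟩ := (hfreq.and_eventually (Metric.ball_mem_nhds a hr)).exists
  have hgx : g =ᶠ[𝓝 x] 0 := by
    have h1 : ∀ᶠ y in 𝓝 x, f y ≠ 0 :=
      (hball x hxb).2.1.continuousAt.eventually_ne hx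
    filter_upwards [h1, Metric.isOpen_ball.mem_nhds hxb] with y hy hyb
    exact (mul_eq_zero.1 (hball y hyb).1).resolve_left hy
  have hga : AnalyticOnNhd ℝ g (Metric.ball a r) := fun y hy => (hball y hy).2.2
  have := hga.eqOn_zero_of_preconnected_of_eventuallyEq_zero
    (convex_ball a r).isPreconnected hxb hgx
  filter_upwards [Metric.ball_mem_nhds a hr] with y hy using this hy

/-- The monomial with exponents `β`. -/
noncomputable def mon {n : ℕ} (β : Fin n → ℕ) (x : Fin n → ℝ) : ℝ := ∏ i, x i ^ β i

theorem mon_zero {n : ℕ} (x : Fin n → ℝ) : mon 0 x = 1 := by simp [mon]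

theorem mon_add {n : ℕ} (β γ : Fin n → ℕ) (x : Fin n → ℝ) :
    mon (β + γ) x = mon β x * mon γ x := by
  simp [mon, pow_add, Finset.prod_mul_distrib]

theorem mon_smul {n : ℕ} (k : ℕ) (β : Fin n → ℕ) (x : Fin n → ℝ) :
    mon (k • β) x = mon β x ^ k := by
  simp [mon, pow_mul', Finset.prod_pow]

theorem mon_single {n : ℕ} (i : Fin n) (k : ℕ) (x : Fin n → ℝ) :
    mon (Pi.single i k) x = x i ^ k := by
  unfold mon
  rw [Finset.prod_eq_single i]
  · simp
  · intro j _ hj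
    simp [hj]
  · simp

theorem mon_eq_zero_iff {n : ℕ} (β : Fin n → ℕ) (x : Fin n → ℝ) :
    mon β x = 0 ↔ ∃ i, x i = 0 ∧ β i ≠ 0 := by
  simp [mon, Finset.prod_eq_zero_iff]

theorem mon_sub_mul {n : ℕ} {β γ : Fin n → ℕ} (h : β ≤ γ) (x : Fin n → ℝ) :
    mon γ x = mon β x * mon (γ - β) x := by
  rw [← mon_add, add_tsub_cancel_of_le h]

theorem mon_eq_mul_of_ne_zero {n : ℕ} {β : Fin n → ℕ} {i : Fin n} (h : β i ≠ 0)
    (x : Fin n → ℝ) : mon β x = x i * mon (β - Pi.single i 1) x := by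
  rw [mon_sub_mul (β := Pi.single i 1) (γ := β) ?_ x, mon_single, pow_one]
  intro j
  by_cases hj : j = i
  · subst hj; simp; omega
  · simp [hj]

theorem analyticAt_mon {n : ℕ} (β : Fin n → ℕ) (a : Fin n → ℝ) : AnalyticAt ℝ (mon β) a := by
  unfold mon
  have : (fun x : Fin n → ℝ => ∏ i, x i ^ β i) = ∏ i, fun x : Fin n → ℝ => x i ^ β i := by
    ext x; simp
  rw [this]
  refine Finset.analyticAt_prod _ fun i _ => ?_
  exact ((ContinuousLinearMap.proj (R := ℝ) (φ := fun _ : Fin n => ℝ) i).analyticAt a).pow _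

theorem analyticAt_coord {n : ℕ} (i : Fin n) (a : Fin n → ℝ) :
    AnalyticAt ℝ (fun x : Fin n → ℝ => x i) a :=
  (ContinuousLinearMap.proj (R := ℝ) (φ := fun _ : Fin n => ℝ) i).analyticAt a

theorem measurable_mon {n : ℕ} (β : Fin n → ℕ) : Measurable (mon β) := by
  unfold mon
  fun_prop

/-- `f` is a monomial times a unit near the origin. -/
def IsMon {n : ℕ} (f : (Fin n → ℝ) → ℝ) : Prop :=
  ∃ β : Fin n → ℕ, ∃ u : (Fin n → ℝ) → ℝ, AnalyticAt ℝ u 0 ∧ u 0 ≠ 0 ∧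
    ∀ᶠ x in 𝓝 0, f x = mon β x * u x

theorem IsMon.congr {n : ℕ} {f g : (Fin n → ℝ) → ℝ} (hf : IsMon f)
    (h : ∀ᶠ x in 𝓝 0, g x = f x) : IsMon g := by
  obtain ⟨β, u, hu, hu0, he⟩ := hf
  refine ⟨β, u, hu, hu0, ?_⟩
  filter_upwards [h, he] with x h1 h2
  rw [h1, h2]

theorem IsMon.of_ne_zero {n : ℕ} {f : (Fin n → ℝ) → ℝ} (hf : AnalyticAt ℝ f 0) (h : f 0 ≠ 0) :
    IsMon f := ⟨0, f, hf, h, by simp [mon_zero]⟩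

theorem isMon_mon {n : ℕ} (β : Fin n → ℕ) : IsMon (mon β) :=
  ⟨β, fun _ => 1, analyticAt_const, one_ne_zero, by simp⟩

theorem IsMon.mul {n : ℕ} {f g : (Fin n → ℝ) → ℝ} (hf : IsMon f) (hg : IsMon g) :
    IsMon fun x => f x * g x := by
  obtain ⟨β, u, hu, hu0, he⟩ := hf
  obtain ⟨γ, v, hv, hv0, hg⟩ := hg
  refine ⟨β + γ, fun x => u x * v x, hu.mul hv, mul_ne_zero hu0 hv0, ?_⟩
  filter_upwards [he, hg] with x h1 h2
  rw [h1, h2, mon_add]; ring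

/-- A punctured version of the diagonal approach to the origin avoiding the coordinates in `Z`. -/
theorem exists_zero_pattern {n : ℕ} {p : (Fin n → ℝ) → Prop} (hp : ∀ᶠ x in 𝓝 0, p x)
    (Z : Set (Fin n)) : ∃ x : Fin n → ℝ, p x ∧ ∀ i, x i = 0 ↔ i ∈ Z := by
  classical
  obtain ⟨r, hr, hb⟩ := Metric.eventually_nhds_iff_ball.1 hp
  refine ⟨fun i => if i ∈ Z then 0 else r / 2, hb _ ?_, fun i => ?_⟩
  · rw [Metric.mem_ball, dist_zero_right, pi_norm_lt_iff hr]
    intro i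
    split_ifs
    · simpa using hr
    · rw [Real.norm_of_nonneg (by positivity)]; linarith
  · by_cases h : i ∈ Z
    · simp [h]
    · simp [h, hr.ne']

theorem IsMon.not_eventually_zero {n : ℕ} {f : (Fin n → ℝ) → ℝ} (hf : IsMon f) :
    ¬ ∀ᶠ x in 𝓝 0, f x = 0 := by
  intro h
  obtain ⟨β, u, hu, hu0, he⟩ := hf
  obtain ⟨x, ⟨⟨h1, h2⟩, h3⟩, h4⟩ :=
    exists_zero_pattern ((h.and he).and (hu.continuousAt.eventually_ne hu0)) ∅
  rw [h1] at h2
  rcases mul_eq_zero.1 h2.symm with h | h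
  · obtain ⟨i, hi, _⟩ := (mon_eq_zero_iff _ _).1 h
    exact absurd hi (by simp [h4])
  · exact h3 h

/-- The projection killing the `i`-th coordinate. -/
noncomputable def dropCoord {n : ℕ} (i : Fin n) : (Fin n → ℝ) →L[ℝ] (Fin n → ℝ) :=
  ContinuousLinearMap.pi fun j => if j = i then 0 else ContinuousLinearMap.proj j

theorem dropCoord_apply {n : ℕ} (i : Fin n) (x : Fin n → ℝ) :
    dropCoord i x = Function.update x i 0 := by
  ext j
  by_cases h : j = i
  · subst h; simp [dropCoord]
  · simp [dropCoord, h]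

theorem norm_dropCoord_le {n : ℕ} (i : Fin n) : ‖dropCoord i‖ ≤ 1 := by
  refine ContinuousLinearMap.opNorm_le_bound _ zero_le_one fun x => ?_
  rw [one_mul, pi_norm_le_iff_of_nonneg (norm_nonneg _), dropCoord_apply]
  intro j
  by_cases h : j = i
  · subst h; simp
  · simpa [h] using norm_le_pi_norm x j

theorem exists_eq_update_add_mul {n : ℕ} {f : (Fin n → ℝ) → ℝ} (hf : AnalyticAt ℝ f 0)
    (i : Fin n) : ∃ g : (Fin n → ℝ) → ℝ, AnalyticAt ℝ g 0 ∧
      ∀ᶠ x in 𝓝 0, f x = f (Function.update x i 0) + x i * g x := by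
  have := exists_analyticAt_sub_comp_eq_mul hf (dropCoord i) (norm_dropCoord_le i)
    (Pi.single i 1) (fun x => x i) ?_
  · simpa only [dropCoord_apply] using this
  · intro x
    ext j
    rw [dropCoord_apply]
    by_cases h : j = i
    · subst h; simp
    · simp [h]

theorem tendsto_update_zero {n : ℕ} (i : Fin n) :
    Tendsto (fun x : Fin n → ℝ => Function.update x i 0) (𝓝 0) (𝓝 0) := by
  have h := (dropCoord i).continuous.tendsto 0
  simpa only [dropCoord_apply, map_zero] using
    (h.congr fun x => dropCoord_apply i x)

theorem analyticAt_comp_update_zero {n : ℕ} {f : (Fin n → ℝ) → ℝ} (hf : AnalyticAt ℝ f 0)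
    (i : Fin n) : AnalyticAt ℝ (fun x => f (Function.update x i 0)) 0 := by
  have h := hf.comp_of_eq ((dropCoord i).analyticAt 0) (map_zero _)
  simpa only [Function.comp_def, dropCoord_apply] using h

theorem eventually_eq_of_coord_mul_eq {n : ℕ} {f g : (Fin n → ℝ) → ℝ} (hf : AnalyticAt ℝ f 0)
    (hg : AnalyticAt ℝ g 0) (i : Fin n) (h : ∀ᶠ x in 𝓝 0, x i * f x = x i * g x) :
    ∀ᶠ x in 𝓝 0, f x = g x := by
  have h1 : ∀ᶠ x in 𝓝 (0 : Fin n → ℝ), x i * (f x - g x) = 0 := by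
    filter_upwards [h] with x hx
    linear_combination hx
  rcases eventuallyEq_zero_or_of_mul (analyticAt_coord i 0) (hf.sub hg) h1 with h2 | h2
  · have := (isMon_mon (Pi.single i 1)).not_eventually_zero
    exact absurd (by simpa [mon_single] using h2) this
  · filter_upwards [h2] with x hx
    simpa [sub_eq_zero] using hx

theorem IsMon.of_mul_left {n : ℕ} {f g : (Fin n → ℝ) → ℝ} (hf : AnalyticAt ℝ f 0)
    (hg : AnalyticAt ℝ g 0) (h : IsMon fun x => f x * g x) : IsMon f := by
  obtain ⟨β, u, hu, hu0, he⟩ := h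
  induction hN : ∑ i, β i generalizing β f g with
  | zero =>
    have hβ : β = 0 := by
      ext i
      simpa using (Finset.sum_eq_zero_iff.1 hN) i (Finset.mem_univ i)
    subst hβ
    have h0 := he.self_of_nhds
    rw [mon_zero, one_mul] at h0
    exact IsMon.of_ne_zero hf fun h => hu0 (by simpa [h] using h0.symm)
  | succ N ih =>
    have : ∃ i, β i ≠ 0 := by
      by_contra! hc
      simp [hc] at hN
    obtain ⟨i, hi⟩ := this
    have hsum : ∑ j, (β - Pi.single i 1 : Fin n → ℕ) j = N := by
      have h1 : (β - Pi.single i 1) + Pi.single i 1 = β := by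
        ext j
        by_cases hj : j = i
        · subst hj; simp; omega
        · simp [hj]
      have h2 := congrArg (fun γ : Fin n → ℕ => ∑ j, γ j) h1
      simp only [Pi.add_apply, Finset.sum_add_distrib, hN, Finset.sum_pi_single',
        Finset.mem_univ, if_true] at h2
      omega
    have hz : ∀ᶠ x in 𝓝 (0 : Fin n → ℝ),
        f (Function.update x i 0) * g (Function.update x i 0) = 0 := by
      filter_upwards [(tendsto_update_zero i).eventually he] with x hx
      rw [hx, (mon_eq_zero_iff _ _).2 ⟨i, by simp, hi⟩, zero_mul]
    rcases eventuallyEq_zero_or_of_mul (analyticAt_comp_update_zero hf i)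
      (analyticAt_comp_update_zero hg i) hz with h0 | h0
    · obtain ⟨f', hf', hfe⟩ := exists_eq_update_add_mul hf i
      have hfe' : ∀ᶠ x in 𝓝 0, f x = x i * f' x := by
        filter_upwards [hfe, h0] with x h1 h2
        rw [h1, h2, zero_add]
      have := ih hf' hg (β - Pi.single i 1) (eventually_eq_of_coord_mul_eq (hf'.mul hg)
        ((analyticAt_mon _ 0).mul hu) i ?_) hsum
      · refine ((isMon_mon (Pi.single i 1)).mul this).congr ?_
        simpa [mon_single] using hfe'
      · filter_upwards [he, hfe'] with x h1 h2
        rw [mon_eq_mul_of_ne_zero hi, h2] at h1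
        linear_combination h1
    · obtain ⟨g', hg', hge⟩ := exists_eq_update_add_mul hg i
      have hge' : ∀ᶠ x in 𝓝 0, g x = x i * g' x := by
        filter_upwards [hge, h0] with x h1 h2
        rw [h1, h2, zero_add]
      refine ih hf hg' (β - Pi.single i 1) (eventually_eq_of_coord_mul_eq (hf.mul hg')
        ((analyticAt_mon _ 0).mul hu) i ?_) hsum
      filter_upwards [he, hge'] with x h1 h2
      rw [mon_eq_mul_of_ne_zero hi, h2] at h1
      linear_combination h1

theorem IsMon.of_mul_right {n : ℕ} {f g : (Fin n → ℝ) → ℝ} (hf : AnalyticAt ℝ f 0)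
    (hg : AnalyticAt ℝ g 0) (h : IsMon fun x => f x * g x) : IsMon g :=
  IsMon.of_mul_left hg hf (h.congr (Eventually.of_forall fun _ => mul_comm _ _))

theorem IsMon.of_prod {n : ℕ} {ι : Type*} {s : Finset ι} {f : ι → (Fin n → ℝ) → ℝ}
    (hf : ∀ i ∈ s, AnalyticAt ℝ (f i) 0) (h : IsMon fun x => ∏ i ∈ s, f i x) {i : ι}
    (hi : i ∈ s) : IsMon (f i) := by
  classical
  refine IsMon.of_mul_left (g := fun x => ∏ j ∈ s.erase i, f j x) (hf i hi)
    (Finset.analyticAt_fun_prod _ fun j hj => hf j (Finset.mem_of_mem_erase hj)) ?_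
  exact h.congr (Eventually.of_forall fun x => Finset.mul_prod_erase s (fun j => f j x) hi)

/-- If the difference of two monomials with unit coefficients is zero or again such a monomial,
then one of the two monomials divides the other. -/
theorem le_or_le_of_sub {n : ℕ} {f g u v : (Fin n → ℝ) → ℝ} {a b : Fin n → ℕ}
    (hu : AnalyticAt ℝ u 0) (hu0 : u 0 ≠ 0) (hv : AnalyticAt ℝ v 0) (hv0 : v 0 ≠ 0)
    (hf : ∀ᶠ x in 𝓝 0, f x = mon a x * u x) (hg : ∀ᶠ x in 𝓝 0, g x = mon b x * v x)
    (h : (∀ᶠ x in 𝓝 0, f x - g x = 0) ∨ IsMon fun x => f x - g x) : a ≤ b ∨ b ≤ a := by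
  have hc : ∃ c : ℕ, ∃ γ : Fin n → ℕ, ∃ w : (Fin n → ℝ) → ℝ, AnalyticAt ℝ w 0 ∧
      (c = 0 ∨ (c = 1 ∧ w 0 ≠ 0)) ∧
      ∀ᶠ x in 𝓝 0, mon a x * u x - mon b x * v x = c * (mon γ x * w x) := by
    rcases h with h | ⟨γ, w, hw, hw0, h⟩
    · refine ⟨0, 0, 0, analyticAt_const, Or.inl rfl, ?_⟩
      filter_upwards [hf, hg, h] with x h1 h2 h3
      rw [← h1, ← h2, h3]; simp
    · refine ⟨1, γ, w, hw, Or.inr ⟨rfl, hw0⟩, ?_⟩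
      filter_upwards [hf, hg, h] with x h1 h2 h3
      rw [← h1, ← h2, h3]; simp
  obtain ⟨c, γ, w, hw, hcw, he⟩ := hc
  clear hf hg h f g
  induction hN : ∑ i, a i generalizing a b γ with
  | zero =>
    left
    intro i
    rw [(Finset.sum_eq_zero_iff.1 hN) i (Finset.mem_univ i)]
    exact Nat.zero_le _
  | succ N ih =>
    have hpat : ∀ Z : Set (Fin n), ∃ x : Fin n → ℝ,
        (mon a x * u x - mon b x * v x = c * (mon γ x * w x) ∧ u x ≠ 0 ∧ v x ≠ 0) ∧
          ∀ i, x i = 0 ↔ i ∈ Z := fun Z =>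
      exists_zero_pattern (he.and ((hu.continuousAt.eventually_ne hu0).and
        (hv.continuousAt.eventually_ne hv0))) Z
    have hvan : ∀ (Z : Set (Fin n)), (c = 0 ∨ ∃ i ∈ Z, γ i ≠ 0) →
        ((∃ i ∈ Z, a i ≠ 0) ↔ (∃ i ∈ Z, b i ≠ 0)) := by
      intro Z hZ
      obtain ⟨x, ⟨h1, h2, h3⟩, h4⟩ := hpat Z
      have h5 : (c : ℝ) * (mon γ x * w x) = 0 := by
        rcases hZ with rfl | ⟨i, hi, hi'⟩
        · simp
        · rw [(mon_eq_zero_iff _ _).2 ⟨i, (h4 i).2 hi, hi'⟩]; simp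
      rw [h5, sub_eq_zero] at h1
      have h6 : mon a x = 0 ↔ mon b x = 0 := by
        constructor <;> intro h
        · rw [h, zero_mul] at h1
          exact (mul_eq_zero.1 h1.symm).resolve_right h3
        · rw [h, zero_mul] at h1
          exact (mul_eq_zero.1 h1).resolve_right h2
      simpa only [mon_eq_zero_iff, h4] using h6
    by_cases hab : ∃ i, a i ≠ 0 ∧ b i ≠ 0
    · obtain ⟨i, hia, hib⟩ := hab
      have hle : ∀ d : Fin n → ℕ, d i ≠ 0 → (d - Pi.single i 1) + Pi.single i 1 = d := by
        intro d hd
        ext j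
        by_cases hj : j = i
        · subst hj; simp; omega
        · simp [hj]
      have hsum : ∑ j, (a - Pi.single i 1 : Fin n → ℕ) j = N := by
        have h2 := congrArg (fun γ : Fin n → ℕ => ∑ j, γ j) (hle a hia)
        simp only [Pi.add_apply, Finset.sum_add_distrib, hN, Finset.sum_pi_single',
          Finset.mem_univ, if_true] at h2
        omega
      have hcγ : c = 0 ∨ γ i ≠ 0 := by
        rcases hcw with hc | ⟨hc, hw0⟩
        · exact Or.inl hc
        right
        intro hγ
        obtain ⟨x, ⟨h1, h2⟩, h4⟩ := exists_zero_pattern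
          (he.and (hw.continuousAt.eventually_ne hw0)) {i}
        rw [(mon_eq_zero_iff a x).2 ⟨i, (h4 i).2 rfl, hia⟩,
          (mon_eq_zero_iff b x).2 ⟨i, (h4 i).2 rfl, hib⟩, hc] at h1
        have : mon γ x = 0 := by
          have h1' : mon γ x * w x = 0 := by simpa using h1.symm
          exact (mul_eq_zero.1 h1').resolve_right h2
        obtain ⟨j, hj, hj'⟩ := (mon_eq_zero_iff _ _).1 this
        have : j = i := by simpa using (h4 j).1 hj
        exact hj' (this ▸ hγ)
      have := ih (a := a - Pi.single i 1) (b := b - Pi.single i 1) (γ := γ - Pi.single i 1)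
        ?_ hsum
      · rw [← hle a hia, ← hle b hib]
        rcases this with h | h
        · exact Or.inl (add_le_add_left h _)
        · exact Or.inr (add_le_add_left h _)
      · refine eventually_eq_of_coord_mul_eq
          (((analyticAt_mon _ 0).mul hu).sub ((analyticAt_mon _ 0).mul hv))
          (analyticAt_const.mul ((analyticAt_mon _ 0).mul hw)) i ?_
        filter_upwards [he] with x hx
        rw [mon_eq_mul_of_ne_zero hia, mon_eq_mul_of_ne_zero hib] at hx
        rcases hcγ with rfl | hγ
        · simp only [Nat.cast_zero, zero_mul, mul_zero] at hx ⊢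
          linear_combination hx
        · rw [mon_eq_mul_of_ne_zero hγ] at hx
          linear_combination hx
    · push Not at hab
      by_cases hb : b = 0
      · right; rw [hb]; exact fun i => Nat.zero_le _
      exfalso
      have ha : ∃ l, a l ≠ 0 := by
        by_contra! hc
        simp [hc] at hN
      obtain ⟨l, hl⟩ := ha
      obtain ⟨l', hl'⟩ := Function.ne_iff.1 hb
      rcases hcw with hc | ⟨hc, hw0⟩
      · have := (hvan {l} (Or.inl hc)).1 ⟨l, rfl, hl⟩
        obtain ⟨j, rfl, hj⟩ := this
        exact hj (hab _ hl)
      · have hγ : ∃ i, γ i ≠ 0 := by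
          by_contra! hγ
          have h1 := he.self_of_nhds
          rw [(mon_eq_zero_iff a 0).2 ⟨l, rfl, hl⟩, (mon_eq_zero_iff b 0).2 ⟨l', rfl, hl'⟩,
            hc, show γ = 0 from funext hγ, mon_zero] at h1
          simp at h1
          exact hw0 h1.symm
        obtain ⟨i, hi⟩ := hγ
        by_cases hbi : b i = 0
        · obtain ⟨j, hj, hj'⟩ := (hvan {i, l} (Or.inr ⟨i, by simp, hi⟩)).1 ⟨l, by simp, hl⟩
          rcases hj with rfl | hj
          · exact hj' hbi
          · rw [Set.mem_singleton_iff.1 hj] at hj'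
            exact hj' (hab l hl)
        · obtain ⟨j, hj, hj'⟩ := (hvan {i} (Or.inr ⟨i, by simp, hi⟩)).2 ⟨i, by simp, hbi⟩
          rw [Set.mem_singleton_iff.1 hj] at hj'
          exact hbi (hab i hj')

theorem iteratedDeriv_succ_id_mul {f : ℝ → ℝ} (hf : AnalyticAt ℝ f 0) (j : ℕ) :
    iteratedDeriv (j + 1) (fun t => t * f t) 0 = (j + 1) * iteratedDeriv j f 0 := by
  rw [iteratedDeriv_fun_mul (f := fun t : ℝ => t) contDiffAt_fun_id hf.contDiffAt]
  rw [Finset.sum_eq_single 1]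
  · simp [iteratedDeriv_one]
  · intro i _ hi
    rcases i with _ | _ | i
    · simp
    · exact absurd rfl hi
    · have : iteratedDeriv (i + 1 + 1) (fun t : ℝ => t) 0 = 0 := by
        rw [iteratedDeriv_succ', iteratedDeriv_succ']
        simp
      simp [this]
  · simp

/-- Derivatives at the origin of a function given by a Taylor expansion with remainder. -/
theorem iteratedDeriv_of_taylor {k : ℕ} {f r : ℝ → ℝ} {a : ℕ → ℝ} (hr : AnalyticAt ℝ r 0)
    (h : ∀ᶠ t in 𝓝 0, f t = ∑ j ∈ Finset.range k, a j * t ^ j + t ^ k * r t) :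
    (∀ j < k, iteratedDeriv j f 0 = j.factorial * a j) ∧
      iteratedDeriv k f 0 = k.factorial * r 0 := by
  induction k generalizing f a with
  | zero =>
    refine ⟨fun j hj => absurd hj (Nat.not_lt_zero j), ?_⟩
    have : f =ᶠ[𝓝 0] r := by filter_upwards [h] with t ht; simpa using ht
    simpa using this.self_of_nhds
  | succ k ih =>
    set g : ℝ → ℝ := fun t => ∑ j ∈ Finset.range k, a (j + 1) * t ^ j + t ^ k * r t with hg
    have hga : AnalyticAt ℝ g 0 := by
      refine AnalyticAt.add (Finset.analyticAt_fun_sum _ fun j _ => ?_) ?_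
      · exact analyticAt_const.mul (analyticAt_id.pow _)
      · exact (analyticAt_id.pow _).mul hr
    obtain ⟨h1, h2⟩ := ih (f := g) (a := fun j => a (j + 1)) (Eventually.of_forall fun t => rfl)
    have hfg : f =ᶠ[𝓝 0] fun t => a 0 + t * g t := by
      filter_upwards [h] with t ht
      rw [ht, Finset.sum_range_succ', hg, mul_add, Finset.mul_sum]
      simp only [pow_succ, pow_zero, mul_one]
      rw [add_comm (Finset.sum _ _) (a 0), add_assoc]
      congr 2
      · exact Finset.sum_congr rfl fun j _ => by ring
      · ring
    have hs : ∀ j, iteratedDeriv (j + 1) f 0 = (j + 1) * iteratedDeriv j g 0 := by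
      intro j
      rw [hfg.iteratedDeriv_eq, iteratedDeriv_const_add (Nat.succ_pos j),
        iteratedDeriv_succ_id_mul hga]
    refine ⟨fun j hj => ?_, ?_⟩
    · rcases j with _ | j
      · simpa using hfg.self_of_nhds
      · rw [hs, h1 j (by omega), Nat.factorial_succ]; push_cast; ring
    · rw [hs, h2, Nat.factorial_succ]; push_cast; ring

theorem update_zero_eq_cons {n : ℕ} (x : Fin (n + 1) → ℝ) (t : ℝ) :
    Function.update x 0 t = Fin.cons t (Fin.tail x) := by
  conv_lhs => rw [← Fin.cons_self_tail x, Fin.update_cons_zero]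

theorem analyticAt_tail {n : ℕ} (a : Fin (n + 1) → ℝ) :
    AnalyticAt ℝ (fun x : Fin (n + 1) → ℝ => (Fin.tail x : Fin n → ℝ)) a :=
  AnalyticAt.pi fun i => analyticAt_coord i.succ a

theorem analyticAt_cons {E : Type*} [NormedAddCommGroup E] [NormedSpace ℝ E] {n : ℕ}
    {f : E → ℝ} {g : E → Fin n → ℝ} {a : E} (hf : AnalyticAt ℝ f a) (hg : AnalyticAt ℝ g a) :
    AnalyticAt ℝ (fun x => (Fin.cons (f x) (g x) : Fin (n + 1) → ℝ)) a := by
  refine AnalyticAt.pi fun i => ?_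
  refine Fin.cases ?_ (fun i => ?_) i
  · simpa using hf
  · simpa using (analyticAt_pi_iff.1 hg) i

theorem cons_zero_zero {n : ℕ} : (Fin.cons 0 0 : Fin (n + 1) → ℝ) = 0 := by
  ext i
  refine Fin.cases ?_ (fun i => ?_) i <;> simp

theorem tail_zero {n : ℕ} : (Fin.tail (0 : Fin (n + 1) → ℝ)) = 0 := rfl

theorem tendsto_tail_zero {n : ℕ} :
    Tendsto (fun x : Fin (n + 1) → ℝ => (Fin.tail x : Fin n → ℝ)) (𝓝 0) (𝓝 0) :=
  (analyticAt_tail 0).continuousAt.tendsto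

theorem analyticAt_axis {n : ℕ} :
    AnalyticAt ℝ (fun t : ℝ => (Fin.cons t 0 : Fin (n + 1) → ℝ)) 0 :=
  analyticAt_cons analyticAt_id analyticAt_const

/-- Taylor expansion with remainder in the first variable. -/
theorem exists_taylor {n : ℕ} {G : (Fin (n + 1) → ℝ) → ℝ} (hG : AnalyticAt ℝ G 0) (k : ℕ) :
    ∃ c : ℕ → (Fin n → ℝ) → ℝ, (∀ j, AnalyticAt ℝ (c j) 0) ∧
      ∃ U : (Fin (n + 1) → ℝ) → ℝ, AnalyticAt ℝ U 0 ∧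
        ∀ᶠ x in 𝓝 0, G x = ∑ j ∈ Finset.range k, c j (Fin.tail x) * x 0 ^ j + x 0 ^ k * U x := by
  induction k with
  | zero => exact ⟨fun _ _ => 0, fun _ => analyticAt_const, G, hG, by simp⟩
  | succ k ih =>
    obtain ⟨c, hc, U, hU, he⟩ := ih
    obtain ⟨V, hV, hUV⟩ := exists_eq_update_add_mul hU 0
    refine ⟨Function.update c k fun y => U (Fin.cons 0 y), fun j => ?_, V, hV, ?_⟩
    · by_cases hj : j = k
      · subst hj
        rw [Function.update_self]
        exact hU.comp_of_eq (analyticAt_cons analyticAt_const analyticAt_id) cons_zero_zero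
      · rw [Function.update_of_ne hj]; exact hc j
    · filter_upwards [he, hUV] with x h1 h2
      rw [h1, h2, Finset.sum_range_succ, Function.update_self, update_zero_eq_cons]
      have : ∀ j ∈ Finset.range k, Function.update c k (fun y => U (Fin.cons 0 y)) j = c j :=
        fun j hj => Function.update_of_ne (Finset.mem_range.1 hj).ne _ _
      have h3 : ∑ j ∈ Finset.range k, Function.update c k (fun y => U (Fin.cons 0 y)) j
          (Fin.tail x) * x 0 ^ j = ∑ j ∈ Finset.range k, c j (Fin.tail x) * x 0 ^ j :=
        Finset.sum_congr rfl fun j hj => by rw [this j hj]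
      rw [h3]
      ring

/-- `G` vanishes to order exactly `k` along the first coordinate axis. -/
def Reg {n : ℕ} (k : ℕ) (G : (Fin (n + 1) → ℝ) → ℝ) : Prop :=
  ∃ v : ℝ → ℝ, AnalyticAt ℝ v 0 ∧ v 0 ≠ 0 ∧ ∀ᶠ t in 𝓝 0, G (Fin.cons t 0) = t ^ k * v t

/-- An analytic function of order `k + 1` along the first axis can be expanded, after an analytic
translation of the first variable, without a term of degree `k`. -/
theorem Reg.exists_translate {n k : ℕ} {G : (Fin (n + 1) → ℝ) → ℝ} (hG : AnalyticAt ℝ G 0)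
    (h : Reg (k + 1) G) : ∃ θ : (Fin n → ℝ) → ℝ, AnalyticAt ℝ θ 0 ∧ θ 0 = 0 ∧
      ∃ c : ℕ → (Fin n → ℝ) → ℝ, (∀ j, AnalyticAt ℝ (c j) 0) ∧
      ∃ U : (Fin (n + 1) → ℝ) → ℝ, AnalyticAt ℝ U 0 ∧ U 0 ≠ 0 ∧ (∀ j < k, c j 0 = 0) ∧
        ∀ᶠ x in 𝓝 0, G (Fin.cons (x 0 + θ (Fin.tail x)) (Fin.tail x)) =
          ∑ j ∈ Finset.range k, c j (Fin.tail x) * x 0 ^ j + x 0 ^ (k + 1) * U x := by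
  obtain ⟨v, hv, hv0, hGv⟩ := h
  set G' : (Fin (n + 2) → ℝ) → ℝ := fun x =>
    G (Fin.cons (x 0 + (Fin.tail x : Fin (n + 1) → ℝ) 0) (Fin.tail (Fin.tail x))) with hG'
  have hin : AnalyticAt ℝ (fun x : Fin (n + 2) → ℝ =>
      (Fin.cons (x 0 + (Fin.tail x : Fin (n + 1) → ℝ) 0) (Fin.tail (Fin.tail x)) :
        Fin (n + 1) → ℝ)) 0 :=
    analyticAt_cons ((analyticAt_coord 0 0).add (analyticAt_coord (Fin.succ 0) 0))
      ((analyticAt_tail 0).comp_of_eq (analyticAt_tail 0) rfl)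
  have hG'a : AnalyticAt ℝ G' 0 := hG.comp_of_eq hin (by
    simp [tail_zero, cons_zero_zero])
  obtain ⟨C, hC, W, hW, he⟩ := exists_taylor hG'a (k + 1)
  set f : ℝ → ℝ := fun t => G (Fin.cons t 0) with hf
  have hfa : AnalyticAt ℝ f 0 := hG.comp_of_eq analyticAt_axis cons_zero_zero
  -- the coefficients on the axis are derivatives of `f`
  have hcoef : ∀ᶠ s in 𝓝 (0 : ℝ), (∀ j < k + 1, iteratedDeriv j f s =
      j.factorial * C j (Fin.cons s 0)) ∧
      iteratedDeriv (k + 1) f s = (k + 1).factorial * W (Fin.cons 0 (Fin.cons s 0)) := by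
    have hten : Tendsto (fun p : ℝ × ℝ => (Fin.cons p.1 (Fin.cons p.2 0) : Fin (n + 2) → ℝ))
        (𝓝 0 ×ˢ 𝓝 0) (𝓝 0) := by
      have h1 : AnalyticAt ℝ (fun p : ℝ × ℝ =>
          (Fin.cons p.1 (Fin.cons p.2 0) : Fin (n + 2) → ℝ)) 0 :=
        analyticAt_cons analyticAt_fst (analyticAt_cons analyticAt_snd analyticAt_const)
      have := h1.continuousAt.tendsto
      rw [← nhds_prod_eq]
      rw [← Prod.zero_eq_mk]
      simpa [cons_zero_zero] using this
    have h2 := hten.eventually (he.and hW.eventually_analyticAt)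
    obtain ⟨p, hp, p', hp', h3⟩ := Filter.eventually_prod_iff.1 h2
    filter_upwards [hp'] with s hs
    have h4 : ∀ᶠ t in 𝓝 (0 : ℝ), (fun t => f (t + s)) t = ∑ j ∈ Finset.range (k + 1),
        C j (Fin.cons s 0) * t ^ j + t ^ (k + 1) * (fun t => W (Fin.cons t (Fin.cons s 0))) t := by
      filter_upwards [hp] with t ht
      have := (h3 ht hs).1
      simpa [hG', Fin.tail_cons] using this
    have hWa : AnalyticAt ℝ (fun t => W (Fin.cons t (Fin.cons s 0))) 0 :=
      (h3 hp.self_of_nhds hs).2.comp_of_eq (analyticAt_cons analyticAt_id analyticAt_const) rfl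
    have h5 := iteratedDeriv_of_taylor hWa h4
    simp only [iteratedDeriv_comp_add_const, zero_add] at h5
    exact h5
  have hord : (∀ j < k + 1, iteratedDeriv j f 0 = 0) ∧
      iteratedDeriv (k + 1) f 0 = (k + 1).factorial * v 0 := by
    have := iteratedDeriv_of_taylor (a := 0) (f := f) hv
      (by filter_upwards [hGv] with t ht; simpa using ht)
    simpa using this
  have h0 := hcoef.self_of_nhds
  have hCj : ∀ j < k + 1, C j 0 = 0 := by
    intro j hj
    have := h0.1 j hj
    rw [hord.1 j hj, cons_zero_zero] at this
    have hne : (j.factorial : ℝ) ≠ 0 := by positivity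
    exact (mul_eq_zero.1 this.symm).resolve_left hne
  have hW0 : W 0 ≠ 0 := by
    have := h0.2
    rw [hord.2, cons_zero_zero, cons_zero_zero] at this
    have hne : ((k + 1).factorial : ℝ) ≠ 0 := by positivity
    rw [← mul_left_cancel₀ hne this]; exact hv0
  -- implicit function
  set H : (Fin n → ℝ) × ℝ → ℝ := fun p => C k (Fin.cons p.2 p.1) with hH
  have hHa : AnalyticAt ℝ H 0 :=
    (hC k).comp_of_eq (analyticAt_cons analyticAt_snd analyticAt_fst) cons_zero_zero
  have hderiv : HasDerivAt (fun s => H (0, s)) ((k + 1) * v 0) 0 := by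
    have h1 : HasDerivAt (iteratedDeriv k f) (iteratedDeriv (k + 1) f 0) 0 := by
      rw [iteratedDeriv_succ]
      apply DifferentiableAt.hasDerivAt
      rw [iteratedDeriv_eq_iterate]
      exact (hfa.iterated_deriv k).differentiableAt
    rw [hord.2] at h1
    have h2 : (fun s => H (0, s)) =ᶠ[𝓝 0] fun s => (k.factorial : ℝ)⁻¹ * iteratedDeriv k f s := by
      filter_upwards [hcoef] with s hs
      rw [hs.1 k (Nat.lt_succ_self k)]
      have hne : (k.factorial : ℝ) ≠ 0 := by positivity
      rw [inv_mul_cancel_left₀ hne]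
    refine ((h1.const_mul _).congr_of_eventuallyEq h2).congr_deriv ?_
    have hne : (k.factorial : ℝ) ≠ 0 := by positivity
    rw [Nat.factorial_succ]; push_cast; field_simp
  have hcd : ContDiffAt ℝ (⊤ : WithTop ℕ∞) H (0, 0) := hHa.contDiffAt
  have hinv : (fderiv ℝ H (0, 0) ∘SL
      ContinuousLinearMap.inr ℝ (Fin n → ℝ) ℝ).IsInvertible := by
    have h1 : HasDerivAt (fun s => H (0, s))
        (fderiv ℝ H (0, 0) (ContinuousLinearMap.inr ℝ (Fin n → ℝ) ℝ 1)) 0 := by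
      have h2 := hHa.differentiableAt.hasFDerivAt
      have h3 : HasDerivAt (fun s : ℝ => ((0 : Fin n → ℝ), s)) ((0 : Fin n → ℝ), (1 : ℝ)) 0 :=
        (hasDerivAt_const _ _).prodMk (hasDerivAt_id _)
      exact h2.comp_hasDerivAt (0 : ℝ) h3
    have h4 := h1.unique hderiv
    have hne : ((k : ℝ) + 1) * v 0 ≠ 0 := mul_ne_zero (by positivity) hv0
    refine ⟨ContinuousLinearEquiv.unitsEquivAut ℝ (Units.mk0 _ hne), ?_⟩
    ext
    simp [← h4]
  set θ := hcd.implicitFunction (by simp) hinv with hθ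
  have hθa : AnalyticAt ℝ θ 0 := (hcd.contDiffAt_implicitFunction (by simp) hinv).analyticAt
  have hθ0 : θ 0 = 0 := hcd.implicitFunction_apply_self (by simp) hinv
  have hθe : ∀ᶠ y in 𝓝 (0 : Fin n → ℝ), C k (Fin.cons (θ y) y) = 0 := by
    have := hcd.eventually_apply_implicitFunction (by simp) hinv
    filter_upwards [this] with y hy
    have h2 : H (0, 0) = 0 := by simp [hH, cons_zero_zero, hCj k (Nat.lt_succ_self k)]
    rw [h2] at hy
    exact hy
  have hca : AnalyticAt ℝ (fun y : Fin n → ℝ => (Fin.cons (θ y) y : Fin (n + 1) → ℝ)) 0 :=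
    analyticAt_cons hθa analyticAt_id
  have hca0 : (Fin.cons (θ 0) (0 : Fin n → ℝ) : Fin (n + 1) → ℝ) = 0 := by
    rw [hθ0, cons_zero_zero]
  have hxa : AnalyticAt ℝ (fun x : Fin (n + 1) → ℝ =>
      (Fin.cons (x 0) (Fin.cons (θ (Fin.tail x)) (Fin.tail x)) : Fin (n + 2) → ℝ)) 0 :=
    analyticAt_cons (analyticAt_coord 0 0)
      (analyticAt_cons (hθa.comp_of_eq (analyticAt_tail 0) rfl) (analyticAt_tail 0))
  have hxa0 : (Fin.cons ((0 : Fin (n + 1) → ℝ) 0) (Fin.cons (θ (Fin.tail (0 : Fin (n + 1) → ℝ)))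
      (Fin.tail (0 : Fin (n + 1) → ℝ))) : Fin (n + 2) → ℝ) = 0 := by
    rw [tail_zero, hca0, Pi.zero_apply, cons_zero_zero]
  refine ⟨θ, hθa, hθ0, fun j y => C j (Fin.cons (θ y) y), fun j => (hC j).comp_of_eq hca hca0,
    fun x => W (Fin.cons (x 0) (Fin.cons (θ (Fin.tail x)) (Fin.tail x))),
    hW.comp_of_eq hxa hxa0, ?_, ?_, ?_⟩
  · simpa only [hxa0] using hW0
  · intro j hj
    simpa only [hca0] using hCj j (by omega)
  · have hten : Tendsto (fun x : Fin (n + 1) → ℝ =>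
      (Fin.cons (x 0) (Fin.cons (θ (Fin.tail x)) (Fin.tail x)) : Fin (n + 2) → ℝ)) (𝓝 0) (𝓝 0) := by
      simpa only [ContinuousAt, hxa0] using hxa.continuousAt
    filter_upwards [hten.eventually he, tendsto_tail_zero.eventually hθe] with x h1 h2
    simp only [hG', Fin.tail_cons, Fin.cons_zero] at h1
    rw [h1, Finset.sum_range_succ, h2, zero_mul, add_zero]

/-- A nonzero analytic germ has finite order along some axis transversal to the tail. -/
theorem exists_shear_reg {n : ℕ} {F : (Fin (n + 1) → ℝ) → ℝ} (hF : AnalyticAt ℝ F 0)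
    (h : ¬ ∀ᶠ x in 𝓝 0, F x = 0) : ∃ v : Fin n → ℝ, ∃ k,
      Reg k fun x => F (Fin.cons (x 0) (Fin.tail x + x 0 • v)) := by
  obtain ⟨r, hr, hb⟩ := Metric.eventually_nhds_iff_ball.1 hF.eventually_analyticAt
  have hne : ∃ x ∈ Metric.ball (0 : Fin (n + 1) → ℝ) r, F x ≠ 0 ∧ x 0 ≠ 0 := by
    by_contra! hc
    have hz : ∀ᶠ x in 𝓝 (0 : Fin (n + 1) → ℝ), x 0 * F x = 0 := by
      filter_upwards [Metric.ball_mem_nhds 0 hr] with x hx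
      by_cases h0 : F x = 0
      · simp [h0]
      · simp [hc x hx h0]
    rcases eventuallyEq_zero_or_of_mul (analyticAt_coord 0 0) hF hz with h1 | h1
    · exact (isMon_mon (Pi.single (0 : Fin (n + 1)) 1)).not_eventually_zero
        (by simpa [mon_single] using h1)
    · exact h h1
  obtain ⟨x, hx, hFx, hx0⟩ := hne
  set v : Fin n → ℝ := (x 0)⁻¹ • Fin.tail x with hv
  have hline : ∀ t : ℝ, (Fin.cons t (t • v) : Fin (n + 1) → ℝ) = (t / x 0) • x := by
    intro t
    ext i
    refine Fin.cases ?_ (fun i => ?_) i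
    · simp [hx0]
    · simp [hv, Fin.tail, div_eq_mul_inv, mul_assoc]
  set f : ℝ → ℝ := fun t => F (Fin.cons t (t • v)) with hf
  have hfa : AnalyticAt ℝ f 0 := by
    refine hF.comp_of_eq (analyticAt_cons analyticAt_id
      (analyticAt_id.smul analyticAt_const)) ?_
    simp [cons_zero_zero]
  have hf0 : ¬ ∀ᶠ t in 𝓝 0, f t = 0 := by
    intro h0
    have hg : AnalyticOnNhd ℝ (fun s : ℝ => F (s • x)) (Set.Icc 0 1) := by
      intro s hs
      refine (hb (s • x) ?_).comp_of_eq (analyticAt_id.smul analyticAt_const) rfl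
      rw [Metric.mem_ball, dist_zero_right] at hx ⊢
      rw [norm_smul, Real.norm_of_nonneg hs.1]
      nlinarith [hs.2, norm_nonneg x]
    have h1 : (fun s : ℝ => F (s • x)) =ᶠ[𝓝 0] 0 := by
      have : Tendsto (fun s : ℝ => s * x 0) (𝓝 0) (𝓝 0) := by
        have : Continuous fun s : ℝ => s * x 0 := by fun_prop
        simpa using this.tendsto 0
      filter_upwards [this.eventually h0] with s hs
      rw [hf] at hs
      simp only [hline, mul_div_cancel_right₀ s hx0] at hs
      exact hs
    have := hg.eqOn_zero_of_preconnected_of_eventuallyEq_zero isPreconnected_Icc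
      (Set.left_mem_Icc.2 zero_le_one) h1 (Set.right_mem_Icc.2 zero_le_one)
    exact hFx (by simpa using this)
  obtain ⟨k, g, hg, hg0, he⟩ := hfa.exists_eventuallyEq_pow_smul_nonzero_iff.2 hf0
  refine ⟨v, k, g, hg, hg0, ?_⟩
  filter_upwards [he] with t ht
  simpa [hf] using ht

/-- An analytic map germ at the origin together with an analytic weight (its Jacobian) for which
the weighted pullback of integrals is bounded. -/
structure Chart (n : ℕ) where
  map : (Fin n → ℝ) → (Fin n → ℝ)
  jac : (Fin n → ℝ) → ℝ
  analyticAt_map : AnalyticAt ℝ map 0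
  map_zero : map 0 = 0
  measurable_map : Measurable map
  analyticAt_jac : AnalyticAt ℝ jac 0
  measurable_jac : Measurable jac
  exists_lintegral_le : ∃ C : ℝ≥0∞, C < ⊤ ∧ ∀ G : (Fin n → ℝ) → ℝ≥0∞, Measurable G →
    ∫⁻ x, G (map x) * ENNReal.ofReal |jac x| ≤ C * ∫⁻ x, G x

namespace Chart

variable {n : ℕ}

theorem tendsto_map (c : Chart n) : Tendsto c.map (𝓝 0) (𝓝 0) := by
  have := c.analyticAt_map.continuousAt.tendsto
  rwa [c.map_zero] at this

theorem analyticAt_comp (c : Chart n) {F : (Fin n → ℝ) → ℝ} (hF : AnalyticAt ℝ F 0) :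
    AnalyticAt ℝ (fun x => F (c.map x)) 0 :=
  hF.comp_of_eq c.analyticAt_map c.map_zero

/-- The weighted pullback of an integrand. -/
noncomputable def pull (c : Chart n) (G : (Fin n → ℝ) → ℝ≥0∞) (x : Fin n → ℝ) : ℝ≥0∞ :=
  G (c.map x) * ENNReal.ofReal |c.jac x|

theorem measurable_pull (c : Chart n) {G : (Fin n → ℝ) → ℝ≥0∞} (hG : Measurable G) :
    Measurable (c.pull G) :=
  (hG.comp c.measurable_map).mul (c.measurable_jac.abs.ennreal_ofReal)

/-- The identity chart. -/
noncomputable def refl (n : ℕ) : Chart n where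
  map := id
  jac := fun _ => 1
  analyticAt_map := analyticAt_id
  map_zero := rfl
  measurable_map := measurable_id
  analyticAt_jac := analyticAt_const
  measurable_jac := measurable_const
  exists_lintegral_le := ⟨1, one_lt_top, fun G _ => by simp⟩

/-- Composition of charts, with the product of the Jacobians. -/
noncomputable def comp (c d : Chart n) : Chart n where
  map := fun x => c.map (d.map x)
  jac := fun x => c.jac (d.map x) * d.jac x
  analyticAt_map := c.analyticAt_map.comp_of_eq d.analyticAt_map d.map_zero
  map_zero := by rw [d.map_zero, c.map_zero]
  measurable_map := c.measurable_map.comp d.measurable_map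
  analyticAt_jac := (d.analyticAt_comp c.analyticAt_jac).mul d.analyticAt_jac
  measurable_jac := (c.measurable_jac.comp d.measurable_map).mul d.measurable_jac
  exists_lintegral_le := by
    obtain ⟨C, hC, h⟩ := c.exists_lintegral_le
    obtain ⟨D, hD, h'⟩ := d.exists_lintegral_le
    refine ⟨D * C, mul_lt_top hD hC, fun G hG => ?_⟩
    calc ∫⁻ x, G (c.map (d.map x)) * ENNReal.ofReal |c.jac (d.map x) * d.jac x|
        = ∫⁻ x, c.pull G (d.map x) * ENNReal.ofReal |d.jac x| := by
          refine lintegral_congr fun x => ?_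
          rw [pull, abs_mul, ENNReal.ofReal_mul (abs_nonneg _), mul_assoc]
      _ ≤ D * ∫⁻ x, c.pull G x := h' _ (c.measurable_pull hG)
      _ ≤ D * (C * ∫⁻ x, G x) := by gcongr; exact h G hG
      _ = D * C * ∫⁻ x, G x := by rw [mul_assoc]

theorem pull_comp (c d : Chart n) (G : (Fin n → ℝ) → ℝ≥0∞) :
    (c.comp d).pull G = d.pull (c.pull G) := by
  ext x
  simp only [pull, comp]
  rw [abs_mul, ENNReal.ofReal_mul (abs_nonneg _), mul_assoc]

theorem setLIntegral_le_of_mem (c : Chart n)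
    {s : Set (Fin n → ℝ)} (hs : MeasurableSet s) {r : ℝ}
    (h : ∀ x, c.map x ∈ s → c.jac x ≠ 0 → x ∈ Metric.ball (0 : Fin n → ℝ) r)
    {G : (Fin n → ℝ) → ℝ≥0∞} (hc : ∫⁻ x, s.indicator G x ≤ ∫⁻ x, c.pull (s.indicator G) x) :
    ∫⁻ x in s, G x ≤ ∫⁻ x in Metric.ball 0 r, c.pull G x := by
  rw [← lintegral_indicator hs, ← lintegral_indicator Metric.isOpen_ball.measurableSet]
  refine hc.trans (lintegral_mono fun x => ?_)
  by_cases hx : c.map x ∈ s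
  · by_cases hj : c.jac x = 0
    · simp [pull, hj]
    · rw [Set.indicator_of_mem (h x hx hj)]
      simp [pull, hx]
  · simp [pull, hx]

end Chart

/-- A family of charts whose images cover a neighbourhood of the origin, in the sense of integrals
and for every choice of the radii of the charts. -/
def Covers {n : ℕ} (S : Set (Chart n)) : Prop :=
  ∀ r : Chart n → ℝ, (∀ c, 0 < r c) → ∃ L : List (Chart n), (∀ c ∈ L, c ∈ S) ∧ ∃ ρ : ℝ, 0 < ρ ∧
    ∀ G : (Fin n → ℝ) → ℝ≥0∞, Measurable G →
      ∫⁻ x in Metric.ball 0 ρ, G x ≤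
        (L.map fun c => ∫⁻ x in Metric.ball 0 (r c), c.pull G x).sum

theorem covers_refl (n : ℕ) : Covers {Chart.refl n} := fun r hr =>
  ⟨[Chart.refl n], by simp, r (Chart.refl n), hr _, fun G _ => by
    simp only [List.map_cons, List.map_nil, List.sum_cons, List.sum_nil, add_zero]
    simp [Chart.pull, Chart.refl]⟩

theorem Covers.bind {n : ℕ} {S : Set (Chart n)} (hS : Covers S) {T : Chart n → Set (Chart n)}
    (hT : ∀ c ∈ S, Covers (T c)) : Covers {e | ∃ c ∈ S, ∃ d ∈ T c, e = c.comp d} := by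
  classical
  intro r hr
  have h : ∀ c : Chart n, ∃ L : List (Chart n), ∃ ρ : ℝ, 0 < ρ ∧ (c ∈ S → (∀ d ∈ L, d ∈ T c) ∧
      ∀ G : (Fin n → ℝ) → ℝ≥0∞, Measurable G → ∫⁻ x in Metric.ball 0 ρ, G x ≤
        (L.map fun d => ∫⁻ x in Metric.ball 0 (r (c.comp d)), d.pull G x).sum) := by
    intro c
    by_cases hc : c ∈ S
    · obtain ⟨L, hL, ρ, hρ, hG⟩ := hT c hc (fun d => r (c.comp d)) fun d => hr _
      exact ⟨L, ρ, hρ, fun _ => ⟨hL, hG⟩⟩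
    · exact ⟨[], 1, one_pos, fun h => absurd h hc⟩
  choose L ρ hρ hL using h
  obtain ⟨M, hM, σ, hσ, hG⟩ := hS ρ hρ
  refine ⟨M.flatMap fun c => (L c).map c.comp, ?_, σ, hσ, fun G hGm => (hG G hGm).trans ?_⟩
  · intro e he
    obtain ⟨c, hc, d, hd, rfl⟩ : ∃ c ∈ M, ∃ d ∈ L c, c.comp d = e := by simpa using he
    exact ⟨c, hM c hc, d, (hL c (hM c hc)).1 d hd, rfl⟩
  · clear hG
    induction M with
    | nil => simp
    | cons c M ih =>
      rw [List.map_cons, List.sum_cons, List.flatMap_cons, List.map_append, List.sum_append]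
      refine add_le_add ?_ (ih fun d hd => hM d (by simp [hd]))
      refine ((hL c (hM c (by simp))).2 _ (c.measurable_pull hGm)).trans_eq ?_
      rw [List.map_map]
      congr 2
      ext d
      simp [Chart.pull_comp]

theorem measurable_cons {n : ℕ} :
    Measurable fun p : ℝ × (Fin n → ℝ) => (Fin.cons p.1 p.2 : Fin (n + 1) → ℝ) := by
  refine measurable_pi_iff.2 fun i => ?_
  refine Fin.cases ?_ (fun i => ?_) i
  · simpa using measurable_fst
  · simpa [Function.comp_def] using (measurable_pi_apply i).comp measurable_snd

theorem measurable_tail {n : ℕ} :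
    Measurable fun x : Fin (n + 1) → ℝ => (Fin.tail x : Fin n → ℝ) :=
  measurable_pi_iff.2 fun i => measurable_pi_apply i.succ

theorem measurePreserving_cons {n : ℕ} : MeasurePreserving
    (fun p : ℝ × (Fin n → ℝ) => (Fin.cons p.1 p.2 : Fin (n + 1) → ℝ)) volume volume := by
  have h := (volume_preserving_piFinSuccAbove (fun _ : Fin (n + 1) => ℝ) 0).symm
  have he : ⇑(MeasurableEquiv.piFinSuccAbove (fun _ : Fin (n + 1) => ℝ) 0).symm =
      fun p : ℝ × (Fin n → ℝ) => (Fin.cons p.1 p.2 : Fin (n + 1) → ℝ) := by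
    ext p i
    simp
  rwa [he] at h

theorem lintegral_cons {n : ℕ} {F : (Fin (n + 1) → ℝ) → ℝ≥0∞} (hF : Measurable F) :
    ∫⁻ x, F x = ∫⁻ t : ℝ, ∫⁻ y : Fin n → ℝ, F (Fin.cons t y) := by
  rw [← measurePreserving_cons.lintegral_comp hF]
  exact lintegral_prod _ (hF.comp measurable_cons).aemeasurable

theorem lintegral_cons_symm {n : ℕ} {F : (Fin (n + 1) → ℝ) → ℝ≥0∞} (hF : Measurable F) :
    ∫⁻ x, F x = ∫⁻ y : Fin n → ℝ, ∫⁻ t : ℝ, F (Fin.cons t y) := by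
  rw [← measurePreserving_cons.lintegral_comp hF]
  exact lintegral_prod_symm _ (hF.comp measurable_cons).aemeasurable

theorem cons_mem_ball {n : ℕ} {t : ℝ} {y : Fin n → ℝ} {r : ℝ} :
    (Fin.cons t y : Fin (n + 1) → ℝ) ∈ Metric.ball (0 : Fin (n + 1) → ℝ) r ↔
      t ∈ Metric.ball (0 : ℝ) r ∧ y ∈ Metric.ball (0 : Fin n → ℝ) r := by
  simp only [Metric.mem_ball, dist_zero_right]
  by_cases hr : 0 < r
  · rw [pi_norm_lt_iff hr, pi_norm_lt_iff hr, Fin.forall_fin_succ]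
    simp
  · exact ⟨fun h => absurd ((norm_nonneg _).trans_lt h) hr,
      fun h => absurd ((norm_nonneg _).trans_lt h.1) hr⟩

theorem setLIntegral_ball_cons {n : ℕ} {F : (Fin (n + 1) → ℝ) → ℝ≥0∞} (hF : Measurable F)
    (r : ℝ) : ∫⁻ x in Metric.ball 0 r, F x =
      ∫⁻ t in Metric.ball (0 : ℝ) r, ∫⁻ y in Metric.ball (0 : Fin n → ℝ) r, F (Fin.cons t y) := by
  have hb : MeasurableSet (Metric.ball (0 : Fin (n + 1) → ℝ) r) := Metric.isOpen_ball.measurableSet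
  rw [← lintegral_indicator hb, lintegral_cons (hF.indicator hb),
    ← lintegral_indicator Metric.isOpen_ball.measurableSet]
  refine lintegral_congr fun t => ?_
  by_cases ht : t ∈ Metric.ball (0 : ℝ) r
  · rw [Set.indicator_of_mem ht, ← lintegral_indicator Metric.isOpen_ball.measurableSet]
    refine lintegral_congr fun y => ?_
    by_cases hy : y ∈ Metric.ball (0 : Fin n → ℝ) r
    · rw [Set.indicator_of_mem hy, Set.indicator_of_mem (cons_mem_ball.2 ⟨ht, hy⟩)]
    · rw [Set.indicator_of_notMem hy, Set.indicator_of_notMem fun h => hy (cons_mem_ball.1 h).2]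
  · rw [Set.indicator_of_notMem ht]
    simp only [Set.indicator, cons_mem_ball, ht, false_and, if_false, lintegral_zero]

/-- A chart acting on the last variables only. -/
noncomputable def Chart.lift {n : ℕ} (c : Chart n) : Chart (n + 1) where
  map := fun x => Fin.cons (x 0) (c.map (Fin.tail x))
  jac := fun x => c.jac (Fin.tail x)
  analyticAt_map := analyticAt_cons (analyticAt_coord 0 0)
    (c.analyticAt_map.comp_of_eq (analyticAt_tail 0) rfl)
  map_zero := by rw [tail_zero, c.map_zero, Pi.zero_apply, cons_zero_zero]
  measurable_map := measurable_cons.comp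
    ((measurable_pi_apply 0).prodMk (c.measurable_map.comp measurable_tail))
  analyticAt_jac := c.analyticAt_jac.comp_of_eq (analyticAt_tail 0) rfl
  measurable_jac := c.measurable_jac.comp measurable_tail
  exists_lintegral_le := by
    obtain ⟨C, hC, h⟩ := c.exists_lintegral_le
    refine ⟨C, hC, fun G hG => ?_⟩
    have hm : Measurable fun x : Fin (n + 1) → ℝ =>
        (Fin.cons (x 0) (c.map (Fin.tail x)) : Fin (n + 1) → ℝ) :=
      measurable_cons.comp
        ((measurable_pi_apply 0).prodMk (c.measurable_map.comp measurable_tail))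
    rw [lintegral_cons, lintegral_cons hG, ← lintegral_const_mul' _ _ hC.ne]
    · refine lintegral_mono fun t => ?_
      simp only [Fin.cons_zero, Fin.tail_cons]
      exact h _ (hG.comp (measurable_cons.comp (measurable_const.prodMk measurable_id)))
    · exact (hG.comp hm).mul (c.measurable_jac.comp measurable_tail).abs.ennreal_ofReal

theorem Covers.lift {n : ℕ} {S : Set (Chart n)} (hS : Covers S) : Covers (Chart.lift '' S) := by
  intro r hr
  obtain ⟨L, hL, ρ, hρ, h⟩ := hS (fun c => r c.lift) fun c => hr _
  obtain ⟨σ, hσ, hσL⟩ : ∃ σ : ℝ, 0 < σ ∧ ∀ c ∈ L, σ ≤ r c.lift := by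
    clear h hL
    induction L with
    | nil => exact ⟨1, one_pos, by simp⟩
    | cons c L ih =>
      obtain ⟨σ, hσ, h⟩ := ih
      refine ⟨min σ (r c.lift), lt_min hσ (hr _), fun d hd => ?_⟩
      rcases List.mem_cons.1 hd with rfl | hd
      · exact min_le_right _ _
      · exact (min_le_left _ _).trans (h d hd)
  refine ⟨L.map Chart.lift, ?_, min ρ σ, lt_min hρ hσ, fun G hG => ?_⟩
  · intro e he
    obtain ⟨c, hc, rfl⟩ := List.mem_map.1 he
    exact ⟨c, hL c hc, rfl⟩
  rw [setLIntegral_ball_cons hG, List.map_map]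
  have h1 : ∀ t : ℝ, ∫⁻ y in Metric.ball (0 : Fin n → ℝ) (min ρ σ), G (Fin.cons t y) ≤
      (L.map fun c => ∫⁻ y in Metric.ball 0 (r c.lift), c.pull (fun y => G (Fin.cons t y)) y).sum :=
    fun t => (lintegral_mono_set (Metric.ball_subset_ball (min_le_left _ _))).trans
      (h _ (hG.comp (measurable_cons.comp (measurable_const.prodMk measurable_id))))
  refine (lintegral_mono h1).trans ?_
  clear h h1 hL
  induction L with
  | nil => simp
  | cons c L ih =>
    simp only [List.map_cons, List.sum_cons]
    have hm : Measurable fun p : ℝ × (Fin n → ℝ) => c.pull (fun y => G (Fin.cons p.1 y)) p.2 := by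
      unfold Chart.pull
      refine Measurable.mul ?_ (c.measurable_jac.comp measurable_snd).abs.ennreal_ofReal
      exact hG.comp (measurable_cons.comp (measurable_fst.prodMk (c.measurable_map.comp
        measurable_snd)))
    rw [lintegral_add_left (hm.lintegral_prod_right')]
    refine add_le_add ?_ (ih fun d hd => hσL d (by simp [hd]))
    rw [Function.comp_apply, setLIntegral_ball_cons (c.lift.measurable_pull hG)]
    refine (lintegral_mono_set (Metric.ball_subset_ball
      ((min_le_right _ _).trans (hσL c (by simp))))).trans_eq ?_
    rfl

/-- An analytic germ agrees with a globally measurable function near the base point. -/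
theorem exists_measurable_eventuallyEq {E : Type*} [NormedAddCommGroup E] [NormedSpace ℝ E]
    [MeasurableSpace E] [BorelSpace E] {f : E → ℝ} {a : E} (hf : AnalyticAt ℝ f a) :
    ∃ g : E → ℝ, Measurable g ∧ AnalyticAt ℝ g a ∧ ∀ᶠ x in 𝓝 a, g x = f x := by
  classical
  obtain ⟨r, hr, hb⟩ := Metric.eventually_nhds_iff_ball.1 hf.eventually_analyticAt
  have he : ∀ᶠ x in 𝓝 a, (Metric.ball a r).piecewise f 0 x = f x := by
    filter_upwards [Metric.ball_mem_nhds a hr] with x hx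
    simp [hx]
  refine ⟨(Metric.ball a r).piecewise f 0, ?_, hf.congr ?_, he⟩
  · exact ContinuousOn.measurable_piecewise
      (fun x hx => (hb x hx).continuousAt.continuousWithinAt) continuousOn_const
      Metric.isOpen_ball.measurableSet
  · filter_upwards [he] with x hx using hx.symm

theorem setLIntegral_le_sum_of_subset {α ι : Type*} [MeasurableSpace α] {μ : Measure α}
    (L : List ι) (s : ι → Set α) {t N : Set α} (hN : μ N = 0) (h : t ⊆ N ∪ ⋃ i ∈ L, s i)
    (G : α → ℝ≥0∞) : ∫⁻ x in t, G x ∂μ ≤ (L.map fun i => ∫⁻ x in s i, G x ∂μ).sum := by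
  induction L generalizing t with
  | nil =>
    have : μ t = 0 := measure_mono_null (h.trans (by simp)) hN
    simp [Measure.restrict_eq_zero.2 this]
  | cons a L ih =>
    rw [List.map_cons, List.sum_cons]
    have h1 : t ⊆ s a ∪ (t \ s a) := by
      intro x hx
      by_cases hxs : x ∈ s a
      · exact Or.inl hxs
      · exact Or.inr ⟨hx, hxs⟩
    refine ((lintegral_mono_set h1).trans (lintegral_union_le _ _ _)).trans ?_
    refine add_le_add le_rfl (ih ?_)
    intro x hx
    rcases h hx.1 with hx' | hx'
    · exact Or.inl hx'
    · right
      simp only [List.mem_cons, Set.mem_iUnion, exists_prop] at hx' ⊢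
      obtain ⟨i, rfl | hi, hxi⟩ := hx'
      · exact absurd hxi hx.2
      · exact ⟨i, hi, hxi⟩

theorem volume_coord_eq_zero {n : ℕ} (i : Fin n) :
    volume {x : Fin n → ℝ | x i = 0} = 0 :=
  Measure.pi_hyperplane (fun _ => volume) i 0

section exact

variable {n : ℕ}

theorem covers_singleton_of_inverse (c : Chart n)
    (hc : ∀ G : (Fin n → ℝ) → ℝ≥0∞, Measurable G → ∫⁻ x, c.pull G x = ∫⁻ x, G x)
    {ψ : (Fin n → ℝ) → (Fin n → ℝ)} (hψ : Tendsto ψ (𝓝 0) (𝓝 0)) (h : ∀ x, ψ (c.map x) = x) :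
    Covers {c} := by
  intro r hr
  obtain ⟨ρ, hρ, hb⟩ := Metric.eventually_nhds_iff_ball.1
    (hψ.eventually (Metric.ball_mem_nhds 0 (hr c)))
  refine ⟨[c], by simp, ρ, hρ, fun G hG => ?_⟩
  simp only [List.map_cons, List.map_nil, List.sum_cons, List.sum_nil, add_zero]
  refine c.setLIntegral_le_of_mem Metric.isOpen_ball.measurableSet (fun x hx _ => ?_)
    (hc _ (hG.indicator Metric.isOpen_ball.measurableSet)).ge
  rw [← h x]
  exact hb _ hx

/-- Translation of the first variable by a function of the other ones. -/
noncomputable def Chart.translate (θ : (Fin n → ℝ) → ℝ) (hθ : AnalyticAt ℝ θ 0) (hθ0 : θ 0 = 0)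
    (hm : Measurable θ) : Chart (n + 1) where
  map := fun x => Fin.cons (x 0 + θ (Fin.tail x)) (Fin.tail x)
  jac := fun _ => 1
  analyticAt_map := analyticAt_cons ((analyticAt_coord 0 0).add
    (hθ.comp_of_eq (analyticAt_tail 0) rfl)) (analyticAt_tail 0)
  map_zero := by rw [tail_zero, hθ0, Pi.zero_apply, add_zero, cons_zero_zero]
  measurable_map := measurable_cons.comp
    (((measurable_pi_apply 0).add (hm.comp measurable_tail)).prodMk measurable_tail)
  analyticAt_jac := analyticAt_const
  measurable_jac := measurable_const
  exists_lintegral_le := by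
    refine ⟨1, one_lt_top, fun G hG => ?_⟩
    have h1 : Measurable fun x : Fin (n + 1) → ℝ =>
        G (Fin.cons (x 0 + θ (Fin.tail x)) (Fin.tail x)) := hG.comp (measurable_cons.comp
      (((measurable_pi_apply 0).add (hm.comp measurable_tail)).prodMk measurable_tail))
    simp only [abs_one, ENNReal.ofReal_one, mul_one, one_mul]
    rw [lintegral_cons_symm hG, lintegral_cons_symm h1]
    refine lintegral_mono fun y => ?_
    simp only [Fin.cons_zero, Fin.tail_cons]
    exact (lintegral_add_right_eq_self (fun t => G (Fin.cons t y)) (θ y)).le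

theorem covers_translate (θ : (Fin n → ℝ) → ℝ) (hθ : AnalyticAt ℝ θ 0) (hθ0 : θ 0 = 0)
    (hm : Measurable θ) : Covers {Chart.translate θ hθ hθ0 hm} := by
  refine covers_singleton_of_inverse _ (fun G hG => ?_)
    (ψ := fun x => Fin.cons (x 0 - θ (Fin.tail x)) (Fin.tail x)) ?_ fun x => ?_
  · rw [lintegral_cons_symm hG, lintegral_cons_symm (Chart.measurable_pull _ hG)]
    refine lintegral_congr fun y => ?_
    simp only [Chart.pull, Chart.translate, abs_one, ENNReal.ofReal_one, mul_one, Fin.cons_zero,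
      Fin.tail_cons]
    exact lintegral_add_right_eq_self (fun t => G (Fin.cons t y)) (θ y)
  · have : AnalyticAt ℝ (fun x : Fin (n + 1) → ℝ =>
        (Fin.cons (x 0 - θ (Fin.tail x)) (Fin.tail x) : Fin (n + 1) → ℝ)) 0 :=
      analyticAt_cons ((analyticAt_coord 0 0).sub
        (hθ.comp_of_eq (analyticAt_tail 0) rfl)) (analyticAt_tail 0)
    have h := this.continuousAt.tendsto
    rwa [tail_zero, hθ0, Pi.zero_apply, sub_zero, cons_zero_zero] at h
  · simp [Chart.translate]

/-- Shear of the last variables along the first one. -/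
noncomputable def Chart.shear (v : Fin n → ℝ) : Chart (n + 1) where
  map := fun x => Fin.cons (x 0) (Fin.tail x + x 0 • v)
  jac := fun _ => 1
  analyticAt_map := analyticAt_cons (analyticAt_coord 0 0)
    ((analyticAt_tail 0).add ((analyticAt_coord 0 0).smul analyticAt_const))
  map_zero := by simp [tail_zero, cons_zero_zero]
  measurable_map := measurable_cons.comp ((measurable_pi_apply 0).prodMk
    (measurable_tail.add ((measurable_pi_apply 0).smul_const v)))
  analyticAt_jac := analyticAt_const
  measurable_jac := measurable_const
  exists_lintegral_le := by
    refine ⟨1, one_lt_top, fun G hG => ?_⟩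
    have h1 : Measurable fun x : Fin (n + 1) → ℝ =>
        G (Fin.cons (x 0) (Fin.tail x + x 0 • v)) := hG.comp (measurable_cons.comp
      ((measurable_pi_apply 0).prodMk
        (measurable_tail.add ((measurable_pi_apply 0).smul_const v))))
    simp only [abs_one, ENNReal.ofReal_one, mul_one, one_mul]
    rw [lintegral_cons hG, lintegral_cons h1]
    refine lintegral_mono fun t => ?_
    simp only [Fin.cons_zero, Fin.tail_cons]
    exact (lintegral_add_right_eq_self (fun y => G (Fin.cons t y)) (t • v)).le

theorem covers_shear (v : Fin n → ℝ) : Covers {Chart.shear v} := by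
  refine covers_singleton_of_inverse _ (fun G hG => ?_)
    (ψ := fun x => Fin.cons (x 0) (Fin.tail x - x 0 • v)) ?_ fun x => ?_
  · rw [lintegral_cons hG, lintegral_cons (Chart.measurable_pull _ hG)]
    refine lintegral_congr fun t => ?_
    simp only [Chart.pull, Chart.shear, abs_one, ENNReal.ofReal_one, mul_one, Fin.cons_zero,
      Fin.tail_cons]
    exact lintegral_add_right_eq_self (fun y => G (Fin.cons t y)) (t • v)
  · have : AnalyticAt ℝ (fun x : Fin (n + 1) → ℝ =>
        (Fin.cons (x 0) (Fin.tail x - x 0 • v) : Fin (n + 1) → ℝ)) 0 :=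
      analyticAt_cons (analyticAt_coord 0 0)
        ((analyticAt_tail 0).sub ((analyticAt_coord 0 0).smul analyticAt_const))
    have h := this.continuousAt.tendsto
    simpa [tail_zero, cons_zero_zero] using h
  · simp [Chart.shear]

theorem lintegral_comp_mul_add {a : ℝ} (ha : a ≠ 0) (c : ℝ) {G : ℝ → ℝ≥0∞} (hG : Measurable G) :
    ∫⁻ t, G (a * (t + c)) * ENNReal.ofReal |a| = ∫⁻ t, G t := by
  have h1 : Measurable fun t => G (a * t) := hG.comp (measurable_const_mul a)
  rw [lintegral_mul_const' _ _ ENNReal.ofReal_ne_top,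
    lintegral_add_right_eq_self (fun t => G (a * t)) c,
    ← lintegral_map hG (measurable_const_mul a), Real.map_volume_mul_left ha, lintegral_smul_measure,
    smul_eq_mul, mul_comm, ← mul_assoc, ← ENNReal.ofReal_mul (abs_nonneg _), ← abs_mul,
    mul_inv_cancel₀ ha]
  simp

theorem measurable_coord {n : ℕ} (i : Fin n) : Measurable fun x : Fin n → ℝ => x i :=
  measurable_pi_apply i

theorem measurable_slope (i : Fin n) (c : ℝ) : Measurable fun x : Fin (n + 1) → ℝ =>
    (Fin.cons (x i.succ * (x 0 + c)) (Fin.tail x) : Fin (n + 1) → ℝ) :=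
  measurable_cons.comp (((measurable_coord i.succ).mul
    ((measurable_coord 0).add measurable_const)).prodMk measurable_tail)

theorem measurable_steep (i : Fin n) : Measurable fun x : Fin (n + 1) → ℝ =>
    (Fin.cons (x 0) (Function.update (Fin.tail x) i (x 0 * x i.succ)) : Fin (n + 1) → ℝ) := by
  have h : Measurable fun x : Fin (n + 1) → ℝ =>
      Function.update (Fin.tail x) i (x 0 * x i.succ) := by
    refine measurable_pi_iff.2 fun j => ?_
    by_cases hj : j = i
    · subst hj
      simp only [Function.update_self]
      exact (measurable_coord 0).mul (measurable_coord j.succ)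
    · simp only [Function.update_of_ne hj]
      exact measurable_coord j.succ
  exact measurable_cons.comp ((measurable_coord 0).prodMk h)

/-- Blow-up chart in which the first variable is divided by the `i`-th of the other ones,
centred at the slope `c`. -/
noncomputable def Chart.slope (i : Fin n) (c : ℝ) : Chart (n + 1) where
  map := fun x => Fin.cons (x i.succ * (x 0 + c)) (Fin.tail x)
  jac := fun x => x i.succ
  analyticAt_map := analyticAt_cons ((analyticAt_coord _ 0).mul
    ((analyticAt_coord 0 0).add analyticAt_const)) (analyticAt_tail 0)
  map_zero := by rw [tail_zero, Pi.zero_apply, zero_mul, cons_zero_zero]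
  measurable_map := measurable_slope i c
  analyticAt_jac := analyticAt_coord i.succ 0
  measurable_jac := measurable_coord i.succ
  exists_lintegral_le := by
    refine ⟨1, one_lt_top, fun G hG => ?_⟩
    have h1 : Measurable fun x : Fin (n + 1) → ℝ =>
        G (Fin.cons (x i.succ * (x 0 + c)) (Fin.tail x)) * ENNReal.ofReal |x i.succ| :=
      (hG.comp (measurable_slope i c)).mul (measurable_coord i.succ).abs.ennreal_ofReal
    rw [one_mul, lintegral_cons_symm hG, lintegral_cons_symm h1]
    refine lintegral_mono fun y => ?_
    simp only [Fin.cons_zero, Fin.tail_cons, Fin.cons_succ]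
    by_cases hy : y i = 0
    · simp [hy]
    · exact (lintegral_comp_mul_add hy c (G := fun t => G (Fin.cons t y))
        (hG.comp (measurable_cons.comp (measurable_id.prodMk measurable_const)))).le

theorem Chart.lintegral_pull_slope (i : Fin n) (c : ℝ) {G : (Fin (n + 1) → ℝ) → ℝ≥0∞}
    (hG : Measurable G) : ∫⁻ x, (Chart.slope i c).pull G x = ∫⁻ x, G x := by
  rw [lintegral_cons_symm hG, lintegral_cons_symm (Chart.measurable_pull _ hG)]
  have h0 : ∀ᵐ y : Fin n → ℝ, y i ≠ 0 := by
    simpa [ae_iff] using volume_coord_eq_zero i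
  refine lintegral_congr_ae ?_
  filter_upwards [h0] with y hy
  simp only [Chart.pull, Chart.slope, Fin.cons_zero, Fin.tail_cons, Fin.cons_succ]
  exact lintegral_comp_mul_add hy c (G := fun t => G (Fin.cons t y))
    (hG.comp (measurable_cons.comp (measurable_id.prodMk measurable_const)))

theorem lintegral_comp_update_mul (i : Fin n) {a : ℝ} (ha : a ≠ 0) {G : (Fin n → ℝ) → ℝ≥0∞}
    (hG : Measurable G) :
    ∫⁻ y, G (Function.update y i (a * y i)) * ENNReal.ofReal |a| = ∫⁻ y, G y := by
  have hdet : (Matrix.diagonal (Function.update (1 : Fin n → ℝ) i a)).det = a := by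
    rw [Matrix.det_diagonal, Finset.prod_update_of_mem (Finset.mem_univ i)]
    simp
  have h := Real.smul_map_diagonal_volume_pi (D := Function.update (1 : Fin n → ℝ) i a)
    (by rw [hdet]; exact ha)
  rw [hdet] at h
  conv_rhs => rw [← h]
  rw [lintegral_smul_measure, smul_eq_mul, lintegral_map hG
    (LinearMap.continuous_of_finiteDimensional _).measurable,
    lintegral_mul_const' _ _ ENNReal.ofReal_ne_top, mul_comm]
  congr 2
  ext y
  congr 1
  ext j
  by_cases hj : j = i
  · subst hj; simp [Matrix.mulVec_diagonal]
  · simp [Matrix.mulVec_diagonal, hj]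

/-- Blow-up chart in which the `i`-th of the last variables is divided by the first variable. -/
noncomputable def Chart.steep (i : Fin n) : Chart (n + 1) where
  map := fun x => Fin.cons (x 0) (Function.update (Fin.tail x) i (x 0 * x i.succ))
  jac := fun x => x 0
  analyticAt_map := by
    refine analyticAt_cons (analyticAt_coord _ 0) (AnalyticAt.pi fun j => ?_)
    by_cases hj : j = i
    · subst hj
      simp only [Function.update_self]
      exact (analyticAt_coord 0 0).mul (analyticAt_coord j.succ 0)
    · simp only [Function.update_of_ne hj]
      exact analyticAt_coord j.succ 0
  map_zero := by
    rw [tail_zero, Pi.zero_apply, zero_mul, Function.update_eq_self_iff.2 (by simp),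
      cons_zero_zero]
  measurable_map := measurable_steep i
  analyticAt_jac := analyticAt_coord 0 0
  measurable_jac := measurable_coord 0
  exists_lintegral_le := by
    refine ⟨1, one_lt_top, fun G hG => ?_⟩
    have h1 : Measurable fun x : Fin (n + 1) → ℝ =>
        G (Fin.cons (x 0) (Function.update (Fin.tail x) i (x 0 * x i.succ))) *
          ENNReal.ofReal |x 0| :=
      (hG.comp (measurable_steep i)).mul (measurable_coord 0).abs.ennreal_ofReal
    rw [one_mul, lintegral_cons hG, lintegral_cons h1]
    refine lintegral_mono fun t => ?_
    simp only [Fin.cons_zero, Fin.tail_cons, Fin.cons_succ]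
    by_cases ht : t = 0
    · simp [ht]
    · exact (lintegral_comp_update_mul i ht (G := fun y => G (Fin.cons t y))
        (hG.comp (measurable_cons.comp (measurable_const.prodMk measurable_id)))).le

theorem Chart.lintegral_pull_steep (i : Fin n) {G : (Fin (n + 1) → ℝ) → ℝ≥0∞}
    (hG : Measurable G) : ∫⁻ x, (Chart.steep i).pull G x = ∫⁻ x, G x := by
  rw [lintegral_cons hG, lintegral_cons (Chart.measurable_pull _ hG)]
  have h0 : ∀ᵐ t : ℝ, t ≠ 0 := by simp [ae_iff]
  refine lintegral_congr_ae ?_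
  filter_upwards [h0] with t ht
  simp only [Chart.pull, Chart.steep, Fin.cons_zero, Fin.tail_cons, Fin.cons_succ]
  exact lintegral_comp_update_mul i ht (G := fun y => G (Fin.cons t y))
    (hG.comp (measurable_cons.comp (measurable_const.prodMk measurable_id)))

end exact

theorem mem_ball_iff_forall {n : ℕ} {x : Fin n → ℝ} {r : ℝ} (hr : 0 < r) :
    x ∈ Metric.ball (0 : Fin n → ℝ) r ↔ ∀ i, |x i| < r := by
  rw [Metric.mem_ball, dist_zero_right, pi_norm_lt_iff hr]
  rfl

theorem covers_blowUp {n : ℕ} (i : Fin n) :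
    Covers (insert (Chart.steep i) (Set.range (Chart.slope i))) := by
  intro r hr
  set R := r (Chart.steep i)
  have hRpos : 0 < R := hr _
  obtain ⟨T, -, hT⟩ := (isCompact_Icc (a := -R⁻¹) (b := R⁻¹)).elim_finite_subcover_image
    (b := Set.univ) (c := fun c : ℝ => Metric.ball c (r (Chart.slope i c)))
    (fun c _ => Metric.isOpen_ball)
    (fun c _ => Set.mem_biUnion (Set.mem_univ c) (Metric.mem_ball_self (hr _)))
  obtain ⟨hTf, hT⟩ := hT
  set L : List ℝ := hTf.toFinset.toList with hL
  obtain ⟨ρ, hρ, hρR, hρL⟩ : ∃ ρ : ℝ, 0 < ρ ∧ ρ ≤ R ∧ ∀ c ∈ L, ρ ≤ r (Chart.slope i c) := by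
    clear_value L
    clear hL
    induction L with
    | nil => exact ⟨R, hRpos, le_rfl, by simp⟩
    | cons c L ih =>
      obtain ⟨σ, hσ, hσR, h⟩ := ih
      refine ⟨min σ (r (Chart.slope i c)), lt_min hσ (hr _), (min_le_left _ _).trans hσR,
        fun d hd => ?_⟩
      rcases List.mem_cons.1 hd with rfl | hd
      · exact min_le_right _ _
      · exact (min_le_left _ _).trans (h d hd)
  set sB : Set (Fin (n + 1) → ℝ) := Metric.ball 0 ρ ∩ {x | |x i.succ| < R * |x 0|} with hsB
  set s : ℝ → Set (Fin (n + 1) → ℝ) := fun c => Metric.ball 0 ρ ∩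
    {x | x i.succ ≠ 0 ∧ |x 0 / x i.succ - c| < r (Chart.slope i c)} with hs
  have hsBm : MeasurableSet sB := Metric.isOpen_ball.measurableSet.inter
    (measurableSet_lt (measurable_coord i.succ).abs ((measurable_coord 0).abs.const_mul R))
  have hsm : ∀ c, MeasurableSet (s c) := fun c => Metric.isOpen_ball.measurableSet.inter
    (((measurableSet_singleton (0 : ℝ)).compl.preimage (measurable_pi_apply i.succ)).inter
      (measurableSet_lt (((measurable_coord 0).div (measurable_coord i.succ)).sub_const c).abs
        measurable_const))
  refine ⟨Chart.steep i :: L.map (Chart.slope i), ?_, ρ, hρ, fun G hG => ?_⟩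
  · intro c hc
    rcases List.mem_cons.1 hc with rfl | hc
    · exact Or.inl rfl
    · obtain ⟨d, -, rfl⟩ := List.mem_map.1 hc
      exact Or.inr ⟨d, rfl⟩
  have hB : ∫⁻ x in sB, G x ≤ ∫⁻ x in Metric.ball 0 R, (Chart.steep i).pull G x := by
    refine (Chart.steep i).setLIntegral_le_of_mem hsBm (fun x hx hx0 => ?_)
      (Chart.lintegral_pull_steep i (hG.indicator hsBm)).ge
    obtain ⟨hx1, hx2⟩ := hx
    rw [mem_ball_iff_forall hρ] at hx1
    rw [mem_ball_iff_forall hRpos, Fin.forall_fin_succ]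
    simp only [Chart.steep, Fin.forall_fin_succ, Fin.cons_zero, Fin.cons_succ] at hx1 hx2 hx0
    refine ⟨hx1.1.trans_le hρR, fun j => ?_⟩
    by_cases hj : j = i
    · subst hj
      simp only [Set.mem_ofPred_eq, Fin.cons_zero, Fin.cons_succ, Function.update_self,
        abs_mul] at hx2
      rw [mul_comm] at hx2
      exact lt_of_mul_lt_mul_right hx2 (abs_nonneg _)
    · have := hx1.2 j
      rw [Function.update_of_ne hj] at this
      exact lt_of_lt_of_le this hρR
  have hA : ∀ c ∈ L, ∫⁻ x in s c, G x ≤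
      ∫⁻ x in Metric.ball 0 (r (Chart.slope i c)), (Chart.slope i c).pull G x := by
    intro c hc
    refine (Chart.slope i c).setLIntegral_le_of_mem (hsm c) (fun x hx hx0 => ?_)
      (Chart.lintegral_pull_slope i c (hG.indicator (hsm c))).ge
    obtain ⟨hx1, hx2, hx3⟩ := hx
    rw [mem_ball_iff_forall hρ] at hx1
    rw [mem_ball_iff_forall (hr _), Fin.forall_fin_succ]
    simp only [Chart.slope, Fin.forall_fin_succ, Fin.cons_zero, Fin.cons_succ, Fin.tail]
      at hx1 hx2 hx3 hx0
    rw [mul_div_cancel_left₀ _ hx2, add_sub_cancel_right] at hx3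
    exact ⟨hx3, fun j => (hx1.2 j).trans_le (hρL c hc)⟩
  have hcov : Metric.ball 0 ρ ⊆ {x : Fin (n + 1) → ℝ | x i.succ = 0} ∪ ⋃ o ∈ (none :: L.map some),
      (fun o : Option ℝ => o.elim sB s) o := by
    intro x hx
    by_cases hxi : x i.succ = 0
    · exact Or.inl hxi
    right
    simp only [List.mem_cons, Set.mem_iUnion, List.mem_map, exists_prop]
    by_cases hxB : |x i.succ| < R * |x 0|
    · exact ⟨none, Or.inl rfl, hx, hxB⟩
    · have hmem : x 0 / x i.succ ∈ Set.Icc (-R⁻¹) R⁻¹ := by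
        rw [Set.mem_Icc, ← abs_le, abs_div, div_le_iff₀ (abs_pos.2 hxi), inv_mul_eq_div,
          le_div_iff₀ hRpos, mul_comm]
        exact not_lt.1 hxB
      obtain ⟨c, hc, hxc⟩ := Set.mem_iUnion₂.1 (hT hmem)
      refine ⟨some c, Or.inr ⟨c, by simpa [hL] using hc, rfl⟩, hx, hxi, ?_⟩
      rwa [Metric.mem_ball, Real.dist_eq] at hxc
  refine (setLIntegral_le_sum_of_subset _ _ (volume_coord_eq_zero i.succ) hcov G).trans ?_
  rw [List.map_cons, List.sum_cons, List.map_cons, List.sum_cons, List.map_map, List.map_map]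
  refine add_le_add hB (List.sum_le_sum fun c hc => ?_)
  exact hA c hc

theorem setLIntegral_comp_pow {N : ℕ} {σ : ℝ} (hσ : |σ| = 1) (G : ℝ → ℝ≥0∞)
    {s : Set ℝ} (hs : MeasurableSet s) (hinj : Set.InjOn (fun t : ℝ => t ^ N) s) :
    ∫⁻ t in s, G (σ * t ^ N) * ENNReal.ofReal |N * t ^ (N - 1)| =
      ∫⁻ t in (fun t => σ * t ^ N) '' s, G t := by
  have hσ0 : σ ≠ 0 := fun h => by simp [h] at hσ
  rw [lintegral_image_eq_lintegral_abs_deriv_mul hs (f' := fun t => σ * (N * t ^ (N - 1)))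
    (fun t _ => ((hasDerivAt_pow N t).const_mul σ).hasDerivWithinAt)
    (fun a ha b hb h => hinj ha hb (mul_left_cancel₀ hσ0 h))]
  refine lintegral_congr fun t => ?_
  rw [abs_mul σ, hσ, one_mul, mul_comm]

theorem lintegral_comp_pow_le {N : ℕ} (hN : N ≠ 0) {σ : ℝ} (hσ : |σ| = 1) (G : ℝ → ℝ≥0∞) :
    ∫⁻ t, G (σ * t ^ N) * ENNReal.ofReal |N * t ^ (N - 1)| ≤ 2 * ∫⁻ t, G t := by
  have hle : ∀ s : Set ℝ, MeasurableSet s → Set.InjOn (fun t : ℝ => t ^ N) s →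
      ∫⁻ t in s, G (σ * t ^ N) * ENNReal.ofReal |N * t ^ (N - 1)| ≤ ∫⁻ t, G t :=
    fun s hs hinj => (setLIntegral_comp_pow hσ G hs hinj).trans_le (setLIntegral_le_lintegral _ _)
  have hu : (Set.univ : Set ℝ) = Set.Ici 0 ∪ Set.Iic 0 := Set.Ici_union_Iic.symm
  rw [← setLIntegral_univ (μ := volume), hu, two_mul]
  refine (lintegral_union_le _ _ _).trans (add_le_add (hle _ measurableSet_Ici ?_)
    (hle _ measurableSet_Iic ?_))
  · exact fun a ha b hb h => (pow_left_inj₀ ha hb hN).1 h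
  · intro a ha b hb h
    have h' : |a| ^ N = |b| ^ N := by
      rw [← abs_pow, ← abs_pow]
      exact congrArg _ h
    have := (pow_left_inj₀ (abs_nonneg a) (abs_nonneg b) hN).1 h'
    rw [abs_of_nonpos ha, abs_of_nonpos hb] at this
    exact neg_injective this

theorem lintegral_indicator_le_comp_pow {N : ℕ} (hN : N ≠ 0) {σ : ℝ} (hσ : |σ| = 1)
    (G : ℝ → ℝ≥0∞) (hG : ∀ t, σ * t ≤ 0 → G t = 0) :
    ∫⁻ t, G t ≤ ∫⁻ t, G (σ * t ^ N) * ENNReal.ofReal |N * t ^ (N - 1)| := by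
  have hsq : σ * σ = 1 := by rw [← abs_mul_abs_self, hσ, one_mul]
  have hsub : {t : ℝ | 0 < σ * t} ⊆ (fun t => σ * t ^ N) '' Set.Ioi 0 := by
    intro t ht
    refine ⟨(σ * t) ^ ((N : ℝ)⁻¹), Real.rpow_pos_of_pos ht _, ?_⟩
    simp only
    rw [Real.rpow_inv_natCast_pow (le_of_lt ht) hN, ← mul_assoc, hsq, one_mul]
  have hm : MeasurableSet {t : ℝ | 0 < σ * t} :=
    measurableSet_lt measurable_const (measurable_const_mul σ)
  calc ∫⁻ t, G t = ∫⁻ t in {t : ℝ | 0 < σ * t}, G t := by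
        rw [← lintegral_indicator hm]
        refine lintegral_congr fun t => ?_
        by_cases ht : 0 < σ * t
        · exact (Set.indicator_of_mem (s := {t : ℝ | 0 < σ * t}) ht G).symm
        · rw [hG t (not_lt.1 ht)]
          exact (Set.indicator_of_notMem (s := {t : ℝ | 0 < σ * t}) ht G).symm
    _ ≤ ∫⁻ t in (fun t => σ * t ^ N) '' Set.Ioi 0, G t := lintegral_mono_set hsub
    _ = ∫⁻ t in Set.Ioi 0, G (σ * t ^ N) * ENNReal.ofReal |N * t ^ (N - 1)| :=
        (setLIntegral_comp_pow hσ G measurableSet_Ioi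
          fun a ha b hb h => (pow_left_inj₀ (le_of_lt ha) (le_of_lt hb) hN).1 h).symm
    _ ≤ _ := setLIntegral_le_lintegral _ _

theorem measurable_pow_cons {n : ℕ} (N : ℕ) (σ : ℝ) : Measurable fun x : Fin (n + 1) → ℝ =>
    (Fin.cons (σ * x 0 ^ N) (Fin.tail x) : Fin (n + 1) → ℝ) :=
  measurable_cons.comp ((((measurable_coord 0).pow_const N).const_mul σ).prodMk measurable_tail)

/-- The power substitution `t ↦ σ * t ^ N` in the first variable. -/
noncomputable def Chart.pow {n : ℕ} (N : ℕ) (hN : N ≠ 0) (σ : ℝ) (hσ : |σ| = 1) :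
    Chart (n + 1) where
  map := fun x => Fin.cons (σ * x 0 ^ N) (Fin.tail x)
  jac := fun x => N * x 0 ^ (N - 1)
  analyticAt_map := analyticAt_cons (analyticAt_const.mul ((analyticAt_coord 0 0).pow N))
    (analyticAt_tail 0)
  map_zero := by
    rw [tail_zero, Pi.zero_apply, zero_pow hN, mul_zero, cons_zero_zero]
  measurable_map := measurable_pow_cons N σ
  analyticAt_jac := analyticAt_const.mul ((analyticAt_coord 0 0).pow _)
  measurable_jac := ((measurable_coord 0).pow_const _).const_mul _
  exists_lintegral_le := by
    refine ⟨2, by simp, fun G hG => ?_⟩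
    have h1 : Measurable fun x : Fin (n + 1) → ℝ =>
        G (Fin.cons (σ * x 0 ^ N) (Fin.tail x)) * ENNReal.ofReal |N * x 0 ^ (N - 1)| :=
      (hG.comp (measurable_pow_cons N σ)).mul
        (((measurable_coord 0).pow_const _).const_mul _).abs.ennreal_ofReal
    rw [lintegral_cons_symm hG, lintegral_cons_symm h1, ← lintegral_const_mul' _ _ (by simp)]
    refine lintegral_mono fun y => ?_
    simp only [Fin.cons_zero, Fin.tail_cons]
    exact lintegral_comp_pow_le hN hσ fun t => G (Fin.cons t y)

theorem covers_pow {n : ℕ} (N : ℕ) (hN : N ≠ 0) :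
    Covers ({Chart.pow N hN 1 abs_one, Chart.pow N hN (-1) (by simp)} : Set (Chart (n + 1))) := by
  intro r hr
  set c₁ : Chart (n + 1) := Chart.pow N hN 1 abs_one
  set c₂ : Chart (n + 1) := Chart.pow N hN (-1) (by simp)
  set r₁ := r c₁ with hr₁
  set r₂ := r c₂ with hr₂
  have h1 : 0 < r₁ := hr _
  have h2 : 0 < r₂ := hr _
  obtain ⟨ρ, hρ, hρ1, hρ1', hρ2, hρ2'⟩ : ∃ ρ : ℝ, 0 < ρ ∧ ρ ≤ r₁ ∧ ρ ≤ r₁ ^ N ∧ ρ ≤ r₂ ∧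
      ρ ≤ r₂ ^ N := by
    refine ⟨min (min r₁ (r₁ ^ N)) (min r₂ (r₂ ^ N)), by positivity, ?_, ?_, ?_, ?_⟩ <;> simp
  have key : ∀ (σ : ℝ) (hσ : |σ| = 1) (R : ℝ), 0 < R → ρ ≤ R → ρ ≤ R ^ N →
      ∀ G : (Fin (n + 1) → ℝ) → ℝ≥0∞, Measurable G →
      ∫⁻ x in Metric.ball (0 : Fin (n + 1) → ℝ) ρ ∩ {x | 0 < σ * x 0}, G x ≤
        ∫⁻ x in Metric.ball 0 R, (Chart.pow N hN σ hσ).pull G x := by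
    intro σ hσ R hR hR1 hR2 G hG
    have hm : MeasurableSet (Metric.ball (0 : Fin (n + 1) → ℝ) ρ ∩ {x | 0 < σ * x 0}) :=
      Metric.isOpen_ball.measurableSet.inter
        (measurableSet_lt measurable_const ((measurable_coord 0).const_mul σ))
    refine Chart.setLIntegral_le_of_mem _ hm (fun x hx _ => ?_) ?_
    · obtain ⟨hx1, -⟩ := hx
      rw [mem_ball_iff_forall hρ, Fin.forall_fin_succ] at hx1
      rw [mem_ball_iff_forall hR, Fin.forall_fin_succ]
      simp only [Chart.pow, Fin.cons_zero, Fin.cons_succ, Fin.tail] at hx1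
      refine ⟨?_, fun j => (hx1.2 j).trans_le hR1⟩
      by_contra! hlt
      have := hx1.1
      rw [abs_mul, hσ, one_mul, abs_pow] at this
      exact absurd (this.trans_le hR2) (not_lt.2 (pow_le_pow_left₀ hR.le hlt N))
    · rw [lintegral_cons_symm (hG.indicator hm),
        lintegral_cons_symm (Chart.measurable_pull _ (hG.indicator hm))]
      refine lintegral_mono fun y => ?_
      simp only [Chart.pull, Chart.pow, Fin.cons_zero, Fin.tail_cons]
      refine lintegral_indicator_le_comp_pow hN hσ (fun t => Set.indicator _ G (Fin.cons t y))
        fun t ht => Set.indicator_of_notMem (fun h => ?_) _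
      exact absurd h.2 (by simpa using ht)
  refine ⟨[c₁, c₂], by simp, ρ, hρ, fun G hG => ?_⟩
  have hcov : Metric.ball 0 ρ ⊆ {x : Fin (n + 1) → ℝ | x 0 = 0} ∪ ⋃ σ ∈ [(1 : ℝ), -1],
      Metric.ball 0 ρ ∩ {x | 0 < σ * x 0} := by
    intro x hx
    rcases lt_trichotomy (x 0) 0 with h | h | h
    · exact Or.inr (Set.mem_iUnion₂.2 ⟨-1, by simp, hx, by simpa using h⟩)
    · exact Or.inl h
    · exact Or.inr (Set.mem_iUnion₂.2 ⟨1, by simp, hx, by simpa using h⟩)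
  refine (setLIntegral_le_sum_of_subset _ _ (volume_coord_eq_zero 0) hcov G).trans ?_
  simp only [List.map_cons, List.map_nil, List.sum_cons, List.sum_nil, add_zero]
  exact add_le_add (key 1 abs_one _ h1 hρ1 hρ1' G hG) (key (-1) (by simp) _ h2 hρ2 hρ2' G hG)

theorem mon_tail {n : ℕ} (β : Fin n → ℕ) (x : Fin (n + 1) → ℝ) :
    mon β (Fin.tail x) = mon (Fin.cons 0 β : Fin (n + 1) → ℕ) x := by
  simp [mon, Fin.prod_univ_succ, Fin.tail]

theorem IsMon.comp_tail {n : ℕ} {f : (Fin n → ℝ) → ℝ} (hf : IsMon f) :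
    IsMon fun x : Fin (n + 1) → ℝ => f (Fin.tail x) := by
  obtain ⟨β, u, hu, hu0, h⟩ := hf
  refine ⟨Fin.cons 0 β, fun x => u (Fin.tail x), hu.comp_of_eq (analyticAt_tail 0) rfl, hu0, ?_⟩
  filter_upwards [tendsto_tail_zero.eventually h] with x hx
  rw [hx, mon_tail]

theorem IsMon.const_mul {n : ℕ} {f : (Fin n → ℝ) → ℝ} (hf : IsMon f) {a : ℝ} (ha : a ≠ 0) :
    IsMon fun x => a * f x :=
  (IsMon.of_ne_zero analyticAt_const ha).mul hf

theorem isMon_coord_pow {n : ℕ} (i : Fin n) (k : ℕ) : IsMon fun x => x i ^ k :=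
  (isMon_mon (Pi.single i k)).congr (Eventually.of_forall fun x => by rw [mon_single])

theorem exists_covers_pow (n N : ℕ) (hN : N ≠ 0) : ∃ S : Set (Chart n), Covers S ∧ ∀ c ∈ S,
    (∃ σ : Fin n → ℝ, (∀ i, |σ i| = 1) ∧ ∀ x i, c.map x i = σ i * x i ^ N) ∧ IsMon c.jac := by
  induction n with
  | zero =>
    refine ⟨{Chart.refl 0}, covers_refl 0, ?_⟩
    rintro c rfl
    exact ⟨⟨1, fun i => i.elim0, fun x i => i.elim0⟩, IsMon.of_ne_zero analyticAt_const one_ne_zero⟩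
  | succ n ih =>
    obtain ⟨S, hS, h⟩ := ih
    refine ⟨_, hS.lift.bind fun _ _ => covers_pow N hN, ?_⟩
    rintro e ⟨_, ⟨c, hc, rfl⟩, d, hd, rfl⟩
    obtain ⟨⟨σ, hσ, hmap⟩, hjac⟩ := h c hc
    obtain ⟨τ, hτ, rfl⟩ : ∃ τ : ℝ, ∃ hτ : |τ| = 1, d = Chart.pow N hN τ hτ := by
      rcases hd with rfl | rfl
      · exact ⟨1, abs_one, rfl⟩
      · exact ⟨-1, by simp, rfl⟩
    refine ⟨⟨Fin.cons τ σ, ?_, fun x i => ?_⟩, ?_⟩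
    · rw [Fin.forall_fin_succ]
      exact ⟨by simpa using hτ, fun i => by simpa using hσ i⟩
    · refine Fin.cases ?_ (fun i => ?_) i
      · simp [Chart.comp, Chart.lift, Chart.pow]
      · simp [Chart.comp, Chart.lift, Chart.pow, hmap, Fin.tail]
    · refine (hjac.comp_tail.mul ((isMon_coord_pow 0 (N - 1)).const_mul
        (Nat.cast_ne_zero.2 hN : (N : ℝ) ≠ 0))).congr (Eventually.of_forall fun x => ?_)
      simp [Chart.comp, Chart.lift, Chart.pow]

/-- `F` becomes a monomial times a unit, and so do the Jacobians, in the charts of a covering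
family. -/
def Res {n : ℕ} (F : (Fin n → ℝ) → ℝ) : Prop :=
  ∃ S : Set (Chart n), Covers S ∧ ∀ c ∈ S, IsMon (fun x => F (c.map x)) ∧ IsMon c.jac

theorem IsMon.res {n : ℕ} {F : (Fin n → ℝ) → ℝ} (h : IsMon F) : Res F := by
  refine ⟨_, covers_refl n, ?_⟩
  rintro c rfl
  exact ⟨h, IsMon.of_ne_zero analyticAt_const one_ne_zero⟩

theorem Res.congr {n : ℕ} {F G : (Fin n → ℝ) → ℝ} (h : Res F) (hG : ∀ᶠ x in 𝓝 0, G x = F x) :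
    Res G := by
  obtain ⟨S, hS, hc⟩ := h
  exact ⟨S, hS, fun c hcS => ⟨(hc c hcS).1.congr (c.tendsto_map.eventually hG), (hc c hcS).2⟩⟩

theorem Res.bind {n : ℕ} {F : (Fin n → ℝ) → ℝ} (hF : AnalyticAt ℝ F 0) {S : Set (Chart n)}
    (hS : Covers S) (h : ∀ c ∈ S, Res fun x => F (c.map x) * c.jac x) : Res F := by
  classical
  choose! T hT hTc using h
  refine ⟨_, hS.bind hT, ?_⟩
  rintro e ⟨c, hc, d, hd, rfl⟩
  obtain ⟨h1, h2⟩ := hTc c hc d hd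
  have ha := d.analyticAt_comp (c.analyticAt_comp hF)
  have hj := d.analyticAt_comp c.analyticAt_jac
  exact ⟨IsMon.of_mul_left ha hj h1, (IsMon.of_mul_right ha hj h1).mul h2⟩

theorem Chart.tendsto_comp_zero {n : ℕ} (c : Chart n) {f : (Fin n → ℝ) → ℝ}
    (hf : ∀ᶠ x in 𝓝 0, f x = 0) : ∀ᶠ x in 𝓝 0, f (c.map x) = 0 :=
  c.tendsto_map.eventually hf

theorem not_eventually_prod_eq_zero {n : ℕ} {ι : Type*} (s : Finset ι)
    {f : ι → (Fin n → ℝ) → ℝ} (hf : ∀ i ∈ s, AnalyticAt ℝ (f i) 0)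
    (h : ∀ i ∈ s, ¬ ∀ᶠ x in 𝓝 0, f i x = 0) : ¬ ∀ᶠ x in 𝓝 0, ∏ i ∈ s, f i x = 0 := by
  classical
  induction s using Finset.induction_on with
  | empty => exact fun h0 => by simpa using h0.self_of_nhds
  | insert i s hi ih =>
    simp only [Finset.prod_insert hi]
    intro h0
    rcases eventuallyEq_zero_or_of_mul (hf i (by simp)) (Finset.analyticAt_fun_prod _
      fun j hj => hf j (by simp [hj])) h0 with h1 | h1
    · exact h i (by simp) h1
    · exact ih (fun j hj => hf j (by simp [hj])) (fun j hj => h j (by simp [hj])) h1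

theorem exists_covers_family {n : ℕ}
    (hR : ∀ F : (Fin n → ℝ) → ℝ, AnalyticAt ℝ F 0 → (¬ ∀ᶠ x in 𝓝 0, F x = 0) → Res F)
    {ι : Type*} (s : Finset ι) {f : ι → (Fin n → ℝ) → ℝ} (hf : ∀ i ∈ s, AnalyticAt ℝ (f i) 0) :
    ∃ S : Set (Chart n), Covers S ∧ ∀ c ∈ S, IsMon c.jac ∧
      ∀ i ∈ s, (∀ᶠ x in 𝓝 0, f i x = 0) ∨ IsMon fun x => f i (c.map x) := by
  classical
  have hs' : ∀ i ∈ s.filter (fun i => ¬ ∀ᶠ x in 𝓝 0, f i x = 0), AnalyticAt ℝ (f i) 0 :=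
    fun i hi => hf i (Finset.mem_filter.1 hi).1
  obtain ⟨S, hS, h⟩ := hR (fun x => ∏ i ∈ s.filter (fun i => ¬ ∀ᶠ x in 𝓝 0, f i x = 0), f i x)
    (Finset.analyticAt_fun_prod _ hs')
    (not_eventually_prod_eq_zero _ hs' fun i hi => (Finset.mem_filter.1 hi).2)
  refine ⟨S, hS, fun c hc => ⟨(h c hc).2, fun i hi => ?_⟩⟩
  by_cases h0 : ∀ᶠ x in 𝓝 0, f i x = 0
  · exact Or.inl h0
  · exact Or.inr (IsMon.of_prod (f := fun i x => f i (c.map x))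
      (fun j hj => c.analyticAt_comp (hs' j hj)) (h c hc).1 (Finset.mem_filter.2 ⟨hi, h0⟩))

theorem IsMon.analyticAt {n : ℕ} {f : (Fin n → ℝ) → ℝ} (h : IsMon f) : AnalyticAt ℝ f 0 := by
  obtain ⟨β, u, hu, -, h⟩ := h
  refine ((analyticAt_mon β 0).mul hu).congr ?_
  filter_upwards [h] with x hx using hx.symm

/-- The vanishing order at the origin, along the first axis, of a translated reduced polynomial is
less than its degree. -/
theorem exists_order_lt (k : ℕ) (a : ℕ → ℝ) {b : ℝ} (hb : b ≠ 0) (c : ℝ) (hc : c ≠ 0) :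
    ∃ j ≤ k, ∃ v : ℝ → ℝ, AnalyticAt ℝ v 0 ∧ v 0 ≠ 0 ∧ ∀ t : ℝ,
      ∑ j ∈ Finset.range k, a j * (t + c) ^ j + (t + c) ^ (k + 1) * b = t ^ j * v t := by
  classical
  open Polynomial in
  set P : ℝ[X] := ∑ j ∈ Finset.range k, C (a j) * X ^ j with hP
  have hPdeg : P.degree < (k : ℕ) := by
    refine (degree_sum_le _ _).trans_lt ((Finset.sup_lt_iff (by simp)).2 fun j hj => ?_)
    refine (degree_C_mul_X_pow_le _ _).trans_lt ?_
    exact_mod_cast Finset.mem_range.1 hj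
  set Q : ℝ[X] := P + C b * X ^ (k + 1) with hQ
  have hQk : Q.coeff k = 0 := by
    rw [hQ, coeff_add, coeff_eq_zero_of_degree_lt hPdeg, coeff_C_mul_X_pow]
    simp
  have hlt : P.degree < (C b * X ^ (k + 1)).degree := by
    rw [degree_C_mul_X_pow _ hb]
    exact hPdeg.trans (by exact_mod_cast Nat.lt_succ_self k)
  have hQdeg : Q.natDegree = k + 1 := by
    have : Q.degree = ((k + 1 : ℕ) : WithBot ℕ) := by
      rw [hQ, degree_add_eq_right_of_degree_lt hlt, degree_C_mul_X_pow _ hb]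
    exact natDegree_eq_of_degree_eq_some this
  have hQ0 : Q ≠ 0 := by
    intro h
    simp [h] at hQdeg
  obtain ⟨V, hV, hVc⟩ := exists_eq_pow_rootMultiplicity_mul_and_not_dvd Q hQ0 c
  set j := Q.rootMultiplicity c with hj
  have hV0 : V ≠ 0 := by
    rintro rfl
    exact hVc (dvd_zero _)
  have hdeg : k + 1 = j + V.natDegree := by
    rw [← hQdeg, hV, natDegree_mul (pow_ne_zero _ (X_sub_C_ne_zero c)) hV0, natDegree_pow,
      natDegree_X_sub_C, mul_one]
  have hjk : j ≤ k := by
    by_contra! hlt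
    have hj1 : j = k + 1 := by omega
    have hVd : V.natDegree = 0 := by omega
    obtain ⟨e, he⟩ := natDegree_eq_zero.1 hVd
    rw [← he, hj1] at hV
    rw [hV, mul_comm, coeff_C_mul, sub_eq_add_neg, ← C_neg, coeff_X_add_C_pow] at hQk
    have he0 : e ≠ 0 := by
      rintro rfl
      exact hV0 (by rw [← he, C_0])
    simp [he0, hc] at hQk
    exact absurd hQk (by positivity)
  refine ⟨j, hjk, fun t => V.eval (t + c), ?_, ?_, fun t => ?_⟩
  · have : AnalyticAt ℝ (fun t : ℝ => V.eval (t + c)) 0 := by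
      have h1 : AnalyticAt ℝ (fun t : ℝ => t + c) 0 := analyticAt_id.add analyticAt_const
      simpa using h1.aeval_polynomial V
    exact this
  · simp only [zero_add]
    intro h
    exact hVc (dvd_iff_isRoot.2 h)
  · have h1 : Q.eval (t + c) = ∑ j ∈ Finset.range k, a j * (t + c) ^ j + (t + c) ^ (k + 1) * b := by
      simp only [hQ, hP, eval_add, eval_finsetSum, eval_mul, eval_C, eval_pow, eval_X]
      ring
    rw [← h1, hV]
    simp

theorem mon_update_mul {n : ℕ} (β : Fin n → ℕ) (i : Fin n) (s : ℝ) (y : Fin n → ℝ) :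
    mon β (Function.update y i (s * y i)) = s ^ β i * mon β y := by
  classical
  unfold mon
  rw [← Finset.mul_prod_erase _ _ (Finset.mem_univ i),
    ← Finset.mul_prod_erase Finset.univ (fun j => y j ^ β j) (Finset.mem_univ i)]
  rw [Function.update_self, mul_pow, mul_assoc]
  congr 2
  refine Finset.prod_congr rfl fun j hj => ?_
  rw [Function.update_of_ne (Finset.ne_of_mem_erase hj)]

theorem IsMon.comp_of_mon {n N : ℕ} {f : (Fin n → ℝ) → ℝ} (hf : IsMon f)
    {φ : (Fin N → ℝ) → (Fin n → ℝ)} (hφ : AnalyticAt ℝ φ 0) (hφ0 : φ 0 = 0)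
    (h : ∀ β : Fin n → ℕ, IsMon fun x => mon β (φ x)) : IsMon fun x => f (φ x) := by
  obtain ⟨β, u, hu, hu0, he⟩ := hf
  have hφt : Tendsto φ (𝓝 0) (𝓝 0) := by
    have := hφ.continuousAt.tendsto
    rwa [hφ0] at this
  refine ((h β).mul (IsMon.of_ne_zero (hu.comp_of_eq hφ hφ0) ?_)).congr (hφt.eventually he)
  simpa [hφ0] using hu0

theorem mon_apply_zero {n : ℕ} {α : Fin n → ℕ} (h : α ≠ 0) : mon α 0 = 0 := by
  obtain ⟨i, hi⟩ := Function.ne_iff.1 h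
  exact (mon_eq_zero_iff _ _).2 ⟨i, rfl, hi⟩

/-- A polynomial of degree `k + 1` in the first variable, without a term of degree `k`, whose
coefficients are divisible by powers of a monomial in the other variables. -/
noncomputable def bracket {n : ℕ} (k : ℕ) (α : Fin n → ℕ) (c : ℕ → (Fin n → ℝ) → ℝ)
    (U : (Fin (n + 1) → ℝ) → ℝ) (x : Fin (n + 1) → ℝ) : ℝ :=
  ∑ j ∈ Finset.range k, mon α (Fin.tail x) ^ (k + 1 - j) * c j (Fin.tail x) * x 0 ^ j +
    x 0 ^ (k + 1) * U x

theorem analyticAt_bracket {n k : ℕ} (α : Fin n → ℕ) {c : ℕ → (Fin n → ℝ) → ℝ}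
    {U : (Fin (n + 1) → ℝ) → ℝ} (hc : ∀ j, AnalyticAt ℝ (c j) 0) (hU : AnalyticAt ℝ U 0) :
    AnalyticAt ℝ (bracket k α c U) 0 := by
  refine (Finset.analyticAt_fun_sum _ fun j _ => ?_).add (((analyticAt_coord 0 0).pow _).mul hU)
  exact ((((analyticAt_mon α 0).comp_of_eq (analyticAt_tail 0) rfl).pow _).mul
    ((hc j).comp_of_eq (analyticAt_tail 0) rfl)).mul ((analyticAt_coord 0 0).pow _)

theorem reg_bracket_zero {n k : ℕ} {c : ℕ → (Fin n → ℝ) → ℝ}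
    {U : (Fin (n + 1) → ℝ) → ℝ} (hU : AnalyticAt ℝ U 0)
    (h : ∃ j < k, c j 0 ≠ 0) : ∃ k' ≤ k, Reg k' (bracket k 0 c U) := by
  classical
  set j₀ := Nat.find h with hj₀
  obtain ⟨hj, hcj⟩ := Nat.find_spec h
  have hmin : ∀ j < j₀, c j 0 = 0 := fun j hjj => by
    by_contra hne
    exact Nat.find_min h hjj ⟨hjj.trans hj, hne⟩
  refine ⟨j₀, hj.le, fun t => ∑ j ∈ Finset.range k, c j 0 * t ^ (j - j₀) +
    t ^ (k + 1 - j₀) * U (Fin.cons t 0), ?_, ?_, Eventually.of_forall fun t => ?_⟩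
  · refine (Finset.analyticAt_fun_sum _ fun j _ => analyticAt_const.mul (analyticAt_id.pow _)).add
      ((analyticAt_id.pow _).mul (hU.comp_of_eq analyticAt_axis cons_zero_zero))
  · have hj' : j₀ < k := hj
    simp only
    rw [zero_pow (by omega), zero_mul, add_zero,
      Finset.sum_eq_single_of_mem j₀ (Finset.mem_range.2 hj)]
    · simpa using hcj
    · intro j _ hne
      rcases lt_or_gt_of_ne hne with hlt | hlt
      · rw [hmin j hlt, zero_mul]
      · rw [zero_pow (by omega), mul_zero]
  · simp only [bracket, mon_zero, one_pow, one_mul, Fin.tail_cons, Fin.cons_zero, mul_add,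
      Finset.mul_sum]
    congr 1
    · refine Finset.sum_congr rfl fun j _ => ?_
      rcases lt_or_ge j j₀ with hlt | hge
      · rw [hmin j hlt]; ring
      · rw [← Nat.add_sub_cancel' hge, pow_add]
        simp only [Nat.add_sub_cancel_left]
        ring
    · rw [← mul_assoc, ← pow_add, Nat.add_sub_cancel' (hj.le.trans (Nat.le_succ k))]

theorem isMon_bracket_steep {n k : ℕ} {α : Fin n → ℕ} (i : Fin n) (hα : α i ≠ 0)
    {P : (Fin n → ℝ) → ℝ} (hP : IsMon P) {c : ℕ → (Fin n → ℝ) → ℝ}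
    {U : (Fin (n + 1) → ℝ) → ℝ} (hc : ∀ j, AnalyticAt ℝ (c j) 0) (hU : AnalyticAt ℝ U 0)
    (hU0 : U 0 ≠ 0) : IsMon fun x => P (Fin.tail ((Chart.steep i).map x)) *
      bracket k α c U ((Chart.steep i).map x) * (Chart.steep i).jac x := by
  set φ : (Fin (n + 1) → ℝ) → (Fin n → ℝ) := fun x => Fin.tail ((Chart.steep i).map x) with hφ
  have hφa : AnalyticAt ℝ φ 0 :=
    (analyticAt_tail _).comp_of_eq (Chart.steep i).analyticAt_map (Chart.steep i).map_zero
  have hφ0 : φ 0 = 0 := by rw [hφ]; simp only [(Chart.steep i).map_zero, tail_zero]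
  have hφx : ∀ x, φ x = Function.update (Fin.tail x) i (x 0 * Fin.tail x i) := fun x => by
    simp [hφ, Chart.steep, Fin.tail]
  have hφm : ∀ β : Fin n → ℕ, IsMon fun x => mon β (φ x) := fun β => by
    refine ((isMon_coord_pow 0 (β i)).mul (isMon_mon β).comp_tail).congr
      (Eventually.of_forall fun x => ?_)
    rw [hφx, mon_update_mul]
  set M : (Fin (n + 1) → ℝ) → ℝ := fun x => x 0 ^ (α i - 1) * mon α (Fin.tail x) with hM
  have hMa : AnalyticAt ℝ M 0 := ((analyticAt_coord 0 0).pow _).mul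
    ((analyticAt_mon α 0).comp_of_eq (analyticAt_tail 0) rfl)
  have hM0 : M 0 = 0 := by
    rw [hM]
    simp only [tail_zero]
    rw [mon_apply_zero (fun h => hα (by rw [h]; rfl)), mul_zero]
  have hmonM : ∀ x, mon α (φ x) = x 0 * M x := fun x => by
    rw [hφx, mon_update_mul, hM]
    simp only
    rw [← mul_assoc, ← pow_succ', Nat.sub_add_cancel (Nat.one_le_iff_ne_zero.2 hα)]
  set W : (Fin (n + 1) → ℝ) → ℝ := fun x =>
    ∑ j ∈ Finset.range k, M x ^ (k + 1 - j) * c j (φ x) + U ((Chart.steep i).map x) with hW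
  have hWa : AnalyticAt ℝ W 0 := (Finset.analyticAt_fun_sum _ fun j _ =>
    (hMa.pow _).mul ((hc j).comp_of_eq hφa hφ0)).add
      (hU.comp_of_eq (Chart.steep i).analyticAt_map (Chart.steep i).map_zero)
  have hW0 : W 0 ≠ 0 := by
    rw [hW]
    simp only [hM0, (Chart.steep i).map_zero]
    rw [Finset.sum_eq_zero, zero_add]
    · exact hU0
    · intro j hj
      rw [zero_pow (by have := Finset.mem_range.1 hj; omega), zero_mul]
  refine ((hP.comp_of_mon hφa hφ0 hφm).mul ((isMon_coord_pow 0 (k + 2)).mul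
    (IsMon.of_ne_zero hWa hW0))).congr (Eventually.of_forall fun x => ?_)
  have h0 : (Chart.steep i).map x 0 = x 0 := rfl
  have hj : (Chart.steep i).jac x = x 0 := rfl
  have hb : bracket k α c U ((Chart.steep i).map x) = x 0 ^ (k + 1) * W x := by
    rw [bracket, h0, hW, mul_add, Finset.mul_sum]
    congr 1
    refine Finset.sum_congr rfl fun j hj => ?_
    change mon α (φ x) ^ (k + 1 - j) * c j (φ x) * x 0 ^ j = _
    rw [hmonM, mul_pow]
    have : x 0 ^ (k + 1) = x 0 ^ (k + 1 - j) * x 0 ^ j := by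
      rw [← pow_add, Nat.sub_add_cancel (by have := Finset.mem_range.1 hj; omega)]
    rw [this]
    ring
  rw [hb, hj]
  ring

/-- The strict transform of a bracket in the chart with slope `s`. -/
theorem bracket_slope {n k : ℕ} {α : Fin n → ℕ} (i : Fin n) (hα : α i ≠ 0) (s : ℝ)
    (c : ℕ → (Fin n → ℝ) → ℝ) (U : (Fin (n + 1) → ℝ) → ℝ) (x : Fin (n + 1) → ℝ) :
    bracket k α c U ((Chart.slope i s).map x) = Fin.tail x i ^ (k + 1) *
      (∑ j ∈ Finset.range k, mon (α - Pi.single i 1) (Fin.tail x) ^ (k + 1 - j) *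
        c j (Fin.tail x) * (x 0 + s) ^ j +
        (x 0 + s) ^ (k + 1) * U ((Chart.slope i s).map x)) := by
  have h0 : (Chart.slope i s).map x 0 = Fin.tail x i * (x 0 + s) := rfl
  have ht : Fin.tail ((Chart.slope i s).map x) = Fin.tail x := rfl
  rw [bracket, h0, ht, mul_add (Fin.tail x i ^ (k + 1)), Finset.mul_sum]
  congr 1
  · refine Finset.sum_congr rfl fun j hj => ?_
    have : Fin.tail x i ^ (k + 1) = Fin.tail x i ^ (k + 1 - j) * Fin.tail x i ^ j := by
      rw [← pow_add, Nat.sub_add_cancel (by have := Finset.mem_range.1 hj; omega)]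
    rw [mon_eq_mul_of_ne_zero hα, this, mul_pow, mul_pow]
    ring
  · rw [mul_pow]
    ring

theorem res_bracket {n k : ℕ}
    (hK : ∀ k' ≤ k, ∀ (P : (Fin n → ℝ) → ℝ) (G : (Fin (n + 1) → ℝ) → ℝ), IsMon P →
      AnalyticAt ℝ G 0 → Reg k' G → Res fun x => P (Fin.tail x) * G x)
    (α : Fin n → ℕ) {P : (Fin n → ℝ) → ℝ} (hP : IsMon P) {c : ℕ → (Fin n → ℝ) → ℝ}
    (hc : ∀ j, AnalyticAt ℝ (c j) 0) {U : (Fin (n + 1) → ℝ) → ℝ} (hU : AnalyticAt ℝ U 0)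
    (hU0 : U 0 ≠ 0) (h : ∃ j < k, c j 0 ≠ 0) :
    Res fun x => P (Fin.tail x) * bracket k α c U x := by
  induction hN : ∑ i, α i generalizing α P U with
  | zero =>
    have hα : α = 0 := by
      ext i
      exact Finset.sum_eq_zero_iff.1 hN i (Finset.mem_univ i)
    subst hα
    obtain ⟨k', hk', hreg⟩ := reg_bracket_zero hU h
    exact hK k' hk' P _ hP (analyticAt_bracket 0 hc hU) hreg
  | succ N ih =>
    obtain ⟨i, hi⟩ : ∃ i, α i ≠ 0 := by
      by_contra! h0
      simp [h0] at hN
    have hsum : ∑ j, (α - Pi.single i 1 : Fin n → ℕ) j = N := by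
      have hle : Pi.single i 1 ≤ α := by
        intro j
        by_cases hj : j = i
        · subst hj; simpa using Nat.one_le_iff_ne_zero.2 hi
        · simp [hj]
      have : ∑ j, α j = ∑ j, (α - Pi.single i 1 : Fin n → ℕ) j + 1 := by
        conv_lhs => rw [← tsub_add_cancel_of_le hle]
        simp [Finset.sum_add_distrib]
      omega
    refine Res.bind ((hP.comp_tail.analyticAt).mul (analyticAt_bracket α hc hU))
      (covers_blowUp i) ?_
    rintro e (rfl | ⟨s, rfl⟩)
    · exact (isMon_bracket_steep i hi hP hc hU hU0).res
    have hP' : IsMon fun y => P y * y i ^ (k + 2) := hP.mul (isMon_coord_pow i _)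
    set U' : (Fin (n + 1) → ℝ) → ℝ := fun x => U ((Chart.slope i s).map x) with hU'
    have hU'a : AnalyticAt ℝ U' 0 := (Chart.slope i s).analyticAt_comp hU
    have hU'0 : U' 0 ≠ 0 := by
      rw [hU']
      simp only [(Chart.slope i s).map_zero]
      exact hU0
    set H : (Fin (n + 1) → ℝ) → ℝ := fun x =>
      ∑ j ∈ Finset.range k, mon (α - Pi.single i 1) (Fin.tail x) ^ (k + 1 - j) *
        c j (Fin.tail x) * (x 0 + s) ^ j + (x 0 + s) ^ (k + 1) * U' x with hH
    have hHa : AnalyticAt ℝ H 0 := by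
      have hxs : AnalyticAt ℝ (fun x : Fin (n + 1) → ℝ => x 0 + s) 0 :=
        (analyticAt_coord 0 0).add analyticAt_const
      refine (Finset.analyticAt_fun_sum _ fun j _ => ?_).add ((hxs.pow _).mul hU'a)
      exact ((((analyticAt_mon _ 0).comp_of_eq (analyticAt_tail 0) rfl).pow _).mul
        ((hc j).comp_of_eq (analyticAt_tail 0) rfl)).mul (hxs.pow _)
    suffices hs : Res fun x => (fun y => P y * y i ^ (k + 2)) (Fin.tail x) * H x by
      refine hs.congr (Eventually.of_forall fun x => ?_)
      rw [bracket_slope i hi]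
      change P (Fin.tail x) * (Fin.tail x i ^ (k + 1) * H x) * Fin.tail x i = _
      ring
    by_cases hs : s = 0
    · refine (ih (α - Pi.single i 1) hP' hU'a hU'0 hsum).congr (Eventually.of_forall fun x => ?_)
      rw [hH, bracket]
      simp only [hs, add_zero]
    by_cases hα' : α - Pi.single i 1 = 0
    · obtain ⟨j, hjk, v, hv, hv0, hvt⟩ := exists_order_lt k (fun j => c j 0) hU0 s hs
      refine hK j hjk _ H hP' hHa ⟨v, hv, hv0, Eventually.of_forall fun t => ?_⟩
      rw [← hvt, hH]
      simp only [hα', mon_zero, one_pow, one_mul, Fin.tail_cons, Fin.cons_zero, hU']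
      congr 3
      simp [Chart.slope, cons_zero_zero, Fin.tail_cons]
    · refine (hP'.comp_tail.mul (IsMon.of_ne_zero hHa ?_)).res
      rw [hH]
      simp only [tail_zero, mon_apply_zero hα']
      rw [Finset.sum_eq_zero, zero_add]
      · simpa [hs] using hU'0
      · intro j hj
        rw [zero_pow (by have := Finset.mem_range.1 hj; omega), zero_mul, zero_mul]

theorem exists_forall_le_of_total {ι α : Type*} [PartialOrder α] {s : Finset ι} (hs : s.Nonempty)
    {a : ι → α} (h : ∀ i ∈ s, ∀ j ∈ s, a i ≤ a j ∨ a j ≤ a i) : ∃ i ∈ s, ∀ j ∈ s, a i ≤ a j := by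
  obtain ⟨i, hi⟩ := s.exists_minimalFor a hs
  exact ⟨i, hi.1, fun j hj => (h i hi.1 j hj).elim id fun hji => hi.2 hj hji⟩

/-- A chart which is a power substitution in every variable. -/
def Chart.IsPow {n : ℕ} (N : ℕ) (d : Chart n) : Prop :=
  ∃ σ : Fin n → ℝ, (∀ i, |σ i| = 1) ∧ ∀ x i, d.map x i = σ i * x i ^ N

theorem Chart.IsPow.exists_mon {n N : ℕ} {d : Chart n} (h : d.IsPow N) (β : Fin n → ℕ) :
    ∃ a : ℝ, a ≠ 0 ∧ ∀ x, mon β (d.map x) = a * mon (N • β) x := by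
  obtain ⟨σ, hσ, hd⟩ := h
  refine ⟨mon β σ, fun h0 => ?_, fun x => ?_⟩
  · obtain ⟨i, hi, -⟩ := (mon_eq_zero_iff _ _).1 h0
    have := hσ i
    rw [hi, abs_zero] at this
    exact zero_ne_one this
  · simp only [mon, hd, mul_pow, Finset.prod_mul_distrib, Pi.smul_apply, smul_eq_mul, pow_mul]

theorem Chart.IsPow.isMon_comp {n N : ℕ} {d : Chart n} (h : d.IsPow N) {f : (Fin n → ℝ) → ℝ}
    (hf : IsMon f) : IsMon fun x => f (d.map x) := by
  refine hf.comp_of_mon d.analyticAt_map d.map_zero fun β => ?_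
  obtain ⟨a, ha, hax⟩ := h.exists_mon β
  exact ((isMon_mon (N • β)).const_mul ha).congr (Eventually.of_forall hax)

theorem exists_common_monomial {n k : ℕ} {f : ℕ → (Fin n → ℝ) → ℝ}
    (hf : ∀ j < k, (∀ᶠ x in 𝓝 0, f j x = 0) ∨ IsMon (f j))
    (hsub : ∀ i < k, ∀ j < k,
      (∀ᶠ x in 𝓝 0, f i x ^ ((k + 1).factorial / (k + 1 - i)) -
        f j x ^ ((k + 1).factorial / (k + 1 - j)) = 0) ∨
      IsMon fun x => f i x ^ ((k + 1).factorial / (k + 1 - i)) -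
        f j x ^ ((k + 1).factorial / (k + 1 - j)))
    (hne : ∃ j < k, ¬ ∀ᶠ x in 𝓝 0, f j x = 0) {d : Chart n} (hd : d.IsPow (k + 1).factorial) :
    ∃ (α : Fin n → ℕ) (g : ℕ → (Fin n → ℝ) → ℝ), (∀ j, AnalyticAt ℝ (g j) 0) ∧
      (∃ j < k, g j 0 ≠ 0) ∧
      ∀ j < k, ∀ᶠ x in 𝓝 0, f j (d.map x) = mon α x ^ (k + 1 - j) * g j x := by
  classical
  set E : ℕ → ℕ := fun j => (k + 1).factorial / (k + 1 - j) with hE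
  have hEmul : ∀ j < k, (k + 1 - j) * E j = (k + 1).factorial := fun j hj =>
    Nat.mul_div_cancel' (Nat.dvd_factorial (by omega) (by omega))
  set Z := (Finset.range k).filter fun j => ¬ ∀ᶠ x in 𝓝 0, f j x = 0 with hZ
  have hZk : ∀ j ∈ Z, j < k := fun j hj => Finset.mem_range.1 (Finset.mem_filter.1 hj).1
  have hau : ∀ j, ∃ (a : Fin n → ℕ) (u : (Fin n → ℝ) → ℝ), AnalyticAt ℝ u 0 ∧ u 0 ≠ 0 ∧
      (j ∈ Z → ∀ᶠ x in 𝓝 0, f j x = mon a x * u x) := by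
    intro j
    by_cases hj : j ∈ Z
    · obtain ⟨a, u, h1, h2, h3⟩ := (hf j (hZk j hj)).resolve_left (Finset.mem_filter.1 hj).2
      exact ⟨a, u, h1, h2, fun _ => h3⟩
    · exact ⟨0, fun _ => 1, analyticAt_const, one_ne_zero, fun h => absurd h hj⟩
  choose a u hu hu0 hfu using hau
  have hpow : ∀ j ∈ Z, ∀ᶠ x in 𝓝 0, f j x ^ E j = mon (E j • a j) x * u j x ^ E j := by
    intro j hj
    filter_upwards [hfu j hj] with x hx
    rw [hx, mul_pow, mon_smul]
  have hZne : Z.Nonempty := by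
    obtain ⟨j, hj, h⟩ := hne
    exact ⟨j, Finset.mem_filter.2 ⟨Finset.mem_range.2 hj, h⟩⟩
  obtain ⟨j₀, hj₀, hmin⟩ := exists_forall_le_of_total hZne (a := fun j => E j • a j)
    fun i hi j hj => le_or_le_of_sub ((hu i).pow _) (pow_ne_zero _ (hu0 i)) ((hu j).pow _)
      (pow_ne_zero _ (hu0 j)) (hpow i hi) (hpow j hj) (hsub i (hZk i hi) j (hZk j hj))
  set α := E j₀ • a j₀ with hα
  have hle : ∀ j ∈ Z, (k + 1 - j) • α ≤ (k + 1).factorial • a j := fun j hj => by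
    rw [← hEmul j (hZk j hj), mul_smul]
    exact fun i => Nat.mul_le_mul_left _ (hmin j hj i)
  choose b hb0 hb using fun j => hd.exists_mon (a j)
  refine ⟨α, fun j x => if j ∈ Z then
    b j * mon ((k + 1).factorial • a j - (k + 1 - j) • α) x * u j (d.map x) else 0, fun j => ?_,
    ⟨j₀, hZk j₀ hj₀, ?_⟩, fun j hj => ?_⟩
  · by_cases hj : j ∈ Z
    · simp only [hj, if_true]
      exact (analyticAt_const.mul (analyticAt_mon _ 0)).mul (d.analyticAt_comp (hu j))
    · simp only [hj, if_false]
      exact analyticAt_const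
  · simp only [hj₀, if_true]
    have : (k + 1).factorial • a j₀ - (k + 1 - j₀) • α = 0 := by
      rw [hα, ← mul_smul, hEmul j₀ (hZk j₀ hj₀), tsub_self]
    rw [this, mon_zero, d.map_zero, mul_one]
    exact mul_ne_zero (hb0 j₀) (hu0 j₀)
  · by_cases hjZ : j ∈ Z
    · filter_upwards [d.tendsto_map.eventually (hfu j hjZ)] with x hx
      simp only [hjZ, if_true]
      rw [hx, hb, mon_sub_mul (hle j hjZ), mon_smul]
      ring
    · have h0 : ∀ᶠ x in 𝓝 0, f j x = 0 := by
        by_contra h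
        exact hjZ (Finset.mem_filter.2 ⟨Finset.mem_range.2 hj, h⟩)
      filter_upwards [d.tendsto_map.eventually h0] with x hx
      simp only [hjZ, if_false]
      rw [hx, mul_zero]

theorem Res.of_covers_translate {n : ℕ} {F : (Fin (n + 1) → ℝ) → ℝ} (hF : AnalyticAt ℝ F 0)
    {θ : (Fin n → ℝ) → ℝ} (hθ : AnalyticAt ℝ θ 0) (hθ0 : θ 0 = 0)
    (h : Res fun x => F (Fin.cons (x 0 + θ (Fin.tail x)) (Fin.tail x))) : Res F := by
  obtain ⟨θ', hm, ha, he⟩ := exists_measurable_eventuallyEq hθ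
  refine Res.bind hF (covers_translate θ' ha (he.self_of_nhds.trans hθ0) hm) ?_
  rintro _ rfl
  refine h.congr ?_
  filter_upwards [tendsto_tail_zero.eventually he] with x hx
  simp [Chart.translate, hx]

theorem res_of_reg {n : ℕ}
    (hR : ∀ F : (Fin n → ℝ) → ℝ, AnalyticAt ℝ F 0 → (¬ ∀ᶠ x in 𝓝 0, F x = 0) → Res F)
    (k : ℕ) : ∀ (P : (Fin n → ℝ) → ℝ) (G : (Fin (n + 1) → ℝ) → ℝ), IsMon P →
      AnalyticAt ℝ G 0 → Reg k G → Res fun x => P (Fin.tail x) * G x := by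
  classical
  induction k using Nat.strong_induction_on with
  | _ k ih =>
  intro P G hP hG hreg
  rcases k with - | k
  · refine (hP.comp_tail.mul (IsMon.of_ne_zero hG ?_)).res
    obtain ⟨v, -, hv0, h⟩ := hreg
    have := h.self_of_nhds
    rw [cons_zero_zero, pow_zero, one_mul] at this
    rwa [this]
  obtain ⟨θ, hθ, hθ0, c, hc, U, hU, hU0, -, hexp⟩ := hreg.exists_translate hG
  refine Res.of_covers_translate (hP.comp_tail.analyticAt.mul hG) hθ hθ0 ?_
  simp only [Fin.tail_cons]
  by_cases hall : ∀ j < k, ∀ᶠ x in 𝓝 0, c j x = 0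
  · have hall' : ∀ᶠ x : Fin (n + 1) → ℝ in 𝓝 0, ∀ j ∈ Finset.range k, c j (Fin.tail x) = 0 :=
      (Filter.eventually_all_finset _).2 fun j hj =>
        tendsto_tail_zero.eventually (hall j (Finset.mem_range.1 hj))
    refine ((hP.comp_tail.mul ((isMon_coord_pow 0 (k + 1)).mul
      (IsMon.of_ne_zero hU hU0))).congr ?_).res
    filter_upwards [hall', hexp] with x hx hx'
    rw [hx', Finset.sum_eq_zero, zero_add]
    intro j hj
    rw [hx j hj, zero_mul]
  push Not at hall
  set E : ℕ → ℕ := fun j => (k + 1).factorial / (k + 1 - j) with hE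
  obtain ⟨S, hS, hSc⟩ := exists_covers_family hR
    (Finset.univ : Finset (Option (Fin k × Option (Fin k))))
    (f := fun o => o.elim P fun p => p.2.elim (c p.1) fun j x => c p.1 x ^ E p.1 - c j x ^ E j)
    (by
      rintro (_ | ⟨i, _ | j⟩) -
      · exact hP.analyticAt
      · exact hc i
      · exact ((hc i).pow _).sub ((hc j).pow _))
  obtain ⟨T, hT, hTd⟩ := exists_covers_pow n (k + 1).factorial (Nat.factorial_ne_zero _)
  have hbr : AnalyticAt ℝ (fun x : Fin (n + 1) → ℝ => P (Fin.tail x) *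
      G (Fin.cons (x 0 + θ (Fin.tail x)) (Fin.tail x))) 0 := by
    refine hP.comp_tail.analyticAt.mul (hG.comp_of_eq (analyticAt_cons ((analyticAt_coord 0 0).add
      (hθ.comp_of_eq (analyticAt_tail 0) rfl)) (analyticAt_tail 0)) ?_)
    rw [tail_zero, hθ0, Pi.zero_apply, add_zero, cons_zero_zero]
  refine Res.bind hbr (hS.bind fun _ _ => hT).lift ?_
  rintro _ ⟨_, ⟨e, he, d, hd, rfl⟩, rfl⟩
  obtain ⟨hjac, halt⟩ := hSc e he
  obtain ⟨hpow, hdjac⟩ := hTd d hd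
  have hpow : d.IsPow (k + 1).factorial := hpow
  have halt' : ∀ (o : Option (Fin k × Option (Fin k))), _ := fun o => halt o (Finset.mem_univ o)
  obtain ⟨α, g, hg, hg0, hcg⟩ := exists_common_monomial (k := k) (f := fun j x => c j (e.map x))
    (fun j hj => (halt' (some (⟨j, hj⟩, none))).imp e.tendsto_comp_zero id)
    (fun i hi j hj => (halt' (some (⟨i, hi⟩, some ⟨j, hj⟩))).imp e.tendsto_comp_zero id)
    (by
      obtain ⟨j, hj, hne⟩ := hall
      refine ⟨j, hj, ?_⟩
      exact ((halt' (some (⟨j, hj⟩, none))).resolve_left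
        (not_eventually.2 hne)).not_eventually_zero) hpow
  have hPe : IsMon fun y => P (e.map (d.map y)) * (e.comp d).jac y :=
    (hpow.isMon_comp ((halt' none).resolve_left hP.not_eventually_zero)).mul
      ((hpow.isMon_comp hjac).mul hdjac)
  have hlift := (e.comp d).lift.map_zero
  refine (res_bracket (fun k' hk' => ih k' (Nat.lt_succ_of_le hk')) α hPe hg
    ((e.comp d).lift.analyticAt_comp hU) (by rwa [hlift]) hg0).congr ?_
  have hcg' : ∀ᶠ x : Fin (n + 1) → ℝ in 𝓝 0, ∀ j ∈ Finset.range k,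
      c j (e.map (d.map (Fin.tail x))) = mon α (Fin.tail x) ^ (k + 1 - j) * g j (Fin.tail x) :=
    (Filter.eventually_all_finset _).2 fun j hj =>
      tendsto_tail_zero.eventually (hcg j (Finset.mem_range.1 hj))
  filter_upwards [hcg', (e.comp d).lift.tendsto_map.eventually hexp] with x hx hx'
  rw [hx', bracket]
  have h1 : Fin.tail ((e.comp d).lift.map x) = e.map (d.map (Fin.tail x)) := rfl
  have h2 : (e.comp d).lift.map x 0 = x 0 := rfl
  have h3 : (e.comp d).lift.jac x = (e.comp d).jac (Fin.tail x) := rfl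
  rw [h1, h2, h3, Finset.sum_congr rfl fun j hj => by rw [hx j hj]]
  ring

/-- Local resolution of singularities: every nonzero analytic germ becomes a monomial times a unit
in suitable charts. -/
theorem res_of_analyticAt {n : ℕ} (F : (Fin n → ℝ) → ℝ) (hF : AnalyticAt ℝ F 0)
    (h : ¬ ∀ᶠ x in 𝓝 0, F x = 0) : Res F := by
  induction n with
  | zero =>
    refine (IsMon.of_ne_zero hF fun h0 => h ?_).res
    exact Eventually.of_forall fun x => by rw [Subsingleton.elim x 0, h0]
  | succ n ih =>
    obtain ⟨v, k, hreg⟩ := exists_shear_reg hF h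
    refine Res.bind hF (covers_shear v) ?_
    rintro _ rfl
    have ha : AnalyticAt ℝ (fun x => F ((Chart.shear v).map x)) 0 :=
      (Chart.shear v).analyticAt_comp hF
    refine (res_of_reg ih k (fun _ => 1) _ (IsMon.of_ne_zero analyticAt_const one_ne_zero) ha
      hreg).congr (Eventually.of_forall fun x => ?_)
    simp [Chart.shear]

/-- The germs `g i` are linear combinations of at most as many monomials times units, of pairwise
distinct degrees. -/
def Adapted {n N : ℕ} (g : Fin N → (Fin n → ℝ) → ℝ) : Prop :=
  ∃ k ≤ N, ∃ (β : Fin k → Fin n → ℕ) (u : Fin k → (Fin n → ℝ) → ℝ) (A : Fin N → Fin k → ℝ),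
    (∀ j, AnalyticAt ℝ (u j) 0) ∧ (∀ j, u j 0 ≠ 0) ∧
    Function.Injective (fun j => ∑ i, β j i) ∧
    ((∀ i, g i 0 = 0) → ∀ j, β j ≠ 0) ∧
    ∀ i, ∀ᶠ x in 𝓝 0, g i x = ∑ j, A i j * (mon (β j) x * u j x)

theorem adapted_of_eventually_zero {n N : ℕ} {g : Fin N → (Fin n → ℝ) → ℝ}
    (h : ∀ i, ∀ᶠ x in 𝓝 0, g i x = 0) : Adapted g := by
  refine ⟨0, Nat.zero_le _, Fin.elim0, Fin.elim0, fun _ => Fin.elim0, fun j => j.elim0,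
    fun j => j.elim0, fun j => j.elim0, fun _ j => j.elim0, fun i => ?_⟩
  simpa using h i

theorem adapted_succ {n N : ℕ} {g : Fin (N + 1) → (Fin n → ℝ) → ℝ} (i₀ : Fin (N + 1))
    (he : IsMon (g i₀)) {w : Fin N → (Fin n → ℝ) → ℝ} {a : Fin N → ℝ}
    (hw : Adapted w) (hw0 : ∀ i, w i 0 = 0)
    (hg : ∀ i, ∀ᶠ x in 𝓝 0, g (i₀.succAbove i) x = g i₀ x * (a i + w i x)) : Adapted g := by
  obtain ⟨b, v, hv, hv0, hb⟩ := he
  obtain ⟨k, hk, β, u, A, hu, hu0, hinj, hβ, hA⟩ := hw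
  refine ⟨k + 1, Nat.succ_le_succ hk, Fin.cons b fun j => b + β j,
    Fin.cons v fun j x => v x * u j x,
    Fin.insertNth (α := fun _ => Fin (k + 1) → ℝ) i₀ (Fin.cons 1 0) fun i => Fin.cons (a i) (A i),
    ?_, ?_, ?_, ?_, ?_⟩
  · rw [Fin.forall_fin_succ]
    exact ⟨by simpa using hv, fun j => by simp only [Fin.cons_succ]; exact hv.mul (hu j)⟩
  · rw [Fin.forall_fin_succ]
    exact ⟨by simpa using hv0, fun j => by simpa using ⟨hv0, hu0 j⟩⟩
  · have hpos : ∀ j, ∑ i, β j i ≠ 0 := fun j h0 => hβ hw0 j <| by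
      ext i
      exact Finset.sum_eq_zero_iff.1 h0 i (Finset.mem_univ i)
    intro j j'
    refine Fin.cases ?_ (fun j => ?_) j <;> refine Fin.cases ?_ (fun j' => ?_) j'
    · simp
    · intro h
      simp only [Fin.cons_zero, Fin.cons_succ, Pi.add_apply, Finset.sum_add_distrib] at h
      exact absurd (by omega) (hpos j')
    · intro h
      simp only [Fin.cons_zero, Fin.cons_succ, Pi.add_apply, Finset.sum_add_distrib] at h
      exact absurd (by omega) (hpos j)
    · intro h
      simp only [Fin.cons_succ, Pi.add_apply, Finset.sum_add_distrib] at h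
      exact congrArg Fin.succ (hinj (Nat.add_left_cancel h))
  · intro hg0
    have hb0 : b ≠ 0 := by
      rintro rfl
      have := hb.self_of_nhds
      rw [hg0, mon_zero, one_mul] at this
      exact hv0 this.symm
    rw [Fin.forall_fin_succ]
    refine ⟨hb0, fun j h => hb0 ?_⟩
    ext i
    have := congrFun h i
    simp only [Fin.cons_succ, Pi.add_apply, Pi.zero_apply] at this
    simp only [Pi.zero_apply]
    omega
  · rw [Fin.forall_iff_succAbove i₀]
    refine ⟨?_, fun i => ?_⟩
    · filter_upwards [hb] with x hx
      simp [Fin.sum_univ_succ, hx]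
    · filter_upwards [hb, hg i, hA i] with x hx hx' hx''
      rw [hx', hx'', hx]
      simp only [Fin.insertNth_apply_succAbove, Fin.sum_univ_succ, Fin.cons_zero, Fin.cons_succ,
        mon_add, mul_add, Finset.mul_sum]
      congr 1
      · ring
      · exact Finset.sum_congr rfl fun j _ => by ring

theorem exists_covers_adapted {n N : ℕ} (g : Fin N → (Fin n → ℝ) → ℝ)
    (hg : ∀ i, AnalyticAt ℝ (g i) 0) {D : (Fin n → ℝ) → ℝ} (hD : AnalyticAt ℝ D 0)
    (hD0 : ¬ ∀ᶠ x in 𝓝 0, D x = 0) : ∃ S : Set (Chart n), Covers S ∧ ∀ c ∈ S,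
      IsMon c.jac ∧ IsMon (fun x => D (c.map x)) ∧ Adapted fun i x => g i (c.map x) := by
  classical
  induction N generalizing D with
  | zero =>
    obtain ⟨S, hS, h⟩ := res_of_analyticAt D hD hD0
    exact ⟨S, hS, fun c hc => ⟨(h c hc).2, (h c hc).1,
      adapted_of_eventually_zero fun i => i.elim0⟩⟩
  | succ N ih =>
    obtain ⟨S, hS, hSc⟩ := exists_covers_family res_of_analyticAt
      (Finset.univ : Finset (Option (Fin (N + 1) × Option (Fin (N + 1)))))
      (f := fun o => o.elim D fun p => p.2.elim (g p.1) fun j x => g p.1 x - g j x)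
      (by
        rintro (_ | ⟨i, _ | j⟩) -
        · exact hD
        · exact hg i
        · exact (hg i).sub (hg j))
    suffices hT : ∀ c ∈ S, ∃ T : Set (Chart n), Covers T ∧ ∀ d ∈ T,
        IsMon (c.comp d).jac ∧ IsMon (fun x => D ((c.comp d).map x)) ∧
          Adapted fun i x => g i ((c.comp d).map x) by
      choose! T hT hTd using hT
      refine ⟨_, hS.bind hT, ?_⟩
      rintro e ⟨c, hc, d, hd, rfl⟩
      exact hTd c hc d hd
    intro c hc
    obtain ⟨hjac, halt⟩ := hSc c hc
    have halt' : ∀ (o : Option (Fin (N + 1) × Option (Fin (N + 1)))), _ :=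
      fun o => halt o (Finset.mem_univ o)
    have hDc : IsMon fun x => D (c.map x) := (halt' none).resolve_left hD0
    by_cases hall : ∀ i, ∀ᶠ x in 𝓝 0, g i x = 0
    · refine ⟨_, covers_refl n, ?_⟩
      rintro _ rfl
      exact ⟨hjac.mul (IsMon.of_ne_zero analyticAt_const one_ne_zero), hDc,
        adapted_of_eventually_zero fun i => c.tendsto_comp_zero (hall i)⟩
    push Not at hall
    set Z := Finset.univ.filter fun i => ¬ ∀ᶠ x in 𝓝 0, g i x = 0 with hZ
    have hau : ∀ i, ∃ (a : Fin n → ℕ) (u : (Fin n → ℝ) → ℝ), AnalyticAt ℝ u 0 ∧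
        (i ∈ Z → u 0 ≠ 0 ∧ ∀ᶠ x in 𝓝 0, g i (c.map x) = mon a x * u x) := by
      intro i
      by_cases hi : i ∈ Z
      · obtain ⟨a, u, h1, h2, h3⟩ :=
          (halt' (some (i, none))).resolve_left (Finset.mem_filter.1 hi).2
        exact ⟨a, u, h1, fun _ => ⟨h2, h3⟩⟩
      · exact ⟨0, fun _ => 1, analyticAt_const, fun h => absurd h hi⟩
    choose a u hu hgu using hau
    have hZne : Z.Nonempty := by
      obtain ⟨i, hi⟩ := hall
      exact ⟨i, Finset.mem_filter.2 ⟨Finset.mem_univ i, not_eventually.2 hi⟩⟩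
    obtain ⟨i₀, hi₀, hmin⟩ := exists_forall_le_of_total hZne (a := a)
      fun i hi j hj => le_or_le_of_sub (hu i) (hgu i hi).1 (hu j) (hgu j hj).1 (hgu i hi).2
        (hgu j hj).2 ((halt' (some (i, some j))).imp c.tendsto_comp_zero id)
    set e : (Fin n → ℝ) → ℝ := fun x => g i₀ (c.map x) with he
    have hea : AnalyticAt ℝ e 0 := c.analyticAt_comp (hg i₀)
    have hemon : IsMon e := ⟨a i₀, u i₀, hu i₀, (hgu i₀ hi₀).1, (hgu i₀ hi₀).2⟩
    have hquot : ∀ i, ∃ w : (Fin n → ℝ) → ℝ, AnalyticAt ℝ w 0 ∧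
        ∀ᶠ x in 𝓝 0, g i (c.map x) = e x * w x := by
      intro i
      by_cases hi : i ∈ Z
      · refine ⟨fun x => mon (a i - a i₀) x * u i x / u i₀ x,
          ((analyticAt_mon _ 0).mul (hu i)).div (hu i₀) (hgu i₀ hi₀).1, ?_⟩
        filter_upwards [(hgu i hi).2, (hgu i₀ hi₀).2,
          (hu i₀).continuousAt.eventually_ne (hgu i₀ hi₀).1] with x h1 h2 h3
        rw [h1, he]
        simp only
        rw [h2, mon_sub_mul (hmin i hi)]
        field_simp
      · have h0 : ∀ᶠ x in 𝓝 0, g i x = 0 := by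
          by_contra h
          exact hi (Finset.mem_filter.2 ⟨Finset.mem_univ i, h⟩)
        refine ⟨fun _ => 0, analyticAt_const, ?_⟩
        filter_upwards [c.tendsto_comp_zero h0] with x hx
        rw [hx, mul_zero]
    choose w hw hgw using hquot
    have hD' : IsMon fun x => D (c.map x) * (c.jac x * e x) := hDc.mul (hjac.mul hemon)
    obtain ⟨T, hT, hTd⟩ := ih (fun i x => w (i₀.succAbove i) x - w (i₀.succAbove i) 0)
      (fun i => (hw _).sub analyticAt_const) hD'.analyticAt hD'.not_eventually_zero
    refine ⟨T, hT, fun d hd => ?_⟩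
    obtain ⟨h1, h2, h3⟩ := hTd d hd
    have aD : AnalyticAt ℝ (fun x => D (c.map (d.map x))) 0 :=
      d.analyticAt_comp (c.analyticAt_comp hD)
    have aj := d.analyticAt_comp c.analyticAt_jac
    have ae := d.analyticAt_comp hea
    have hje := IsMon.of_mul_right aD (aj.mul ae) h2
    refine ⟨(IsMon.of_mul_left aj ae hje).mul h1, IsMon.of_mul_left aD (aj.mul ae) h2,
      adapted_succ i₀ (IsMon.of_mul_right aj ae hje) (a := fun i => w (i₀.succAbove i) 0) h3
      (fun i => ?_) fun i => ?_⟩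
    · simp only [d.map_zero, sub_self]
    · filter_upwards [d.tendsto_map.eventually (hgw (i₀.succAbove i))] with x hx
      rw [add_sub_cancel]
      exact hx

theorem volume_le_of_forall_abs_sub_le {s : Set ℝ} {d : ℝ}
    (h : ∀ x ∈ s, ∀ y ∈ s, x ≤ y → y - x ≤ d) : volume s ≤ ENNReal.ofReal d := by
  refine (Real.volume_le_diam s).trans (Metric.ediam_le fun x hx y hy => ?_)
  rw [edist_dist]
  refine ENNReal.ofReal_le_ofReal ?_
  rw [Real.dist_eq]
  rcases le_total x y with hxy | hxy
  · rw [abs_sub_comm, abs_of_nonneg (sub_nonneg.2 hxy)]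
    exact h x hx y hy hxy
  · rw [abs_of_nonneg (sub_nonneg.2 hxy)]
    exact h y hy x hx hxy

/-- Sublevel sets of a function of one variable with a large derivative of order `i`. -/
theorem volume_sublevel_le (i : ℕ) : ∃ C : ℝ, 0 ≤ C ∧ ∀ (I : Set ℝ) (Y : ℕ → ℝ → ℝ) (A lam : ℝ),
    I.OrdConnected → 0 < A → 0 < lam →
    (∀ j < i, ∀ τ ∈ I, HasDerivAt (Y j) (Y (j + 1) τ) τ) → (∀ τ ∈ I, A ≤ Y i τ) →
    volume {τ | τ ∈ I ∧ |Y 0 τ| < A * lam ^ i} ≤ ENNReal.ofReal (C * lam) := by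
  induction i with
  | zero =>
    refine ⟨0, le_rfl, fun I Y A lam _ hA _ _ hY => ?_⟩
    have : {τ | τ ∈ I ∧ |Y 0 τ| < A * lam ^ 0} = ∅ := by
      ext τ
      simp only [pow_zero, mul_one, Set.mem_ofPred_eq, Set.mem_empty_iff_false, iff_false, not_and,
        not_lt]
      exact fun h => (hY τ h).trans (le_abs_self _)
    rw [this]
    simp
  | succ i ih =>
    obtain ⟨C, hC, ih⟩ := ih
    refine ⟨C + C + 2, by positivity, fun I Y A lam hI hA hlam hd hY => ?_⟩
    have hmvt : ∀ x ∈ I, ∀ y ∈ I, x ≤ y → A * (y - x) ≤ Y i y - Y i x :=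
      hI.convex.mul_sub_le_image_sub_of_le_deriv
        (fun τ hτ => (hd i i.lt_succ_self τ hτ).continuousAt.continuousWithinAt)
        (fun τ hτ => (hd i i.lt_succ_self τ (interior_subset hτ)).differentiableAt
          |>.differentiableWithinAt)
        fun τ hτ => by
          rw [(hd i i.lt_succ_self τ (interior_subset hτ)).deriv]
          exact hY τ (interior_subset hτ)
    have hmono : ∀ x ∈ I, ∀ y ∈ I, x ≤ y → Y i x ≤ Y i y := fun x hx y hy hxy => by
      have := hmvt x hx y hy hxy
      nlinarith [mul_nonneg hA.le (sub_nonneg.2 hxy)]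
    have hAl : 0 < A * lam := mul_pos hA hlam
    have hup := ih {τ | τ ∈ I ∧ A * lam ≤ Y i τ} Y (A * lam) lam
      ⟨fun x hx y hy z hz => ⟨hI.out hx.1 hy.1 hz, hx.2.trans
        (hmono x hx.1 z (hI.out hx.1 hy.1 hz) hz.1)⟩⟩ hAl hlam
      (fun j hj τ hτ => hd j (hj.trans i.lt_succ_self) τ hτ.1) fun τ hτ => hτ.2
    have hlow := ih {τ | τ ∈ I ∧ A * lam ≤ -Y i τ} (fun j τ => -Y j τ) (A * lam) lam
      ⟨fun x hx y hy z hz => ⟨hI.out hx.1 hy.1 hz, hy.2.trans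
        (neg_le_neg (hmono z (hI.out hx.1 hy.1 hz) y hy.1 hz.2))⟩⟩ hAl hlam
      (fun j hj τ hτ => (hd j (hj.trans i.lt_succ_self) τ hτ.1).neg) fun τ hτ => hτ.2
    have hmid : volume {τ | τ ∈ I ∧ |Y i τ| < A * lam} ≤ ENNReal.ofReal (2 * lam) := by
      refine volume_le_of_forall_abs_sub_le fun x hx y hy hxy => ?_
      have h1 := hmvt x hx.1 y hy.1 hxy
      have h2 := (abs_lt.1 hx.2).1
      have h3 := (abs_lt.1 hy.2).2
      refine le_of_mul_le_mul_left ?_ hA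
      linarith
    calc volume {τ | τ ∈ I ∧ |Y 0 τ| < A * lam ^ (i + 1)}
        ≤ volume (({τ | τ ∈ {τ | τ ∈ I ∧ A * lam ≤ Y i τ} ∧ |Y 0 τ| < A * lam * lam ^ i} ∪
            {τ | τ ∈ {τ | τ ∈ I ∧ A * lam ≤ -Y i τ} ∧ |-Y 0 τ| < A * lam * lam ^ i}) ∪
            {τ | τ ∈ I ∧ |Y i τ| < A * lam}) := by
          refine measure_mono fun τ hτ => ?_
          have h1 : |Y 0 τ| < A * lam * lam ^ i := by
            rw [mul_assoc, ← pow_succ']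
            exact hτ.2
          by_cases h2 : |Y i τ| < A * lam
          · exact Or.inr ⟨hτ.1, h2⟩
          · left
            rcases le_abs.1 (not_lt.1 h2) with h3 | h3
            · exact Or.inl ⟨⟨hτ.1, h3⟩, h1⟩
            · exact Or.inr ⟨⟨hτ.1, h3⟩, by rwa [abs_neg]⟩
      _ ≤ ENNReal.ofReal (C * lam) + ENNReal.ofReal (C * lam) + ENNReal.ofReal (2 * lam) :=
          (measure_union_le _ _).trans
            (add_le_add ((measure_union_le _ _).trans (add_le_add hup hlow)) hmid)
      _ = ENNReal.ofReal ((C + C + 2) * lam) := by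
          rw [← ENNReal.ofReal_add (by positivity) (by positivity),
            ← ENNReal.ofReal_add (by positivity) (by positivity)]
          congr 1
          ring

theorem two_mul_div_add_rpow_le {ε A κ : ℝ} (hε : 0 < ε) (hA : ε ≤ A) (hκ : 0 ≤ κ) :
    (ε / A) ^ κ ≤ 2 ^ κ * (ε / (ε + A)) ^ κ := by
  have hA0 : 0 < A := hε.trans_le hA
  rw [← Real.mul_rpow zero_le_two (by positivity)]
  refine Real.rpow_le_rpow (by positivity) ?_ hκ
  rw [mul_div_assoc', div_le_div_iff₀ hA0 (by positivity)]
  nlinarith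

theorem one_le_two_mul_div_add_rpow {ε A κ : ℝ} (hA0 : 0 ≤ A) (hA : A ≤ ε) (hε : 0 < ε)
    (hκ : 0 ≤ κ) : 1 ≤ 2 ^ κ * (ε / (ε + A)) ^ κ := by
  rw [← Real.mul_rpow zero_le_two (by positivity)]
  refine Real.one_le_rpow ?_ hκ
  rw [mul_div_assoc', le_div_iff₀ (by positivity)]
  linarith

/-- Sublevel sets of a function of one variable with a derivative of order less than `k` bounded
from below in absolute value, on an interval of length at most one. -/
theorem exists_volume_sublevel_le (k : ℕ) {κ : ℝ} (hκ : 0 ≤ κ) (hk : ∀ i < k, κ * i ≤ 1) :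
    ∃ C : ℝ, 0 ≤ C ∧ ∀ i < k, ∀ (T : ℝ) (Y : ℕ → ℝ → ℝ) (A ε : ℝ), T ≤ 1 → 0 ≤ A → 0 < ε →
      (∀ j < i, ∀ τ ∈ Set.Icc 0 T, HasDerivAt (Y j) (Y (j + 1) τ) τ) →
      ((∀ τ ∈ Set.Icc 0 T, A ≤ Y i τ) ∨ ∀ τ ∈ Set.Icc 0 T, A ≤ -Y i τ) →
      volume {τ | τ ∈ Set.Icc 0 T ∧ |Y 0 τ| < ε} ≤ ENNReal.ofReal (C * (ε / (ε + A)) ^ κ) := by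
  choose C hC hCi using volume_sublevel_le
  have hsum : 0 ≤ ∑ i ∈ Finset.range k, C i := Finset.sum_nonneg fun i _ => hC i
  refine ⟨(1 + ∑ i ∈ Finset.range k, C i) * 2 ^ κ, by positivity,
    fun i hi T Y A ε hT hA hε hd hY => ?_⟩
  wlog hY' : ∀ τ ∈ Set.Icc 0 T, A ≤ Y i τ generalizing Y
  · have := this (fun j τ => -Y j τ) (fun j hj τ hτ => (hd j hj τ hτ).neg) (by simpa using hY.symm)
      (hY.resolve_left hY')
    simpa using this
  have hle : C i ≤ 1 + ∑ i ∈ Finset.range k, C i := by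
    have := Finset.single_le_sum (f := C) (fun i _ => hC i) (Finset.mem_range.2 hi)
    linarith
  rcases le_total A ε with h | h
  · refine (measure_mono (t := Set.Icc 0 T) fun τ hτ => hτ.1).trans ?_
    rw [Real.volume_Icc]
    refine ENNReal.ofReal_le_ofReal ?_
    have := one_le_two_mul_div_add_rpow hA h hε hκ
    nlinarith
  · have hA0 : 0 < A := hε.trans_le h
    refine (measure_mono (t := {τ | τ ∈ Set.Icc 0 T ∧ |Y 0 τ| < A * ((ε / A) ^ κ) ^ i})
      fun τ hτ => ⟨hτ.1, hτ.2.trans_le ?_⟩).trans ((hCi i (Set.Icc 0 T) Y A ((ε / A) ^ κ)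
        Set.ordConnected_Icc hA0 (by positivity) hd
        hY').trans (ENNReal.ofReal_le_ofReal ?_))
    · have h1 : ε / A ≤ ((ε / A) ^ κ) ^ i := by
        rw [← Real.rpow_natCast, ← Real.rpow_mul (by positivity)]
        conv_lhs => rw [← Real.rpow_one (ε / A)]
        exact Real.rpow_le_rpow_of_exponent_ge (by positivity) ((div_le_one hA0).2 h) (hk i hi)
      calc ε = A * (ε / A) := by field_simp
        _ ≤ _ := by gcongr
    · rw [mul_assoc]
      exact mul_le_mul hle (two_mul_div_add_rpow_le hε h hκ) (by positivity) (by positivity)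

/-- Some power sum with distinct nodes and nonzero weights is comparable to the coefficients. -/
theorem exists_power_sum_ge {k : ℕ} {d : Fin k → ℕ} (hd : Function.Injective d) {v : Fin k → ℝ}
    (hv : ∀ j, v j ≠ 0) (hk : 0 < k) : ∃ a : ℝ, 0 < a ∧ ∀ c : Fin k → ℝ, ∃ i : Fin k,
      a * ‖c‖ ≤ |∑ j, c j * ((d j : ℝ) ^ (i : ℕ) * v j)| := by
  let Λ : (Fin k → ℝ) →ₗ[ℝ] (Fin k → ℝ) := LinearMap.pi fun i =>
    ∑ j, ((d j : ℝ) ^ (i : ℕ) * v j) • LinearMap.proj j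
  have hΛ : ∀ c i, Λ c i = ∑ j, c j * ((d j : ℝ) ^ (i : ℕ) * v j) := fun c i => by
    simp [Λ, mul_comm]
  obtain ⟨K, hK, hanti⟩ := Λ.exists_antilipschitzWith (by
    rw [LinearMap.ker_eq_bot']
    intro c hc
    have := Matrix.eq_zero_of_forall_pow_sum_mul_pow_eq_zero (f := fun j => (d j : ℝ))
      (v := fun j => c j * v j) (fun i j hij => hd (Nat.cast_injective hij)) fun i => by
        have := congrFun hc i
        rw [hΛ] at this
        rw [← Pi.zero_apply (M := fun _ => ℝ) i, ← this]
        exact Finset.sum_congr rfl fun j _ => by ring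
    ext j
    exact (mul_eq_zero.1 (congrFun this j)).resolve_right (hv j))
  have hK' : (0 : ℝ) < K := hK
  refine ⟨(K : ℝ)⁻¹, by positivity, fun c => ?_⟩
  by_contra! h
  have h1 : ‖c‖ ≤ K * ‖Λ c‖ := by
    have := hanti.le_mul_dist c 0
    simpa using this
  have : Nonempty (Fin k) := ⟨⟨0, hk⟩⟩
  have hc0 : 0 < (K : ℝ)⁻¹ * ‖c‖ := by
    refine lt_of_le_of_ne (by positivity) fun h0 => ?_
    have := h ⟨0, hk⟩
    rw [← h0] at this
    exact absurd (abs_nonneg _) (not_le.2 this)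
  have h2 : ‖Λ c‖ < (K : ℝ)⁻¹ * ‖c‖ := by
    rw [pi_norm_lt_iff hc0]
    intro i
    rw [Real.norm_eq_abs, hΛ]
    exact h i
  rw [inv_mul_eq_div, lt_div_iff₀ hK'] at h2
  linarith [mul_comm (K : ℝ) ‖Λ c‖]

/-- The functions obtained from `u` by iterating `d` plus the Euler vector field. -/
noncomputable def eulerSeq {n : ℕ} (d : ℕ) (u : (Fin n → ℝ) → ℝ) : ℕ → (Fin n → ℝ) → ℝ
  | 0 => u
  | i + 1 => fun x => d * eulerSeq d u i x + fderiv ℝ (eulerSeq d u i) x x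

theorem analyticAt_eulerSeq {n : ℕ} (d : ℕ) {u : (Fin n → ℝ) → ℝ} {x : Fin n → ℝ}
    (hu : AnalyticAt ℝ u x) (i : ℕ) : AnalyticAt ℝ (eulerSeq d u i) x := by
  induction i with
  | zero => exact hu
  | succ i ih =>
    exact (analyticAt_const.mul ih).add
      (((ContinuousLinearMap.id ℝ ((Fin n → ℝ) →L[ℝ] ℝ)).analyticAt_bilinear
        (fderiv ℝ (eulerSeq d u i) x, x)).comp (f := fun x => (fderiv ℝ (eulerSeq d u i) x, x))
        (AnalyticAt.prod ih.fderiv analyticAt_id))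

theorem eulerSeq_zero {n : ℕ} (d : ℕ) (u : (Fin n → ℝ) → ℝ) (i : ℕ) :
    eulerSeq d u i 0 = (d : ℝ) ^ i * u 0 := by
  induction i with
  | zero => simp [eulerSeq]
  | succ i ih => simp [eulerSeq, ih, pow_succ', mul_assoc]

theorem hasDerivAt_exp_mul_eulerSeq {n : ℕ} (d : ℕ) {u : (Fin n → ℝ) → ℝ} {z : Fin n → ℝ} {τ : ℝ}
    (hu : AnalyticAt ℝ u (Real.exp τ • z)) (i : ℕ) :
    HasDerivAt (fun τ => Real.exp (d * τ) * eulerSeq d u i (Real.exp τ • z))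
      (Real.exp (d * τ) * eulerSeq d u (i + 1) (Real.exp τ • z)) τ := by
  have h1 : HasDerivAt (fun τ : ℝ => Real.exp τ • z) (Real.exp τ • z) τ :=
    (Real.hasDerivAt_exp τ).smul_const z
  have h2 := ((analyticAt_eulerSeq d hu i).differentiableAt.hasFDerivAt).comp_hasDerivAt τ h1
  have h3 : HasDerivAt (fun τ : ℝ => Real.exp (d * τ)) (Real.exp (d * τ) * d) τ := by
    simpa using ((hasDerivAt_id τ).const_mul (d : ℝ)).exp
  refine (h3.mul h2).congr_deriv ?_
  simp only [eulerSeq, Function.comp_apply]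
  ring

theorem mon_smul_vec {n : ℕ} (β : Fin n → ℕ) (s : ℝ) (z : Fin n → ℝ) :
    mon β (s • z) = s ^ (∑ i, β i) * mon β z := by
  simp [mon, mul_pow, Finset.prod_mul_distrib, Finset.prod_pow_eq_pow_sum]

theorem lintegral_exp_smul {n : ℕ} (τ : ℝ) {F : (Fin n → ℝ) → ℝ≥0∞} (hF : Measurable F) :
    ∫⁻ x, F x = ENNReal.ofReal (Real.exp τ ^ n) * ∫⁻ z, F (Real.exp τ • z) := by
  have hne : Real.exp τ ≠ 0 := (Real.exp_pos τ).ne'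
  have h := Measure.map_addHaar_smul (volume : Measure (Fin n → ℝ)) hne
  rw [← lintegral_map hF (measurable_const_smul (Real.exp τ)), h, lintegral_smul_measure,
    smul_eq_mul, ← mul_assoc, ← ENNReal.ofReal_mul (by positivity), Module.finrank_fin_fun,
    abs_of_pos (by positivity), mul_inv_cancel₀ (by positivity), ENNReal.ofReal_one, one_mul]

theorem div_add_mul_rpow_le {ε A b κ : ℝ} (hε : 0 < ε) (hA : 0 ≤ A) (hb : 0 < b) (hκ : 0 ≤ κ) :
    (ε / (ε + b * A)) ^ κ ≤ (max 1 b⁻¹) ^ κ * (ε / (ε + A)) ^ κ := by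
  have h1 : (1 : ℝ) ≤ max 1 b⁻¹ := le_max_left _ _
  have h2 : 1 ≤ max 1 b⁻¹ * b := by
    have := mul_le_mul_of_nonneg_right (le_max_right 1 b⁻¹) hb.le
    rwa [inv_mul_cancel₀ hb.ne'] at this
  rw [← Real.mul_rpow (by positivity) (by positivity)]
  refine Real.rpow_le_rpow (by positivity) ?_ hκ
  rw [mul_div_assoc', div_le_div_iff₀ (by positivity) (by positivity)]
  nlinarith [mul_le_mul_of_nonneg_right h1 hε.le, mul_le_mul_of_nonneg_right h2 hA]

theorem tendsto_exp_smul {n : ℕ} :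
    Tendsto (fun p : ℝ × (Fin n → ℝ) => Real.exp p.1 • p.2) (𝓝 (0, 0)) (𝓝 0) := by
  have h : Continuous fun p : ℝ × (Fin n → ℝ) => Real.exp p.1 • p.2 := by fun_prop
  simpa using h.tendsto (0, 0)

/-- A monomial times a unit varies by a bounded factor under small dilations. -/
theorem IsMon.exists_dilation_le {n : ℕ} {J : (Fin n → ℝ) → ℝ} (hJ : IsMon J) :
    ∃ C : ℝ, 0 < C ∧ ∀ᶠ p : ℝ × (Fin n → ℝ) in 𝓝 (0, 0),
      |J (Real.exp p.1 • p.2)| ≤ C * |J p.2| := by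
  obtain ⟨b, v, hv, hv0, hJ⟩ := hJ
  have hv0' : 0 < |v 0| := abs_pos.2 hv0
  have hsnd : Tendsto (fun p : ℝ × (Fin n → ℝ) => p.2) (𝓝 (0, 0)) (𝓝 0) :=
    continuous_snd.tendsto (0, 0)
  have hup : ∀ᶠ x in 𝓝 0, |v x| < 2 * |v 0| :=
    hv.continuousAt.abs.eventually_lt_const (by linarith)
  have hlo : ∀ᶠ x in 𝓝 0, |v 0| / 2 < |v x| :=
    hv.continuousAt.abs.eventually_const_lt (by linarith)
  have hexp : ∀ᶠ p : ℝ × (Fin n → ℝ) in 𝓝 (0, 0), Real.exp p.1 ^ (∑ i, b i) < 2 := by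
    have h : Continuous fun p : ℝ × (Fin n → ℝ) => Real.exp p.1 ^ (∑ i, b i) := by fun_prop
    exact h.continuousAt.eventually_lt_const (by simp)
  refine ⟨8, by norm_num, ?_⟩
  filter_upwards [tendsto_exp_smul.eventually hJ, hsnd.eventually hJ,
    tendsto_exp_smul.eventually hup, hsnd.eventually hlo, hexp] with p h1 h2 h3 h4 h5
  rw [h1, h2, mon_smul_vec, abs_mul, abs_mul, abs_mul, abs_of_pos (pow_pos (Real.exp_pos _) _)]
  calc Real.exp p.1 ^ (∑ i, b i) * |mon b p.2| * |v (Real.exp p.1 • p.2)|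
      ≤ 2 * |mon b p.2| * (4 * |v p.2|) := by
        gcongr
        linarith
    _ = 8 * (|mon b p.2| * |v p.2|) := by ring

theorem exists_setLIntegral_sublevel_le {n k : ℕ} {J : (Fin n → ℝ) → ℝ} (hJ : IsMon J)
    (hJm : Measurable J) {β : Fin k → Fin n → ℕ} {u : Fin k → (Fin n → ℝ) → ℝ}
    (hu : ∀ j, AnalyticAt ℝ (u j) 0) (hum : ∀ j, Measurable (u j)) (hu0 : ∀ j, u j 0 ≠ 0)
    (hβ : Function.Injective fun j => ∑ i, β j i) {κ : ℝ} (hκ : 0 ≤ κ)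
    (hk : ∀ i < k, κ * i ≤ 1) {r : ℝ} (hr : 0 < r) :
    ∃ ρ : ℝ, 0 < ρ ∧ ρ ≤ r ∧ ∃ K : ℝ≥0∞, K < ⊤ ∧ ∀ (μ : Fin k → ℝ) (ε : ℝ), 0 < ε →
      ∫⁻ x in Metric.ball 0 ρ, {x | |∑ j, μ j * (mon (β j) x * u j x)| < ε}.indicator
        (fun x => ENNReal.ofReal |J x|) x ≤
      K * ∫⁻ x in Metric.ball 0 ρ, ENNReal.ofReal
        ((ε / (ε + ‖fun j => μ j * mon (β j) x‖)) ^ κ) * ENNReal.ofReal |J x| := by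
  classical
  rcases Nat.eq_zero_or_pos k with rfl | hk0
  · refine ⟨r, hr, le_rfl, 1, one_lt_top, fun μ ε hε => ?_⟩
    rw [one_mul]
    refine lintegral_mono fun x => ?_
    have : ‖fun j : Fin 0 => μ j * mon (β j) x‖ = 0 := by
      rw [show (fun j : Fin 0 => μ j * mon (β j) x) = 0 from Subsingleton.elim _ _, norm_zero]
    simp [this, hε, hε.ne']
  set d : Fin k → ℕ := fun j => ∑ i, β j i with hd
  obtain ⟨a, ha, hpow⟩ := exists_power_sum_ge hβ hu0 hk0
  obtain ⟨C, hC, hdil⟩ := hJ.exists_dilation_le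
  obtain ⟨C₁, hC₁, hvol⟩ := exists_volume_sublevel_le k hκ hk
  have hk0' : (0 : ℝ) < k := Nat.cast_pos.2 hk0
  have hclose : ∀ᶠ p : ℝ × (Fin n → ℝ) in 𝓝 (0, 0), ∀ i j : Fin k,
      |Real.exp (d j * p.1) * eulerSeq (d j) (u j) i (Real.exp p.1 • p.2) -
        (d j : ℝ) ^ (i : ℕ) * u j 0| < a / (2 * k) := by
    refine eventually_all.2 fun i => eventually_all.2 fun j => ?_
    have h1 : Tendsto (fun p : ℝ × (Fin n → ℝ) => Real.exp (d j * p.1) *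
        eulerSeq (d j) (u j) i (Real.exp p.1 • p.2)) (𝓝 (0, 0))
        (𝓝 (1 * ((d j : ℝ) ^ (i : ℕ) * u j 0))) := by
      refine Tendsto.mul ?_ ?_
      · have : Continuous fun p : ℝ × (Fin n → ℝ) => Real.exp (d j * p.1) := by fun_prop
        simpa using this.tendsto (0, 0)
      · rw [← eulerSeq_zero]
        exact (analyticAt_eulerSeq (d j) (hu j) i).continuousAt.tendsto.comp tendsto_exp_smul
    rw [one_mul] at h1
    have := Metric.tendsto_nhds.1 h1 (a / (2 * k)) (by positivity)
    simpa only [Real.dist_eq] using this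
  have han : ∀ᶠ p : ℝ × (Fin n → ℝ) in 𝓝 (0, 0), ∀ j, AnalyticAt ℝ (u j) (Real.exp p.1 • p.2) :=
    eventually_all.2 fun j => tendsto_exp_smul.eventually (hu j).eventually_analyticAt
  obtain ⟨r₁, hr₁, hball⟩ := Metric.eventually_nhds_iff_ball.1 (hclose.and (han.and hdil))
  set ρ := min r r₁ with hρ
  set T := min 1 (r₁ / 2) with hT
  have hρ0 : 0 < ρ := lt_min hr hr₁
  have hT0 : 0 < T := lt_min one_pos (by positivity)
  have hmem : ∀ τ ∈ Set.Icc 0 T, ∀ z ∈ Metric.ball (0 : Fin n → ℝ) ρ,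
      (τ, z) ∈ Metric.ball ((0 : ℝ), (0 : Fin n → ℝ)) r₁ := by
    intro τ hτ z hz
    rw [Metric.mem_ball, Prod.dist_eq, max_lt_iff]
    constructor
    · rw [Real.dist_eq, sub_zero, abs_of_nonneg hτ.1]
      have := hτ.2.trans (min_le_right 1 (r₁ / 2))
      linarith
    · exact (Metric.mem_ball.1 hz).trans_le (min_le_right _ _)
  set K₀ : ℝ := Real.exp 1 ^ n * C * (C₁ * (max 1 (a / 2)⁻¹) ^ κ) with hK₀
  refine ⟨ρ, hρ0, min_le_left _ _, ENNReal.ofReal K₀ / ENNReal.ofReal T,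
    ENNReal.div_lt_top ofReal_ne_top (by simpa using hT0), fun μ ε hε => ?_⟩
  set f : (Fin n → ℝ) → ℝ := fun x => ∑ j, μ j * (mon (β j) x * u j x) with hf
  have hfm : Measurable f := Finset.measurable_fun_sum _ fun j _ =>
    measurable_const.mul ((measurable_mon _).mul (hum j))
  have hpt : ∀ z ∈ Metric.ball (0 : Fin n → ℝ) ρ,
      volume {τ | τ ∈ Set.Icc 0 T ∧ |f (Real.exp τ • z)| < ε} ≤
        ENNReal.ofReal (C₁ * (max 1 (a / 2)⁻¹) ^ κ) *
          ENNReal.ofReal ((ε / (ε + ‖fun j => μ j * mon (β j) z‖)) ^ κ) := by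
    intro z hz
    set c : Fin k → ℝ := fun j => μ j * mon (β j) z with hc
    set Y : ℕ → ℝ → ℝ := fun i τ => ∑ j, c j *
      (Real.exp (d j * τ) * eulerSeq (d j) (u j) i (Real.exp τ • z)) with hY
    have hY0 : ∀ τ, f (Real.exp τ • z) = Y 0 τ := fun τ => by
      simp only [hf, hY, hc, eulerSeq]
      refine Finset.sum_congr rfl fun j _ => ?_
      rw [mon_smul_vec, Real.exp_nat_mul]
      ring
    obtain ⟨i, hi⟩ := hpow c
    set S := ∑ j, c j * ((d j : ℝ) ^ (i : ℕ) * u j 0) with hS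
    have hYS : ∀ τ ∈ Set.Icc 0 T, |Y i τ - S| ≤ a / 2 * ‖c‖ := by
      intro τ hτ
      have h1 := (hball _ (hmem τ hτ z hz)).1 i
      rw [hY, hS]
      simp only
      rw [← Finset.sum_sub_distrib]
      calc _ ≤ ∑ j, |c j * (Real.exp (d j * τ) * eulerSeq (d j) (u j) i (Real.exp τ • z)) -
            c j * ((d j : ℝ) ^ (i : ℕ) * u j 0)| := Finset.abs_sum_le_sum_abs _ _
        _ ≤ ∑ _j : Fin k, ‖c‖ * (a / (2 * k)) := by
          refine Finset.sum_le_sum fun j _ => ?_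
          rw [← mul_sub, abs_mul]
          exact mul_le_mul (norm_le_pi_norm c j) (h1 j).le (abs_nonneg _) (norm_nonneg _)
        _ = a / 2 * ‖c‖ := by
          rw [Finset.sum_const, Finset.card_univ, Fintype.card_fin, nsmul_eq_mul]
          field_simp
    simp only [hY0]
    refine (hvol i i.2 T Y (a / 2 * ‖c‖) ε (min_le_left _ _) (by positivity) hε ?_ ?_).trans ?_
    · intro l _ τ hτ
      exact HasDerivAt.fun_sum fun j _ =>
        (hasDerivAt_exp_mul_eulerSeq (d j) ((hball _ (hmem τ hτ z hz)).2.1 j) l).const_mul (c j)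
    · rcases le_abs.1 hi with h | h
      · refine Or.inl fun τ hτ => ?_
        have := abs_le.1 (hYS τ hτ)
        linarith
      · refine Or.inr fun τ hτ => ?_
        have := abs_le.1 (hYS τ hτ)
        linarith
    · rw [← ENNReal.ofReal_mul (by positivity)]
      refine ENNReal.ofReal_le_ofReal ?_
      rw [mul_assoc]
      exact mul_le_mul_of_nonneg_left
        (div_add_mul_rpow_le hε (norm_nonneg _) (by positivity) hκ) hC₁
  set B := Metric.ball (0 : Fin n → ℝ) ρ with hB
  have hBm : MeasurableSet B := Metric.isOpen_ball.measurableSet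
  set E : Set (Fin n → ℝ) := {x | |f x| < ε} with hE
  have hEm : MeasurableSet E := measurableSet_lt hfm.abs measurable_const
  have hJm' : Measurable fun x => ENNReal.ofReal |J x| := hJm.abs.ennreal_ofReal
  set H : (Fin n → ℝ) → ℝ≥0∞ := E.indicator fun x => ENNReal.ofReal |J x| with hH
  have hHm : Measurable H := hJm'.indicator hEm
  have hsm : Measurable fun p : ℝ × (Fin n → ℝ) => Real.exp p.1 • p.2 := by fun_prop
  have hstep : ∀ τ ∈ Set.Icc 0 T, ∫⁻ x in B, H x ≤ ENNReal.ofReal (Real.exp 1 ^ n * C) *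
      ∫⁻ z in B, {τ | Real.exp τ • z ∈ E}.indicator (fun _ => ENNReal.ofReal |J z|) τ := by
    intro τ hτ
    rw [← lintegral_indicator hBm, lintegral_exp_smul τ (hHm.indicator hBm),
      ← lintegral_indicator hBm, ENNReal.ofReal_mul (by positivity), mul_assoc,
      ← lintegral_const_mul' (ENNReal.ofReal C) _ ofReal_ne_top]
    refine mul_le_mul' (ENNReal.ofReal_le_ofReal ?_) (lintegral_mono fun z => ?_)
    · gcongr
      exact hτ.2.trans (min_le_left _ _)
    · by_cases hz : Real.exp τ • z ∈ B
      · have hz' : z ∈ B := by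
          rw [hB, mem_ball_zero_iff] at hz ⊢
          rw [norm_smul, Real.norm_of_nonneg (Real.exp_pos τ).le] at hz
          have := Real.one_le_exp hτ.1
          nlinarith [norm_nonneg z]
        rw [Set.indicator_of_mem hz, Set.indicator_of_mem hz']
        by_cases hzE : Real.exp τ • z ∈ E
        · rw [hH, Set.indicator_of_mem hzE, Set.indicator_of_mem (by exact hzE),
            ← ENNReal.ofReal_mul hC.le]
          exact ENNReal.ofReal_le_ofReal (hball _ (hmem τ hτ z hz')).2.2
        · rw [hH, Set.indicator_of_notMem hzE]
          exact zero_le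
      · rw [Set.indicator_of_notMem hz]
        exact zero_le
  have hgm : Measurable (Function.uncurry fun (τ : ℝ) (z : Fin n → ℝ) =>
      {τ | Real.exp τ • z ∈ E}.indicator (fun _ => ENNReal.ofReal |J z|) τ) :=
    Measurable.indicator (s := {p : ℝ × (Fin n → ℝ) | Real.exp p.1 • p.2 ∈ E})
      (hJm'.comp measurable_snd) (hsm hEm)
  have hT' : ENNReal.ofReal T ≠ 0 := by simpa using hT0
  rw [← ENNReal.mul_div_right_comm, ENNReal.le_div_iff_mul_le (Or.inl hT') (Or.inl ofReal_ne_top),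
    mul_comm]
  calc ENNReal.ofReal T * ∫⁻ x in B, H x = ∫⁻ _ in Set.Icc 0 T, ∫⁻ x in B, H x := by
        rw [setLIntegral_const, Real.volume_Icc, sub_zero, mul_comm]
    _ ≤ ∫⁻ τ in Set.Icc 0 T, ENNReal.ofReal (Real.exp 1 ^ n * C) *
        ∫⁻ z in B, {τ | Real.exp τ • z ∈ E}.indicator (fun _ => ENNReal.ofReal |J z|) τ :=
        setLIntegral_mono' measurableSet_Icc hstep
    _ = ENNReal.ofReal (Real.exp 1 ^ n * C) * ∫⁻ z in B, ∫⁻ τ in Set.Icc 0 T,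
        {τ | Real.exp τ • z ∈ E}.indicator (fun _ => ENNReal.ofReal |J z|) τ := by
        rw [lintegral_const_mul' _ _ ofReal_ne_top, lintegral_lintegral_swap hgm.aemeasurable]
    _ ≤ ENNReal.ofReal (Real.exp 1 ^ n * C) * ∫⁻ z in B,
        ENNReal.ofReal (C₁ * (max 1 (a / 2)⁻¹) ^ κ) * (ENNReal.ofReal
          ((ε / (ε + ‖fun j => μ j * mon (β j) z‖)) ^ κ) * ENNReal.ofReal |J z|) := by
        refine mul_le_mul' le_rfl (setLIntegral_mono' hBm fun z hz => ?_)
        have hm : MeasurableSet {τ : ℝ | Real.exp τ • z ∈ E} :=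
          (hsm.comp (measurable_id.prodMk measurable_const)) hEm
        rw [lintegral_indicator_const hm, Measure.restrict_apply hm, mul_comm, ← mul_assoc]
        refine mul_le_mul' ((measure_mono fun τ hτ => ?_).trans (hpt z hz)) le_rfl
        exact ⟨hτ.2, hτ.1⟩
    _ = _ := by
        rw [lintegral_const_mul' _ _ ofReal_ne_top, ← mul_assoc,
          ← ENNReal.ofReal_mul (by positivity)]

theorem forall_eventually_half_le {m k : ℕ} (A : Fin (m + 1) → Fin k → ℝ) :
    ∃ δ : ℝ, 0 < δ ∧ ∀ η : Fin m → ℝ, (∀ i, |η i| < δ) →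
      ∀ j, |A 0 j| ≤ 2 * |A 0 j + ∑ i, η i * A i.succ j| := by
  have h : ∀ᶠ η : Fin m → ℝ in 𝓝 0, ∀ j, |A 0 j| ≤ 2 * |A 0 j + ∑ i, η i * A i.succ j| := by
    refine eventually_all.2 fun j => ?_
    by_cases hj : A 0 j = 0
    · exact Eventually.of_forall fun η => by rw [hj, abs_zero]; positivity
    · have hc : Continuous fun η : Fin m → ℝ => 2 * |A 0 j + ∑ i, η i * A i.succ j| := by fun_prop
      have hj' := abs_pos.2 hj
      exact (hc.continuousAt.eventually_const_lt (by simp; linarith)).mono fun _ => le_of_lt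
  obtain ⟨δ, hδ, hb⟩ := Metric.eventually_nhds_iff_ball.1 h
  exact ⟨δ, hδ, fun η hη => hb η ((mem_ball_iff_forall hδ).2 hη)⟩

theorem Chart.exists_pull_sublevel_le {n m : ℕ} (c : Chart n) (hJ : IsMon c.jac)
    {g : Fin (m + 1) → (Fin n → ℝ) → ℝ} (hgm : ∀ i, Measurable (g i))
    (hg : Adapted fun i x => g i (c.map x)) {κ : ℝ} (hκ : 0 ≤ κ) (hk : ∀ i ≤ m, κ * i ≤ 1)
    {R : ℝ} (hR : 0 < R) :
    ∃ δ : ℝ, 0 < δ ∧ ∃ ρ : ℝ, 0 < ρ ∧ ∃ K : ℝ≥0∞, K < ⊤ ∧ ∀ η : Fin m → ℝ, (∀ i, |η i| < δ) →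
      ∀ ε : ℝ, 0 < ε → ∫⁻ x in Metric.ball 0 ρ,
        c.pull ({x | |g 0 x + ∑ i, η i * g i.succ x| < ε}.indicator 1) x ≤
      K * ∫⁻ x in Metric.ball 0 R, ENNReal.ofReal ((ε / (ε + |g 0 x|)) ^ κ) := by
  obtain ⟨k, hkm, β, u, A, hu, hu0, hβ, -, hA⟩ := hg
  obtain ⟨u', hu'⟩ := Classical.axiomOfChoice fun j => exists_measurable_eventuallyEq (hu j)
  have hA' : ∀ i, ∀ᶠ x in 𝓝 0, g i (c.map x) = ∑ j, A i j * (mon (β j) x * u' j x) := by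
    intro i
    filter_upwards [hA i, eventually_all.2 fun j => (hu' j).2.2] with x h1 h2
    rw [h1]
    exact Finset.sum_congr rfl fun j _ => by rw [h2]
  obtain ⟨δ, hδ, hη⟩ := forall_eventually_half_le A
  obtain ⟨C, hC, hpull⟩ := c.exists_lintegral_le
  set M : ℝ := ∑ j, (|u' j 0| + 1) with hM
  have hM0 : 0 ≤ M := Finset.sum_nonneg fun j _ => by positivity
  have hbd : ∀ᶠ x in 𝓝 0, ∀ j, |u' j x| ≤ M := by
    refine eventually_all.2 fun j => ?_
    have hle : |u' j 0| + 1 ≤ M := Finset.single_le_sum (f := fun j => |u' j 0| + 1)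
      (fun j _ => by positivity) (Finset.mem_univ j)
    exact ((hu' j).2.1.continuousAt.abs.eventually_lt_const (by linarith)).mono fun _ => le_of_lt
  obtain ⟨r, hr, hball⟩ := Metric.eventually_nhds_iff_ball.1
    ((eventually_all.2 hA').and (hbd.and (c.tendsto_map.eventually (Metric.ball_mem_nhds 0 hR))))
  obtain ⟨ρ, hρ, hρr, K, hK, hleaf⟩ := exists_setLIntegral_sublevel_le hJ c.measurable_jac
    (fun j => (hu' j).2.1) (fun j => (hu' j).1)
    (fun j => by rw [(hu' j).2.2.self_of_nhds]; exact hu0 j) hβ hκ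
    (fun i hi => hk i (by omega)) hr
  set b : ℝ := (2 * k * M + 1)⁻¹ with hb
  have hb0 : 0 < b := by positivity
  refine ⟨δ, hδ, ρ, hρ, K * (ENNReal.ofReal ((max 1 b⁻¹) ^ κ) * C),
    mul_lt_top hK (mul_lt_top ofReal_lt_top hC), fun η hηδ ε hε => ?_⟩
  set μ : Fin k → ℝ := fun j => A 0 j + ∑ i, η i * A i.succ j with hμ
  have hBm : MeasurableSet (Metric.ball (0 : Fin n → ℝ) ρ) := Metric.isOpen_ball.measurableSet
  set G : (Fin n → ℝ) → ℝ≥0∞ := fun x => ENNReal.ofReal ((ε / (ε + |g 0 x|)) ^ κ) with hG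
  have hGm : Measurable G :=
    ((measurable_const.div (measurable_const.add (hgm 0).abs)).pow_const κ).ennreal_ofReal
  have hsum : ∀ x ∈ Metric.ball (0 : Fin n → ℝ) ρ,
      g 0 (c.map x) + ∑ i, η i * g i.succ (c.map x) = ∑ j, μ j * (mon (β j) x * u' j x) := by
    intro x hx
    have h := (hball x (Metric.ball_subset_ball hρr hx)).1
    simp only [h, hμ, add_mul, Finset.sum_add_distrib, Finset.sum_mul, Finset.mul_sum]
    congr 1
    rw [Finset.sum_comm]
    exact Finset.sum_congr rfl fun j _ => Finset.sum_congr rfl fun i _ => by ring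
  have hq : ∀ x ∈ Metric.ball (0 : Fin n → ℝ) ρ,
      b * |g 0 (c.map x)| ≤ ‖fun j => μ j * mon (β j) x‖ := by
    intro x hx
    obtain ⟨h1, h2, -⟩ := hball x (Metric.ball_subset_ball hρr hx)
    set B := ‖fun j => μ j * mon (β j) x‖ with hB
    have h3 : |g 0 (c.map x)| ≤ 2 * k * M * B := by
      rw [h1]
      calc _ ≤ ∑ j, |A 0 j * (mon (β j) x * u' j x)| := Finset.abs_sum_le_sum_abs _ _
        _ ≤ ∑ _j : Fin k, 2 * (B * M) := by
          refine Finset.sum_le_sum fun j _ => ?_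
          rw [abs_mul, abs_mul]
          calc |A 0 j| * (|mon (β j) x| * |u' j x|)
              ≤ (2 * |μ j|) * (|mon (β j) x| * M) := by
                gcongr
                · exact hη η hηδ j
                · exact h2 j
            _ = 2 * (‖μ j * mon (β j) x‖ * M) := by
                rw [Real.norm_eq_abs, abs_mul]
                ring
            _ ≤ 2 * (B * M) := by
                gcongr
                exact norm_le_pi_norm (fun j => μ j * mon (β j) x) j
        _ = 2 * k * M * B := by
          rw [Finset.sum_const, Finset.card_univ, Fintype.card_fin, nsmul_eq_mul]
          ring
    rw [hb, inv_mul_le_iff₀ (by positivity)]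
    linarith [norm_nonneg fun j => μ j * mon (β j) x]
  calc ∫⁻ x in Metric.ball 0 ρ,
        c.pull ({x | |g 0 x + ∑ i, η i * g i.succ x| < ε}.indicator 1) x
      = ∫⁻ x in Metric.ball 0 ρ, {x | |∑ j, μ j * (mon (β j) x * u' j x)| < ε}.indicator
        (fun x => ENNReal.ofReal |c.jac x|) x := by
        refine setLIntegral_congr_fun hBm fun x hx => ?_
        by_cases hE : |∑ j, μ j * (mon (β j) x * u' j x)| < ε
        · rw [Set.indicator_of_mem (by exact hE), Chart.pull, Set.indicator_of_mem
            (by rw [Set.mem_ofPred_eq, hsum x hx]; exact hE), Pi.one_apply, one_mul]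
        · rw [Set.indicator_of_notMem (by exact hE), Chart.pull, Set.indicator_of_notMem
            (by rw [Set.mem_ofPred_eq, hsum x hx]; exact hE), zero_mul]
    _ ≤ K * ∫⁻ x in Metric.ball 0 ρ, ENNReal.ofReal
        ((ε / (ε + ‖fun j => μ j * mon (β j) x‖)) ^ κ) * ENNReal.ofReal |c.jac x| := hleaf μ ε hε
    _ ≤ K * ∫⁻ x, ENNReal.ofReal ((max 1 b⁻¹) ^ κ) *
        c.pull ((Metric.ball 0 R).indicator G) x := by
        refine mul_le_mul' le_rfl ?_
        rw [← lintegral_indicator hBm]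
        refine lintegral_mono fun x => ?_
        by_cases hx : x ∈ Metric.ball (0 : Fin n → ℝ) ρ
        · have hxR : c.map x ∈ Metric.ball 0 R := (hball x (Metric.ball_subset_ball hρr hx)).2.2
          rw [Set.indicator_of_mem hx, Chart.pull, Set.indicator_of_mem hxR, ← mul_assoc]
          refine mul_le_mul' ?_ le_rfl
          rw [← ENNReal.ofReal_mul (by positivity)]
          refine ENNReal.ofReal_le_ofReal ?_
          refine (Real.rpow_le_rpow (by positivity) ?_ hκ).trans
            (div_add_mul_rpow_le hε (abs_nonneg _) hb0 hκ)
          exact div_le_div_of_nonneg_left hε.le (by positivity) (by linarith [hq x hx])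
        · rw [Set.indicator_of_notMem hx]
          exact zero_le
    _ ≤ K * (ENNReal.ofReal ((max 1 b⁻¹) ^ κ) * (C * ∫⁻ x in Metric.ball 0 R, G x)) := by
        rw [lintegral_const_mul' _ _ ofReal_ne_top, ← lintegral_indicator
          Metric.isOpen_ball.measurableSet]
        gcongr
        exact hpull _ (hGm.indicator Metric.isOpen_ball.measurableSet)
    _ = _ := by simp only [mul_assoc, hG]

/-- Sublevel sets of small perturbations are controlled by the unperturbed function. -/
theorem exists_volume_perturbed_sublevel_le {n m : ℕ} {g : Fin (m + 1) → (Fin n → ℝ) → ℝ}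
    (hgm : ∀ i, Measurable (g i)) (hg : ∀ i, AnalyticAt ℝ (g i) 0) {κ : ℝ} (hκ : 0 ≤ κ)
    (hk : ∀ i ≤ m, κ * i ≤ 1) {R : ℝ} (hR : 0 < R) :
    ∃ δ : ℝ, 0 < δ ∧ ∃ ρ : ℝ, 0 < ρ ∧ ∃ K : ℝ≥0∞, K < ⊤ ∧ ∀ η : Fin m → ℝ, (∀ i, |η i| < δ) →
      ∀ ε : ℝ, 0 < ε →
        volume ({x | |g 0 x + ∑ i, η i * g i.succ x| < ε} ∩ Metric.ball 0 ρ) ≤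
          K * ∫⁻ x in Metric.ball 0 R, ENNReal.ofReal ((ε / (ε + |g 0 x|)) ^ κ) := by
  obtain ⟨S, hS, hSc⟩ := exists_covers_adapted g hg (D := fun _ => 1) analyticAt_const
    fun h => one_ne_zero h.self_of_nhds
  have key : ∀ c : Chart n, ∃ ρ : ℝ, 0 < ρ ∧ ∃ δ : ℝ, 0 < δ ∧ ∃ K : ℝ≥0∞, K < ⊤ ∧ (c ∈ S →
      ∀ η : Fin m → ℝ, (∀ i, |η i| < δ) → ∀ ε : ℝ, 0 < ε → ∫⁻ x in Metric.ball 0 ρ,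
        c.pull ({x | |g 0 x + ∑ i, η i * g i.succ x| < ε}.indicator 1) x ≤
      K * ∫⁻ x in Metric.ball 0 R, ENNReal.ofReal ((ε / (ε + |g 0 x|)) ^ κ)) := by
    intro c
    by_cases hc : c ∈ S
    · obtain ⟨δ, hδ, ρ, hρ, K, hK, h⟩ :=
        c.exists_pull_sublevel_le (hSc c hc).1 hgm (hSc c hc).2.2 hκ hk hR
      exact ⟨ρ, hρ, δ, hδ, K, hK, fun _ => h⟩
    · exact ⟨1, one_pos, 1, one_pos, 1, one_lt_top, fun h => absurd h hc⟩
  choose r hr d hd K hK hpull using key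
  obtain ⟨L, hL, ρ, hρ, hcov⟩ := hS r hr
  obtain ⟨δ, hδ, hδL⟩ : ∃ δ : ℝ, 0 < δ ∧ ∀ c ∈ L, δ ≤ d c := by
    clear hcov hL
    induction L with
    | nil => exact ⟨1, one_pos, by simp⟩
    | cons c L ih =>
      obtain ⟨δ, hδ, h⟩ := ih
      refine ⟨min δ (d c), lt_min hδ (hd c), fun e he => ?_⟩
      rcases List.mem_cons.1 he with rfl | he
      · exact min_le_right _ _
      · exact (min_le_left _ _).trans (h e he)
  refine ⟨δ, hδ, ρ, hρ, (L.map K).sum, ?_, fun η hη ε hε => ?_⟩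
  · clear hcov hL hδL
    induction L with
    | nil => simp
    | cons c L ih => simpa using ⟨hK c, ih⟩
  · have hEm : MeasurableSet {x | |g 0 x + ∑ i, η i * g i.succ x| < ε} :=
      measurableSet_lt ((hgm 0).add (Finset.measurable_fun_sum _ fun i _ =>
        measurable_const.mul (hgm _))).abs measurable_const
    have h1 := hcov _ ((measurable_one (α := ℝ≥0∞)).indicator hEm)
    rw [lintegral_indicator_one hEm, Measure.restrict_apply hEm] at h1
    refine h1.trans ?_
    clear h1 hcov
    induction L with
    | nil => simp
    | cons c L ih =>
      simp only [List.map_cons, List.sum_cons, add_mul]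
      refine add_le_add ?_ (ih (fun e he => hL e (by simp [he])) fun e he => hδL e (by simp [he]))
      exact hpull c (hL c (by simp)) η (fun i => (hη i).trans_le (hδL c (by simp))) ε hε

theorem exists_dyadic {y ε : ℝ} (hε : 0 < ε) :
    ∃ i : ℕ, y < 2 ^ (i + 1) * ε ∧ (i = 0 ∨ 2 ^ i * ε ≤ y) := by
  classical
  have hex : ∃ i : ℕ, y < 2 ^ (i + 1) * ε := by
    obtain ⟨i, hi⟩ := pow_unbounded_of_one_lt (y / ε) one_lt_two
    refine ⟨i, ?_⟩
    rw [div_lt_iff₀ hε] at hi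
    refine hi.trans_le ?_
    gcongr
    · norm_num
    · exact i.le_succ
  refine ⟨Nat.find hex, Nat.find_spec hex, ?_⟩
  rcases Nat.eq_zero_or_pos (Nat.find hex) with h | h
  · exact Or.inl h
  · have := Nat.find_min hex (Nat.sub_lt h Nat.one_pos)
    rw [show Nat.find hex - 1 + 1 = Nat.find hex by omega] at this
    exact Or.inr (not_lt.1 this)

theorem lintegral_div_add_rpow_le {α : Type*} [MeasurableSpace α] {μ : Measure α} {y : α → ℝ}
    (hy : Measurable y) (hy0 : ∀ x, 0 ≤ y x) {ε D h κ : ℝ} (hε : 0 < ε) (hD : 0 ≤ D)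
    (hh : 0 < h) (hκ : h < κ)
    (hV : ∀ ε', ε ≤ ε' → μ {x | y x < ε'} ≤ ENNReal.ofReal (D * ε' ^ h)) :
    ∫⁻ x, ENNReal.ofReal ((ε / (ε + y x)) ^ κ) ∂μ ≤
      ENNReal.ofReal (2 ^ h * (1 - 2 ^ (h - κ))⁻¹ * (D * ε ^ h)) := by
  have hr : (2 : ℝ) ^ (h - κ) < 1 := Real.rpow_lt_one_of_one_lt_of_neg one_lt_two (by linarith)
  have hr0 : (0 : ℝ) < 2 ^ (h - κ) := by positivity
  have hpt : ∀ x, ENNReal.ofReal ((ε / (ε + y x)) ^ κ) ≤ ∑' i : ℕ,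
      {x | y x < 2 ^ (i + 1) * ε}.indicator (fun _ => ENNReal.ofReal ((2 ^ (-κ)) ^ i)) x := by
    intro x
    obtain ⟨i, hi, hi'⟩ := exists_dyadic (y := y x) hε
    refine le_trans ?_ (ENNReal.le_tsum i)
    rw [Set.indicator_of_mem (by exact hi)]
    refine ENNReal.ofReal_le_ofReal ?_
    have h0 := hy0 x
    rw [← Real.rpow_natCast, ← Real.rpow_mul zero_le_two, mul_comm, Real.rpow_mul zero_le_two,
      Real.rpow_natCast, Real.rpow_neg (by positivity), ← Real.inv_rpow (by positivity)]
    refine Real.rpow_le_rpow (by positivity) ?_ (hh.le.trans hκ.le)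
    rw [div_le_iff₀ (by positivity), inv_mul_eq_div, le_div_iff₀ (by positivity)]
    rcases hi' with rfl | hi'
    · simpa using h0
    · linarith
  have hm : ∀ i : ℕ, MeasurableSet {x | y x < 2 ^ (i + 1) * ε} := fun i =>
    measurableSet_lt hy measurable_const
  calc _ ≤ ∫⁻ x, ∑' i : ℕ, {x | y x < 2 ^ (i + 1) * ε}.indicator
        (fun _ => ENNReal.ofReal ((2 ^ (-κ)) ^ i)) x ∂μ := lintegral_mono hpt
    _ = ∑' i : ℕ, ENNReal.ofReal ((2 ^ (-κ)) ^ i) * μ {x | y x < 2 ^ (i + 1) * ε} := by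
        rw [lintegral_tsum fun i => (measurable_const.indicator (hm i)).aemeasurable]
        exact tsum_congr fun i => lintegral_indicator_const (hm i) _
    _ ≤ ∑' i : ℕ, ENNReal.ofReal (2 ^ h * (D * ε ^ h) * (2 ^ (h - κ)) ^ i) := by
        refine ENNReal.tsum_le_tsum fun i => ?_
        refine (mul_le_mul' le_rfl (hV (2 ^ (i + 1) * ε) ?_)).trans_eq ?_
        · have : (1 : ℝ) ≤ 2 ^ (i + 1) := one_le_pow₀ one_le_two
          nlinarith
        · rw [← ENNReal.ofReal_mul (by positivity)]
          congr 1
          rw [Real.mul_rpow (by positivity) hε.le, pow_succ,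
            Real.mul_rpow (by positivity) zero_le_two, ← Real.rpow_natCast 2 i,
            ← Real.rpow_mul zero_le_two, mul_comm (i : ℝ) h, Real.rpow_mul zero_le_two,
            Real.rpow_natCast, sub_eq_add_neg, Real.rpow_add two_pos, mul_pow]
          ring
    _ = _ := by
        rw [← ENNReal.ofReal_tsum_of_nonneg (fun i => by positivity)
          ((summable_geometric_of_lt_one hr0.le hr).mul_left _), tsum_mul_left,
          tsum_geometric_of_lt_one hr0.le hr]
        congr 1
        ring

theorem summable_dyadic_power (l : ℕ) {t h : ℝ} (hth : t < h) : Summable fun j : ℕ =>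
    (2 : ℝ) ^ (((j : ℝ) + 4) * t) * ((2 ^ (-((j : ℝ) + 2))) ^ h *
      Real.log (1 / 2 ^ (-((j : ℝ) + 2))) ^ l) := by
  have hr : (2 : ℝ) ^ (t - h) < 1 := Real.rpow_lt_one_of_one_lt_of_neg one_lt_two (by linarith)
  have hr0 : (0 : ℝ) < 2 ^ (t - h) := by positivity
  have h1 := (summable_nat_add_iff 2).2 (summable_pow_mul_geometric_of_norm_lt_one (R := ℝ) l
    (r := 2 ^ (t - h)) (by rwa [Real.norm_of_nonneg hr0.le]))
  refine (h1.mul_left (2 ^ (2 * t) * Real.log 2 ^ l)).congr fun j => ?_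
  rw [one_div, ← Real.rpow_neg zero_le_two, neg_neg, Real.log_rpow two_pos,
    ← Real.rpow_mul zero_le_two, ← Real.rpow_natCast (2 ^ (t - h)), ← Real.rpow_mul zero_le_two]
  push_cast
  have h2 : (2 : ℝ) ^ (((j : ℝ) + 4) * t) * 2 ^ (-((j : ℝ) + 2) * h) =
      2 ^ (2 * t) * 2 ^ ((t - h) * ((j : ℝ) + 2)) := by
    rw [← Real.rpow_add two_pos, ← Real.rpow_add two_pos]
    congr 1
    ring
  calc _ = (2 ^ (2 * t) * 2 ^ ((t - h) * ((j : ℝ) + 2))) * (((j : ℝ) + 2) * Real.log 2) ^ l := by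
        rw [mul_pow]
        ring
    _ = _ := by
        rw [← h2]
        ring

theorem exists_lintegral_rpow_neg_le {l : ℕ} {C t h v : ℝ} (hC : 0 ≤ C) (ht : 0 < t)
    (hth : t < h) : ∃ D : ℝ≥0∞, D < ⊤ ∧ ∀ {α : Type} [MeasurableSpace α] (μ : Measure α)
      (y : α → ℝ), Measurable y → (∀ x, 0 ≤ y x) → μ Set.univ ≤ ENNReal.ofReal v →
      (∀ ε, 0 < ε → ε < 1 / 2 →
        μ {x | y x < ε} ≤ ENNReal.ofReal (C * ε ^ h * Real.log (1 / ε) ^ l)) →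
      ∫⁻ x, ENNReal.ofReal (y x ^ (-t)) ∂μ ≤ D := by
  have hsum := (summable_dyadic_power l hth).mul_left C
  have hlog : ∀ j : ℕ, 0 ≤ Real.log (1 / 2 ^ (-((j : ℝ) + 2))) := fun j => by
    rw [one_div, ← Real.rpow_neg zero_le_two, neg_neg]
    exact Real.log_nonneg (Real.one_le_rpow one_le_two (by positivity))
  refine ⟨ENNReal.ofReal (8 ^ t) * ENNReal.ofReal v + ENNReal.ofReal (∑' j : ℕ, C *
    ((2 : ℝ) ^ (((j : ℝ) + 4) * t) * ((2 ^ (-((j : ℝ) + 2))) ^ h *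
      Real.log (1 / 2 ^ (-((j : ℝ) + 2))) ^ l))),
    ENNReal.add_lt_top.2 ⟨mul_lt_top ofReal_lt_top ofReal_lt_top, ofReal_lt_top⟩,
    fun μ y hy hy0 hμ hV => ?_⟩
  have hm : ∀ j : ℕ, MeasurableSet {x | y x < (2 : ℝ) ^ (-((j : ℝ) + 2))} := fun j =>
    measurableSet_lt hy measurable_const
  have hpt : ∀ x, ENNReal.ofReal (y x ^ (-t)) ≤ ENNReal.ofReal (8 ^ t) + ∑' j : ℕ,
      {x | y x < (2 : ℝ) ^ (-((j : ℝ) + 2))}.indicator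
        (fun _ => ENNReal.ofReal (2 ^ (((j : ℝ) + 4) * t))) x := by
    intro x
    rcases (hy0 x).eq_or_lt with h0 | h0
    · rw [← h0, Real.zero_rpow (by linarith)]
      simp
    obtain ⟨i, hi, hi'⟩ := exists_dyadic (y := 1 / 4) h0
    rcases i with _ | k
    · refine le_trans (ENNReal.ofReal_le_ofReal ?_) le_self_add
      rw [Real.rpow_neg h0.le, ← Real.inv_rpow h0.le]
      refine Real.rpow_le_rpow (by positivity) ?_ ht.le
      rw [inv_le_comm₀ h0 (by norm_num)]
      norm_num at hi ⊢
      linarith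
    · replace hi' := hi'.resolve_left k.succ_ne_zero
      refine le_trans ?_ (le_add_of_nonneg_left (zero_le))
      refine le_trans ?_ (ENNReal.le_tsum k)
      rw [Set.indicator_of_mem, Real.rpow_neg h0.le, ← Real.inv_rpow h0.le,
        Real.rpow_mul zero_le_two]
      · refine ENNReal.ofReal_le_ofReal (Real.rpow_le_rpow (by positivity) ?_ ht.le)
        rw [inv_le_comm₀ h0 (by positivity), ← Real.rpow_neg zero_le_two,
          Real.rpow_neg zero_le_two, inv_le_iff_one_le_mul₀ (by positivity)]
        rw [show (k : ℝ) + 4 = ((k + 4 : ℕ) : ℝ) by push_cast; ring, Real.rpow_natCast]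
        ring_nf at hi ⊢
        linarith
      · rw [Set.mem_ofPred_eq, Real.rpow_neg zero_le_two,
          show (k : ℝ) + 2 = ((k + 2 : ℕ) : ℝ) by push_cast; ring, Real.rpow_natCast,
          lt_inv_comm₀ h0 (by positivity), ← mul_one (y x)⁻¹, lt_inv_mul_iff₀ h0]
        have : (0 : ℝ) < 2 ^ k * y x := by positivity
        ring_nf at hi' ⊢
        linarith
  calc _ ≤ ∫⁻ x, (ENNReal.ofReal (8 ^ t) + ∑' j : ℕ,
        {x | y x < (2 : ℝ) ^ (-((j : ℝ) + 2))}.indicator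
          (fun _ => ENNReal.ofReal (2 ^ (((j : ℝ) + 4) * t))) x) ∂μ := lintegral_mono hpt
    _ = ENNReal.ofReal (8 ^ t) * μ Set.univ + ∑' j : ℕ,
        ENNReal.ofReal (2 ^ (((j : ℝ) + 4) * t)) *
          μ {x | y x < (2 : ℝ) ^ (-((j : ℝ) + 2))} := by
        rw [lintegral_add_left measurable_const, lintegral_const,
          lintegral_tsum fun i => (measurable_const.indicator (hm i)).aemeasurable]
        exact congrArg _ (tsum_congr fun i => lintegral_indicator_const (hm i) _)
    _ ≤ _ := by
        refine add_le_add (mul_le_mul' le_rfl hμ) ?_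
        rw [ENNReal.ofReal_tsum_of_nonneg _ hsum]
        · refine ENNReal.tsum_le_tsum fun j => ?_
          refine (mul_le_mul' le_rfl (hV _ (by positivity) ?_)).trans_eq ?_
          · refine (Real.rpow_lt_rpow_of_exponent_lt one_lt_two
              (show -((j : ℝ) + 2) < -1 by linarith [j.cast_nonneg (α := ℝ)])).trans_eq ?_
            norm_num [Real.rpow_neg_one]
          · rw [← ENNReal.ofReal_mul (by positivity)]
            congr 1
            ring
        · intro j
          have := hlog j
          positivity

theorem exists_le_of_isLittleO {V : ℝ → ℝ} {W c h : ℝ} {l : ℕ} (hh : 0 < h) (hc : 0 < c)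
    (hV0 : ∀ ε, 0 ≤ V ε) (hVW : ∀ ε, V ε ≤ W)
    (hV : (fun ε => V ε - c * ε ^ h * Real.log (1 / ε) ^ l) =o[𝓝[>] 0]
      fun ε => ε ^ h * Real.log (1 / ε) ^ l) :
    ∃ C, 0 < C ∧ ∀ ε, 0 < ε → ε < 1 / 2 → ∀ ε', ε ≤ ε' →
      V ε' ≤ C * Real.log (1 / ε) ^ l * ε' ^ h := by
  have h1 := hV.bound one_pos
  obtain ⟨u, hu, hsub⟩ := mem_nhdsGT_iff_exists_Ioo_subset.1 h1
  obtain ⟨e, he0, he⟩ := exists_between (lt_min (show (0 : ℝ) < u from hu) one_pos)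
  have hW : 0 ≤ W := (hV0 0).trans (hVW 0)
  have hlog2 : 0 < Real.log 2 := Real.log_pos one_lt_two
  refine ⟨c + 1 + W / (e ^ h * Real.log 2 ^ l), by positivity, fun ε hε hε2 ε' hεε' => ?_⟩
  have hε' := hε.trans_le hεε'
  have hle : Real.log 2 ≤ Real.log (1 / ε) :=
    Real.log_le_log two_pos (by rw [le_div_iff₀ hε]; linarith)
  have hl0 : 0 ≤ Real.log (1 / ε) := hlog2.le.trans hle
  rcases lt_or_ge ε' e with hlt | hge
  · have h2 : ε' < u := hlt.trans (he.trans_le (min_le_left _ _))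
    have h3 : ε' < 1 := hlt.trans (he.trans_le (min_le_right _ _))
    have h4 := hsub ⟨hε', h2⟩
    have hl1 : 0 ≤ Real.log (1 / ε') := Real.log_nonneg (by rw [le_div_iff₀ hε']; linarith)
    have hl2 : Real.log (1 / ε') ≤ Real.log (1 / ε) :=
      Real.log_le_log (by positivity) (by gcongr)
    rw [Set.mem_ofPred_eq, one_mul, Real.norm_eq_abs, Real.norm_of_nonneg (by positivity)] at h4
    have h5 := (abs_le.1 h4).2
    calc V ε' ≤ (c + 1) * Real.log (1 / ε') ^ l * ε' ^ h := by linarith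
      _ ≤ _ := by
        have : c + 1 ≤ c + 1 + W / (e ^ h * Real.log 2 ^ l) :=
          le_add_of_nonneg_right (by positivity)
        gcongr
  · calc V ε' ≤ W := hVW ε'
      _ = W / (e ^ h * Real.log 2 ^ l) * Real.log 2 ^ l * e ^ h := by field_simp
      _ ≤ _ := by
        gcongr
        exact le_add_of_nonneg_left (by positivity)

theorem eventually_ge_of_isLittleO {V : ℝ → ℝ} {c h : ℝ} {l : ℕ} (hc : 0 < c)
    (hV : (fun ε => V ε - c * ε ^ h * Real.log (1 / ε) ^ l) =o[𝓝[>] 0]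
      fun ε => ε ^ h * Real.log (1 / ε) ^ l) :
    ∀ᶠ ε in 𝓝[>] 0, c / 2 * Real.log 2 ^ l * ε ^ h ≤ V ε := by
  filter_upwards [hV.bound (half_pos hc), Ioo_mem_nhdsGT (show (0 : ℝ) < 1 / 2 by norm_num)]
    with ε h1 h2
  have hlog2 : 0 < Real.log 2 := Real.log_pos one_lt_two
  have hε := h2.1
  have hle : Real.log 2 ≤ Real.log (1 / ε) :=
    Real.log_le_log two_pos (by rw [le_div_iff₀ hε]; linarith [h2.2])
  have hl0 : 0 ≤ Real.log (1 / ε) := hlog2.le.trans hle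
  rw [Real.norm_eq_abs, Real.norm_of_nonneg (by positivity)] at h1
  have h3 := (abs_le.1 h1).1
  calc c / 2 * Real.log 2 ^ l * ε ^ h ≤ c / 2 * Real.log (1 / ε) ^ l * ε ^ h := by gcongr
    _ ≤ _ := by linarith

theorem lt_of_lintegral_rpow_neg_lt_top {α : Type*} [MeasurableSpace α] {μ : Measure α}
    [IsFiniteMeasure μ] {y : α → ℝ} (hy : Measurable y) {c h t : ℝ}
    (hc : 0 < c) (ht : 0 < t) (hV : ∀ᶠ ε in 𝓝[>] 0, ENNReal.ofReal (c * ε ^ h) ≤ μ {x | y x < ε})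
    (hlim : Tendsto (fun ε => μ {x | y x < ε}) (𝓝[>] 0) (𝓝 0))
    (hint : ∫⁻ x, ENNReal.ofReal (y x ^ (-t)) ∂μ < ⊤) : t < h := by
  by_contra! hth
  have hzero : ∀ᵐ x ∂μ, 0 < y x := by
    have : μ {x | y x ≤ 0} = 0 := le_antisymm (ge_of_tendsto hlim (by
      filter_upwards [self_mem_nhdsWithin] with ε hε
      exact measure_mono fun x (hx : y x ≤ 0) => hx.trans_lt hε)) zero_le
    rw [ae_iff]
    simpa only [not_lt] using this
  have h1 := tendsto_setLIntegral_zero (s := fun ε : ℝ => {x | y x < ε}) hint.ne hlim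
  have h2 : ENNReal.ofReal c ≤ 0 := by
    refine ge_of_tendsto h1 ?_
    filter_upwards [hV, Ioo_mem_nhdsGT (zero_lt_one (α := ℝ))] with ε hε hε1
    have hm : MeasurableSet {x | y x < ε} := measurableSet_lt hy measurable_const
    calc ENNReal.ofReal c ≤ ENNReal.ofReal (ε ^ (-t)) * ENNReal.ofReal (c * ε ^ h) := by
          rw [← ENNReal.ofReal_mul (by have := hε1.1; positivity)]
          refine ENNReal.ofReal_le_ofReal ?_
          have : 1 ≤ ε ^ (h - t) :=
            Real.one_le_rpow_of_pos_of_le_one_of_nonpos hε1.1 hε1.2.le (by linarith)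
          calc c ≤ c * ε ^ (h - t) := le_mul_of_one_le_right hc.le this
            _ = _ := by
              rw [sub_eq_neg_add, Real.rpow_add hε1.1]
              ring
      _ ≤ ENNReal.ofReal (ε ^ (-t)) * μ {x | y x < ε} := by gcongr
      _ = ∫⁻ _ in {x | y x < ε}, ENNReal.ofReal (ε ^ (-t)) ∂μ := by rw [setLIntegral_const]
      _ ≤ _ := by
        refine setLIntegral_mono_ae' hm ?_
        filter_upwards [hzero] with x hx hxε
        exact ENNReal.ofReal_le_ofReal
          (Real.rpow_le_rpow_of_nonpos hx (le_of_lt hxε) (by linarith))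
  simp only [nonpos_iff_eq_zero, ENNReal.ofReal_eq_zero] at h2
  linarith

theorem exists_volume_perturbed_sublevel_le_euclidean {n m : ℕ}
    {g : Fin (m + 1) → EuclideanSpace ℝ (Fin n) → ℝ} (hgm : ∀ i, Measurable (g i))
    (hg : ∀ i, AnalyticAt ℝ (g i) 0) {κ : ℝ} (hκ : 0 ≤ κ) (hk : ∀ i : ℕ, i ≤ m → κ * i ≤ 1)
    {R : ℝ} (hR : 0 < R) :
    ∃ δ, 0 < δ ∧ ∃ ρ, 0 < ρ ∧ ∃ K : ℝ≥0∞, K < ⊤ ∧ ∀ η : Fin m → ℝ, (∀ i, |η i| < δ) →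
      ∀ ε, 0 < ε → volume ({x | |g 0 x + ∑ i, η i * g i.succ x| < ε} ∩ Metric.ball 0 ρ) ≤
        K * ∫⁻ x in Metric.ball 0 R, ENNReal.ofReal ((ε / (ε + |g 0 x|)) ^ κ) := by
  set T := (EuclideanSpace.equiv (Fin n) ℝ).symm with hT
  have hTmp : MeasurePreserving T volume volume := PiLp.volume_preserving_toLp (Fin n)
  have hTe : MeasurableEmbedding T := T.toHomeomorph.measurableEmbedding
  obtain ⟨R', hR', hsub⟩ : ∃ R', 0 < R' ∧ Metric.ball 0 R' ⊆ T ⁻¹' Metric.ball 0 R := by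
    refine Metric.mem_nhds_iff.1 (T.continuous.continuousAt.preimage_mem_nhds ?_)
    rw [map_zero]
    exact Metric.ball_mem_nhds _ hR
  obtain ⟨δ, hδ, ρ, hρ, K, hK, H⟩ := exists_volume_perturbed_sublevel_le
    (g := fun i x => g i (T x)) (fun i => (hgm i).comp hTmp.measurable)
    (fun i => AnalyticAt.comp (by rw [map_zero]; exact hg i)
      (T.toContinuousLinearMap.analyticAt 0)) hκ hk hR'
  refine ⟨δ, hδ, ρ, hρ, K, hK, fun η hη ε hε => ?_⟩
  rw [← hTmp.measure_preimage_emb hTe]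
  calc _ ≤ volume ({x | |g 0 (T x) + ∑ i, η i * g i.succ (T x)| < ε} ∩ Metric.ball 0 ρ) := by
        refine measure_mono fun x hx => ⟨hx.1, ?_⟩
        rw [mem_ball_iff_forall hρ]
        intro i
        have h2 : ‖T x‖ < ρ := by simpa using hx.2
        exact (PiLp.norm_apply_le (T x) i).trans_lt h2
    _ ≤ _ := H η hη ε hε
    _ ≤ K * ∫⁻ x in T ⁻¹' Metric.ball 0 R, ENNReal.ofReal ((ε / (ε + |g 0 (T x)|)) ^ κ) := by
        gcongr
    _ = _ := by
        rw [hTmp.setLIntegral_comp_preimage_emb hTe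
          (fun x => ENNReal.ofReal ((ε / (ε + |g 0 x|)) ^ κ))]

theorem exists_volume_perturbed_sublevel_le_rpow_mul_log {n m : ℕ}
    {g : Fin (m + 1) → EuclideanSpace ℝ (Fin n) → ℝ} (hgm : ∀ i, Measurable (g i))
    (hg : ∀ i, AnalyticAt ℝ (g i) 0) {h κ c R : ℝ} {l : ℕ} (hh : 0 < h) (hκ : h < κ)
    (hk : ∀ i : ℕ, i ≤ m → κ * i ≤ 1) (hR : 0 < R) (hc : 0 < c)
    (hV : (fun ε => (volume.restrict (Metric.ball 0 R)).real {x | |g 0 x| < ε}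
      - c * ε ^ h * Real.log (1 / ε) ^ l) =o[𝓝[>] 0] fun ε => ε ^ h * Real.log (1 / ε) ^ l) :
    ∃ C, 0 < C ∧ ∃ δ, 0 < δ ∧ ∃ ρ, 0 < ρ ∧ ∀ η : Fin m → ℝ, (∀ i, |η i| < δ) →
      ∀ ε, 0 < ε → ε < 1 / 2 →
        volume ({x | |g 0 x + ∑ i, η i * g i.succ x| < ε} ∩ Metric.ball 0 ρ) ≤
          ENNReal.ofReal (C * ε ^ h * Real.log (1 / ε) ^ l) := by
  have : IsFiniteMeasure (volume.restrict (Metric.ball (0 : EuclideanSpace ℝ (Fin n)) R)) :=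
    isFiniteMeasure_restrict.2 measure_ball_lt_top.ne
  obtain ⟨A, hA, hVA⟩ := exists_le_of_isLittleO hh hc (fun _ => measureReal_nonneg)
    (fun ε => measureReal_mono (Set.subset_univ {x | |g 0 x| < ε})) hV
  obtain ⟨δ, hδ, ρ, hρ, K, hK, H⟩ :=
    exists_volume_perturbed_sublevel_le_euclidean hgm hg (hh.trans hκ).le hk hR
  have hr : (2 : ℝ) ^ (h - κ) < 1 := Real.rpow_lt_one_of_one_lt_of_neg one_lt_two (by linarith)
  have hr' : (0 : ℝ) < (1 - 2 ^ (h - κ))⁻¹ := inv_pos.2 (sub_pos.2 hr)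
  refine ⟨(K.toReal + 1) * (2 ^ h * (1 - 2 ^ (h - κ))⁻¹ * A), by positivity, δ, hδ, ρ, hρ,
    fun η hη ε hε hε2 => ?_⟩
  have hl0 : 0 ≤ Real.log (1 / ε) := Real.log_nonneg (by rw [le_div_iff₀ hε]; linarith)
  refine (H η hη ε hε).trans ?_
  calc _ ≤ K * ENNReal.ofReal (2 ^ h * (1 - 2 ^ (h - κ))⁻¹ *
        (A * Real.log (1 / ε) ^ l * ε ^ h)) := by
        gcongr
        refine lintegral_div_add_rpow_le (hgm 0).abs (fun x => abs_nonneg _) hε (by positivity)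
          hh hκ fun ε' hε' => ?_
        rw [← ofReal_measureReal]
        exact ENNReal.ofReal_le_ofReal (hVA ε hε hε2 ε' hε')
    _ ≤ ENNReal.ofReal (K.toReal + 1) * ENNReal.ofReal (2 ^ h * (1 - 2 ^ (h - κ))⁻¹ *
        (A * Real.log (1 / ε) ^ l * ε ^ h)) := by
        gcongr
        rw [← ENNReal.ofReal_toReal hK.ne]
        exact ENNReal.ofReal_le_ofReal (by simp)
    _ = _ := by
        rw [← ENNReal.ofReal_mul (by positivity)]
        congr 1
        ring

theorem tendsto_rpow_mul_log_pow {h : ℝ} (hh : 0 < h) (l : ℕ) :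
    Tendsto (fun ε : ℝ => ε ^ h * Real.log (1 / ε) ^ l) (𝓝[>] 0) (𝓝 0) := by
  have h1 := ((isLittleO_log_rpow_rpow_atTop (l : ℝ) hh).tendsto_div_nhds_zero).comp
    tendsto_inv_nhdsGT_zero
  refine h1.congr' ?_
  filter_upwards [self_mem_nhdsWithin] with ε hε
  rw [Function.comp_apply, Real.rpow_natCast, Real.inv_rpow (le_of_lt hε), div_inv_eq_mul, one_div,
    mul_comm]

theorem lt_of_setLIntegral_rpow_neg_lt_top {n : ℕ} {f : EuclideanSpace ℝ (Fin n) → ℝ}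
    (hf : Measurable f) {h t c R : ℝ} {l : ℕ} (hh : 0 < h) (ht : 0 < t) (hc : 0 < c)
    (hV : (fun ε => (volume.restrict (Metric.ball 0 R)).real {x | |f x| < ε}
      - c * ε ^ h * Real.log (1 / ε) ^ l) =o[𝓝[>] 0] fun ε => ε ^ h * Real.log (1 / ε) ^ l)
    (hint : ∫⁻ x in Metric.ball 0 R, ENNReal.ofReal (|f x| ^ (-t)) < ⊤) : t < h := by
  have : IsFiniteMeasure (volume.restrict (Metric.ball (0 : EuclideanSpace ℝ (Fin n)) R)) :=
    isFiniteMeasure_restrict.2 measure_ball_lt_top.ne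
  refine lt_of_lintegral_rpow_neg_lt_top (c := c / 2 * Real.log 2 ^ l) hf.abs ?_ ht ?_ ?_ hint
  · have := Real.log_pos one_lt_two
    positivity
  · filter_upwards [eventually_ge_of_isLittleO hc hV] with ε hε
    rw [← ofReal_measureReal]
    exact ENNReal.ofReal_le_ofReal hε
  · have h1 := tendsto_rpow_mul_log_pow hh l
    have h2 := (hV.trans_tendsto h1).add (h1.const_mul c)
    have h3 := (ENNReal.tendsto_ofReal h2)
    simp only [mul_zero, add_zero, ENNReal.ofReal_zero] at h3
    refine h3.congr fun ε => ?_
    rw [← ofReal_measureReal]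
    congr 1
    ring

end SublevelStability

open SublevelStability

/-- stability of the sublevel growth rate of a real analytic function under
perturbation by a small linear combination of `m` fixed real analytic functions, where
`h = 1/(m + γ)` with `0 < γ ≤ 1`; and the consequent uniform bound on integrals of
negative powers. -/
theorem stmt11
    (n : ℕ) (hn : 1 ≤ n)
    (q : EuclideanSpace ℝ (Fin n) → ℝ)
    (U : Set (EuclideanSpace ℝ (Fin n))) (hU : U ∈ 𝓝 (0 : EuclideanSpace ℝ (Fin n)))
    (hqa : AnalyticOnNhd ℝ q U) (hq0 : q 0 = 0)
    (h : ℝ) (hh0 : 0 < h)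
    (l : ℕ) (hl : l ≤ n - 1)
    (r₀ : ℝ) (hr₀ : 0 < r₀)
    (hasymp : ∀ r : ℝ, 0 < r → r ≤ r₀ → ∃ c : ℝ, 0 < c ∧
      (fun ε : ℝ =>
          (volume {x : EuclideanSpace ℝ (Fin n) | ‖x‖ < r ∧ |q x| < ε}).toReal
            - c * ε ^ h * (Real.log (1 / ε)) ^ l)
        =o[𝓝[>] (0 : ℝ)] fun ε : ℝ => ε ^ h * (Real.log (1 / ε)) ^ l)
    (m : ℕ) (γ : ℝ) (hγ0 : 0 < γ) (hγ1 : γ ≤ 1) (hhm : h = 1 / (m + γ))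
    (s : Fin m → EuclideanSpace ℝ (Fin n) → ℝ)
    (hsa : ∀ i, AnalyticOnNhd ℝ (s i) U) (hs0 : ∀ i, s i 0 = 0)
    (hind : LinearIndependent ℝ s) :
    ∃ C : ℝ, 0 < C ∧ ∃ δ : ℝ, 0 < δ ∧ ∃ r₁ : ℝ, 0 < r₁ ∧ r₁ < r₀ ∧
      (∀ η : Fin m → ℝ, (∀ i, |η i| < δ) →
        ∀ ε : ℝ, 0 < ε → ε < 1 / 2 →
          (volume {x : EuclideanSpace ℝ (Fin n) |
              ‖x‖ < r₁ ∧ |q x + ∑ i, η i * s i x| < ε}).toReal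
            ≤ C * ε ^ h * (Real.log (1 / ε)) ^ l) ∧
      (∀ t : ℝ, 0 < t →
        (∫⁻ x in Metric.ball (0 : EuclideanSpace ℝ (Fin n)) r₀,
            ENNReal.ofReal (|q x| ^ (-t))) < ⊤ →
        ∃ Dt : ℝ≥0∞, Dt < ⊤ ∧
          ∀ η : Fin m → ℝ, (∀ i, |η i| < δ) →
            (∫⁻ x in Metric.ball (0 : EuclideanSpace ℝ (Fin n)) r₁,
                ENNReal.ofReal (|q x + ∑ i, η i * s i x| ^ (-t))) ≤ Dt) := by
  have h0U : (0 : EuclideanSpace ℝ (Fin n)) ∈ U := mem_of_mem_nhds hU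
  have hG : ∀ i, AnalyticAt ℝ
      (Fin.cons (α := fun _ => EuclideanSpace ℝ (Fin n) → ℝ) q s i) 0 := by
    intro i
    refine Fin.cases ?_ (fun j => ?_) i
    · exact hqa 0 h0U
    · exact hsa j 0 h0U
  choose g hgm hga hge using fun i => exists_measurable_eventuallyEq (hG i)
  obtain ⟨R₁, hR₁, hball⟩ := Metric.eventually_nhds_iff_ball.1 (eventually_all.2 hge)
  set R := min R₁ r₀ with hRdef
  have hR : 0 < R := lt_min hR₁ hr₀
  have hq : ∀ x ∈ Metric.ball 0 R, g 0 x = q x := fun x hx =>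
    hball x (Metric.ball_subset_ball (min_le_left _ _) hx) 0
  have hs : ∀ x ∈ Metric.ball 0 R, ∀ i, g (Fin.succ i) x = s i x := fun x hx i =>
    hball x (Metric.ball_subset_ball (min_le_left _ _) hx) i.succ
  obtain ⟨c, hc, hV⟩ := hasymp R hR (min_le_right _ _)
  have hset : ∀ ε, (volume {x : EuclideanSpace ℝ (Fin n) | ‖x‖ < R ∧ |q x| < ε}).toReal =
      (volume.restrict (Metric.ball 0 R)).real {x | |g 0 x| < ε} := fun ε => by
    rw [measureReal_restrict_apply (measurableSet_lt (hgm 0).abs measurable_const), measureReal_def]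
    congr 2
    ext x
    simp only [Set.mem_ofPred_eq, Set.mem_inter_iff, ← mem_ball_zero_iff, and_comm (a := x ∈ _)]
    exact and_congr_left fun hx => by rw [hq x hx]
  simp only [hset] at hV
  have hmγ : 0 < (m : ℝ) + γ / 2 := by positivity
  obtain ⟨C, hC, δ, hδ, ρ, hρ, H⟩ := exists_volume_perturbed_sublevel_le_rpow_mul_log
    (κ := 1 / (m + γ / 2)) hgm hga hh0
    (by rw [hhm]; exact one_div_lt_one_div_of_lt hmγ (by linarith))
    (fun i hi => by
      have : (i : ℝ) ≤ m := by exact_mod_cast hi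
      rw [one_div, inv_mul_le_iff₀ hmγ]
      linarith) hR hc hV
  have hr₁ : 0 < min (min ρ R) (r₀ / 2) := by positivity
  set r₁ := min (min ρ R) (r₀ / 2) with hr₁def
  have hr₁ρ : r₁ ≤ ρ := (min_le_left _ _).trans (min_le_left _ _)
  have hr₁R : r₁ ≤ R := (min_le_left _ _).trans (min_le_right _ _)
  have heq : ∀ η : Fin m → ℝ, ∀ x ∈ Metric.ball 0 r₁,
      q x + ∑ i, η i * s i x = g 0 x + ∑ i, η i * g i.succ x := fun η x hx => by
    have hx' := Metric.ball_subset_ball hr₁R hx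
    simp only [hq x hx', hs x hx']
  refine ⟨C, hC, δ, hδ, r₁, hr₁, (min_le_right _ _).trans_lt (by linarith),
    fun η hη ε hε hε2 => ?_, fun t ht hint => ?_⟩
  · have hl0 : 0 ≤ Real.log (1 / ε) := Real.log_nonneg (by rw [le_div_iff₀ hε]; linarith)
    refine ENNReal.toReal_le_of_le_ofReal (by positivity)
      ((measure_mono fun x hx => ?_).trans (H η hη ε hε hε2))
    have hx1 : x ∈ Metric.ball 0 r₁ := mem_ball_zero_iff.2 hx.1
    refine ⟨?_, Metric.ball_subset_ball hr₁ρ hx1⟩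
    rw [Set.mem_ofPred_eq, ← heq η x hx1]
    exact hx.2
  · have hth : t < h := by
      refine lt_of_setLIntegral_rpow_neg_lt_top (hgm 0) hh0 ht hc hV (lt_of_le_of_lt ?_ hint)
      refine (setLIntegral_congr_fun measurableSet_ball fun x hx => ?_).trans_le
        (lintegral_mono_set (Metric.ball_subset_ball (min_le_right _ _)))
      simp only [hq x hx]
    obtain ⟨D, hD, HD⟩ := exists_lintegral_rpow_neg_le (l := l)
      (v := volume.real (Metric.ball (0 : EuclideanSpace ℝ (Fin n)) r₁)) hC.le ht hth
    refine ⟨D, hD, fun η hη => ?_⟩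
    have hm : Measurable fun x => |g 0 x + ∑ i, η i * g i.succ x| :=
      ((hgm 0).add (Finset.measurable_sum _ fun i _ => (hgm i.succ).const_mul (η i))).abs
    refine (setLIntegral_congr_fun measurableSet_ball fun x hx => ?_).trans_le
      (HD (volume.restrict (Metric.ball 0 r₁)) _ hm (fun x => abs_nonneg _) ?_
        fun ε hε hε2 => ?_)
    · simp only [heq η x hx]
    · rw [Measure.restrict_apply_univ, ofReal_measureReal measure_ball_lt_top.ne]
    · rw [Measure.restrict_apply (measurableSet_lt hm measurable_const)]
      exact (measure_mono (Set.inter_subset_inter_right _ (Metric.ball_subset_ball hr₁ρ))).trans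
        (H η hη ε hε hε2)
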